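/- arXiv:2303.04312 — 8 statements merged into one kernel-verified Lean document; each statement's English description precedes it below -/
import Mathlib

section
/- Let (R,𝔪) be a finite commutative local ring with identity, with maximal ideal 𝔪 of size m = |𝔪| and residue field R/𝔪 of size q. Let k ∈ ℕ with gcd(k,|R|) = 1, and assume q is even or (q is odd and gcd(k, q−1) divides (q−1)/2). Then for every ℓ ∈ ℕ, the number of cliques of size ℓ in G_R(k) equals the number of cliques of size ℓ in the generalized Paley graph Γ(k,q) times m^ℓ: K_ℓ(G_R(k)) = K_ℓ(Γ(k,q)) · m^ℓ. -/
/-- The number of cliques of size `n` in a graph `G`. -/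
noncomputable def SimpleGraph.cliqueCount {V : Type*} (G : SimpleGraph V) (n : ℕ) : ℕ :=
  Nat.card {s : Finset V // G.IsNClique n s}

/-- The `k`-unitary Cayley graph `G_R(k)` of a commutative ring `R`: distinct `x, y ∈ R` are
adjacent iff `y - x = u^k` for some unit `u ∈ R^*` (symmetrized; under the hypotheses of the
theorems below this relation is already symmetric). -/
def unitaryCayleyGraph (R : Type*) [CommRing R] (k : ℕ) : SimpleGraph R :=
  SimpleGraph.fromRel fun x y => ∃ u : Rˣ, y - x = (u : R) ^ k

/-- The generalized Paley graph `Γ(k,q)` on a finite field `F` with `q` elements: distinct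
`x, y` are adjacent iff `y - x` is a `k`-th power of a nonzero element of `F`. -/
def paleyGraph (F : Type*) [Field F] (k : ℕ) : SimpleGraph F :=
  SimpleGraph.fromRel fun x y => ∃ z : F, z ≠ 0 ∧ y - x = z ^ k

theorem aux_cliqueCount {V W : Type*} [Finite V] [Finite W] (G : SimpleGraph V) (H : SimpleGraph W)
    (f : V → W) (hadj : ∀ x y, G.Adj x y ↔ H.Adj (f x) (f y)) (m : ℕ)
    (hfib : ∀ w, Nat.card {x // f x = w} = m) (n : ℕ) :
    G.cliqueCount n = H.cliqueCount n * m ^ n := by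
  classical
  have := Fintype.ofFinite V
  have := Fintype.ofFinite W
  unfold SimpleGraph.cliqueCount
  let S := Σ t : {t : Finset W // H.IsNClique n t}, ∀ a : t.1, {x // f x = a.1}
  have himg : ∀ p : S, (Finset.univ.image (fun a => (p.2 a).1)).image f = p.1.1 := by
    intro p
    ext w
    simp only [Finset.mem_image, Finset.mem_univ, true_and]
    constructor
    · rintro ⟨x, ⟨a, rfl⟩, rfl⟩
      rw [(p.2 a).2]
      exact a.2
    · intro hw
      exact ⟨_, ⟨⟨w, hw⟩, rfl⟩, (p.2 ⟨w, hw⟩).2⟩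
  let F : S → {s : Finset V // G.IsNClique n s} := fun p =>
    ⟨Finset.univ.image (fun a => (p.2 a).1), by
      have hp := p.1.2
      rw [SimpleGraph.isNClique_iff] at hp ⊢
      constructor
      · intro x hx y hy hxy
        simp only [Finset.coe_image, Finset.coe_univ, Set.image_univ, Set.mem_range] at hx hy
        obtain ⟨a, rfl⟩ := hx
        obtain ⟨b, rfl⟩ := hy
        rw [hadj, (p.2 a).2, (p.2 b).2]
        apply hp.1 a.2 b.2
        intro hab
        apply hxy
        rw [Subtype.ext hab]
      · rw [Finset.card_image_of_injective, Finset.card_univ, Fintype.card_coe, hp.2]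
        intro a b hab
        apply Subtype.ext
        rw [← (p.2 a).2, ← (p.2 b).2]
        exact congrArg f hab⟩
  have hF : Function.Bijective F := by
    constructor
    · rintro ⟨t, g⟩ ⟨t', g'⟩ h
      have h1 : (Finset.univ.image (fun a => (g a).1)) = (Finset.univ.image (fun a => (g' a).1)) :=
        congrArg Subtype.val h
      have e1 := himg ⟨t, g⟩
      have e2 := himg ⟨t', g'⟩
      dsimp only at e1 e2
      have ht : t = t' := by
        apply Subtype.ext
        rw [← e1, ← e2, h1]
      subst ht
      congr 1
      funext a
      apply Subtype.ext
      have : (g a).1 ∈ Finset.univ.image (fun a => (g' a).1) := by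
        rw [← h1]
        exact Finset.mem_image_of_mem _ (Finset.mem_univ a)
      obtain ⟨b, -, hb⟩ := Finset.mem_image.1 this
      have hab : b = a := by
        apply Subtype.ext
        rw [← (g a).2, ← (g' b).2, hb]
      rw [← hb, hab]
    · rintro ⟨s, hs⟩
      have hs' := hs
      rw [SimpleGraph.isNClique_iff] at hs'
      have hinj : Set.InjOn f s := by
        intro x hx y hy hxy
        by_contra hne
        have := (hadj x y).1 (hs'.1 hx hy hne)
        rw [hxy] at this
        exact this.ne rfl
      have ht : H.IsNClique n (s.image f) := by
        rw [SimpleGraph.isNClique_iff]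
        constructor
        · intro a ha b hb hab
          rw [Finset.mem_coe, Finset.mem_image] at ha hb
          obtain ⟨x, hx, rfl⟩ := ha
          obtain ⟨y, hy, rfl⟩ := hb
          rw [← hadj]
          exact hs'.1 hx hy (fun h => hab (by rw [h]))
        · rw [Finset.card_image_of_injOn hinj, hs'.2]
      have hch : ∀ a : (s.image f), ∃ x, x ∈ s ∧ f x = a.1 := fun a => Finset.mem_image.1 a.2
      choose g hg1 hg2 using hch
      refine ⟨⟨⟨s.image f, ht⟩, fun a => ⟨g a, hg2 a⟩⟩, ?_⟩
      apply Subtype.ext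
      change Finset.univ.image g = s
      ext x
      simp only [Finset.mem_image, Finset.mem_univ, true_and]
      constructor
      · rintro ⟨a, rfl⟩
        exact hg1 a
      · intro hx
        refine ⟨⟨f x, Finset.mem_image_of_mem f hx⟩, ?_⟩
        exact hinj (hg1 _) hx (hg2 _)
  rw [← Nat.card_congr (Equiv.ofBijective F hF), Nat.card_sigma]
  have : ∀ t : {t : Finset W // H.IsNClique n t},
      Nat.card (∀ a : t.1, {x // f x = a.1}) = m ^ n := by
    intro t
    rw [Nat.card_pi]
    simp only [hfib, Finset.prod_const, Finset.card_univ, Fintype.card_coe]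
    rw [t.2.card_eq]
  rw [Finset.sum_congr rfl (fun t _ => this t), Finset.sum_const, Finset.card_univ, smul_eq_mul,
    Nat.card_eq_fintype_card]

theorem aux_kth {R : Type*} [CommRing R] [IsLocalRing R] [Finite R] (k : ℕ)
    (hk : Nat.Coprime (Nat.card (IsLocalRing.maximalIdeal R)) k) (a : R) :
    (∃ u : Rˣ, a = (u : R) ^ k) ↔
      ∃ z : IsLocalRing.ResidueField R, z ≠ 0 ∧ IsLocalRing.residue R a = z ^ k := by
  constructor
  · rintro ⟨u, rfl⟩
    exact ⟨IsLocalRing.residue R u, (u.isUnit.map _).ne_zero, map_pow _ _ _⟩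
  · rintro ⟨z, hz, h⟩
    obtain ⟨b, rfl⟩ := IsLocalRing.residue_surjective z
    have hb : IsUnit b := (IsLocalRing.residue_ne_zero_iff_isUnit b).1 hz
    have ha : IsUnit a := by
      rw [← IsLocalRing.residue_ne_zero_iff_isUnit, h]
      exact pow_ne_zero _ hz
    obtain ⟨b, rfl⟩ := hb
    obtain ⟨a, rfl⟩ := ha
    let K := (Units.map (IsLocalRing.residue R).toMonoidHom).ker
    have hmemK : ∀ u : Rˣ, u ∈ K ↔ IsLocalRing.residue R (u : R) = 1 := by
      intro u
      rw [MonoidHom.mem_ker, Units.ext_iff]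
      rfl
    let φ : K → IsLocalRing.maximalIdeal R := fun u => ⟨(u.1 : R) - 1, by
      rw [← IsLocalRing.residue_eq_zero_iff, map_sub, (hmemK _).1 u.2, map_one, sub_self]⟩
    have hφ : Function.Bijective φ := by
      constructor
      · intro u v huv
        have := congrArg Subtype.val huv
        simp only [φ] at this
        exact Subtype.ext (Units.ext (sub_left_injective this))
      · rintro ⟨x, hx⟩
        rw [← IsLocalRing.residue_eq_zero_iff] at hx
        have h1 : IsLocalRing.residue R (1 + x) = 1 := by rw [map_add, hx, map_one, add_zero]
        have hu : IsUnit (1 + x) := by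
          rw [← IsLocalRing.residue_ne_zero_iff_isUnit, h1]
          exact one_ne_zero
        obtain ⟨u, hu⟩ := hu
        refine ⟨⟨u, (hmemK u).2 (by rw [hu, h1])⟩, Subtype.ext ?_⟩
        simp [φ, hu]
    rw [← Nat.card_congr (Equiv.ofBijective φ hφ)] at hk
    have hc : a * (b ^ k)⁻¹ ∈ K := by
      rw [MonoidHom.mem_ker, map_mul, map_inv, mul_inv_eq_one]
      apply Units.ext
      simpa using h
    obtain ⟨v, hv⟩ := (powCoprime hk).surjective ⟨_, hc⟩
    have hv' : (v.1) ^ k = a * (b ^ k)⁻¹ := congrArg Subtype.val hv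
    refine ⟨v.1 * b, ?_⟩
    rw [← Units.val_pow_eq_pow_val, mul_pow, hv', inv_mul_cancel_right]

/-- Let `(R,𝔪)` be a finite commutative local ring with `|𝔪| = m` and residue field of size
`q`, let `k ∈ ℕ` with `gcd(k,|R|) = 1`, and assume `q` is even or `gcd(k,q-1) ∣ (q-1)/2`.
Then `K_ℓ(G_R(k)) = K_ℓ(Γ(k,q)) · m^ℓ` for every `ℓ`. -/
theorem cliqueCount_unitaryCayley_local (R : Type*) [CommRing R] [IsLocalRing R] [Fintype R]
    (k q m : ℕ)
    (hm : Nat.card (IsLocalRing.maximalIdeal R) = m)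
    (hq : Nat.card (IsLocalRing.ResidueField R) = q)
    (hk : Nat.gcd k (Fintype.card R) = 1)
    (hsym : Even q ∨ (Odd q ∧ Nat.gcd k (q - 1) ∣ (q - 1) / 2))
    (F : Type*) [Field F] [Fintype F] (hF : Fintype.card F = q) (ℓ : ℕ) :
    (unitaryCayleyGraph R k).cliqueCount ℓ = (paleyGraph F k).cliqueCount ℓ * m ^ ℓ := by
  classical
  have : Finite (IsLocalRing.ResidueField R) :=
    Finite.of_surjective _ IsLocalRing.residue_surjective
  have : Fintype (IsLocalRing.ResidueField R) := Fintype.ofFinite _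
  have hcard : Fintype.card (IsLocalRing.ResidueField R) = Fintype.card F := by
    rw [hF, ← hq, Nat.card_eq_fintype_card]
  let e : IsLocalRing.ResidueField R ≃+* F := FiniteField.ringEquivOfCardEq hcard
  have hcop : Nat.Coprime (Nat.card (IsLocalRing.maximalIdeal R)) k := by
    have hd : Nat.card (IsLocalRing.maximalIdeal R) ∣ Fintype.card R := by
      rw [← Nat.card_eq_fintype_card]
      exact AddSubgroup.card_addSubgroup_dvd_card (IsLocalRing.maximalIdeal R).toAddSubgroup
    exact (Nat.Coprime.coprime_dvd_right hd hk).symm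
  have key : ∀ a : R, (∃ u : Rˣ, a = (u : R) ^ k) ↔
      ∃ z : F, z ≠ 0 ∧ e (IsLocalRing.residue R a) = z ^ k := by
    intro a
    rw [aux_kth k hcop]
    constructor
    · rintro ⟨z, hz, h⟩
      exact ⟨e z, by simpa using hz, by rw [h, map_pow]⟩
    · rintro ⟨z, hz, h⟩
      refine ⟨e.symm z, by simpa using hz, ?_⟩
      rw [← map_pow, ← h, RingEquiv.symm_apply_apply]
  have hk0 : k ≠ 0 := by
    rintro rfl
    rw [Nat.gcd_zero_left] at hk
    have := Fintype.one_lt_card (α := R)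
    omega
  apply aux_cliqueCount _ _ (fun x => e (IsLocalRing.residue R x))
  · intro x y
    simp only [unitaryCayleyGraph, paleyGraph, SimpleGraph.fromRel_adj, key, map_sub]
    refine and_congr_left fun hor => ?_
    have hne : e (IsLocalRing.residue R x) ≠ e (IsLocalRing.residue R y) := by
      intro heq
      rw [heq] at hor
      simp only [sub_self, or_self] at hor
      obtain ⟨z, hz, h⟩ := hor
      exact pow_ne_zero k hz h.symm
    exact ⟨fun _ => hne, fun _ h => hne (by rw [h])⟩
  · intro w
    obtain ⟨x₀, hx₀⟩ := IsLocalRing.residue_surjective (e.symm w)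
    have hw : w = e (IsLocalRing.residue R x₀) := by rw [hx₀, RingEquiv.apply_symm_apply]
    rw [← hm]
    refine Nat.card_congr ((Equiv.subRight x₀).subtypeEquiv fun x => ?_)
    rw [hw, e.injective.eq_iff, Equiv.subRight_apply, ← IsLocalRing.residue_eq_zero_iff, map_sub,
      sub_eq_zero]
end

section
/- Let (R,𝔪) be a finite commutative local ring with identity, with residue field R/𝔪 of size q. Let k ∈ ℕ with gcd(k,q) = 1, and assume q is even or (q is odd and gcd(k, q−1) divides (q−1)/2). Then the clique number of G_R(k) equals the clique number of the generalized Paley graph Γ(k,q): ω(G_R(k)) = ω(Γ(k,q)). -/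
lemma cliqueNum_eq_of_surj {A B : Type*} (G : SimpleGraph A) (H : SimpleGraph B) (f : A → B)
    (hf : Function.Surjective f) (h : ∀ x y, G.Adj x y ↔ H.Adj (f x) (f y)) :
    G.cliqueNum = H.cliqueNum := by
  classical
  unfold SimpleGraph.cliqueNum
  congr 1
  ext n
  constructor
  · rintro ⟨s, hs, hc⟩
    have inj : Set.InjOn f s := by
      intro x hx y hy hxy
      by_contra hne
      exact ((h x y).1 (hs hx hy hne)).ne hxy
    refine ⟨s.image f, ?_, ?_⟩
    · intro a ha b hb hab
      simp only [Finset.coe_image, Set.mem_image] at ha hb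
      obtain ⟨x, hx, rfl⟩ := ha
      obtain ⟨y, hy, rfl⟩ := hb
      exact (h x y).1 (hs hx hy (fun e => hab (by rw [e])))
    · rw [Finset.card_image_of_injOn inj, hc]
  · rintro ⟨s, hs, hc⟩
    obtain ⟨g, hg⟩ := hf.hasRightInverse
    refine ⟨s.image g, ?_, ?_⟩
    · intro a ha b hb hab
      simp only [Finset.coe_image, Set.mem_image] at ha hb
      obtain ⟨x, hx, rfl⟩ := ha
      obtain ⟨y, hy, rfl⟩ := hb
      rw [h, hg, hg]
      exact hs hx hy (fun e => hab (by rw [e]))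
    · rw [Finset.card_image_of_injective _ hg.injective, hc]

lemma natCast_ne_zero_of_gcd (F : Type*) [Field F] [Fintype F] (k : ℕ)
    (hk : Nat.gcd k (Fintype.card F) = 1) : (k : F) ≠ 0 := by
  intro h0
  obtain ⟨p, hp⟩ := CharP.exists F
  have h1 : p ∣ k := (CharP.cast_eq_zero_iff F p k).1 h0
  have h2 : p ∣ Fintype.card F := (CharP.cast_eq_zero_iff F p _).1 (FiniteField.cast_card_eq_zero F)
  have h3 : p ∣ 1 := hk ▸ Nat.dvd_gcd h1 h2
  exact CharP.char_ne_one F p (Nat.dvd_one.1 h3)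

lemma isPow_lift {R : Type*} [CommRing R] [IsLocalRing R] [Finite R] {F : Type*} [Field F]
    (f : R →+* F) [IsLocalHom f] (hf : Function.Surjective f) (k : ℕ) (hk : (k : F) ≠ 0) (x : R) :
    (∃ u : Rˣ, x = (u : R) ^ k) ↔ ∃ z : F, z ≠ 0 ∧ f x = z ^ k := by
  have hu : ∀ a : R, f a ≠ 0 → IsUnit a := fun a ha => isUnit_of_map_unit f a (isUnit_iff_ne_zero.2 ha)
  have hn : ∀ a : R, f a = 0 → IsNilpotent a := by
    intro a ha
    have hm : a ∈ IsLocalRing.maximalIdeal R := by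
      rw [IsLocalRing.mem_maximalIdeal, mem_nonunits_iff]
      exact fun h => (h.map f).ne_zero ha
    rw [← mem_nilradical, nilradical, ← IsArtinianRing.jacobson_eq_radical, Ideal.zero_eq_bot,
      IsLocalRing.jacobson_eq_maximalIdeal ⊥ bot_ne_top]
    exact hm
  constructor
  · rintro ⟨u, rfl⟩
    exact ⟨f u, (u.isUnit.map f).ne_zero, map_pow f _ _⟩
  · rintro ⟨z, hz, hx⟩
    obtain ⟨a, rfl⟩ := hf z
    have h1 : IsNilpotent (Polynomial.aeval a (Polynomial.X ^ k - Polynomial.C x : Polynomial R)) := by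
      apply hn
      simp [hx]
    have h2 : IsUnit (Polynomial.aeval a
        (Polynomial.derivative (Polynomial.X ^ k - Polynomial.C x : Polynomial R))) := by
      apply hu
      simp [Polynomial.derivative_X_pow, hk, hz]
    obtain ⟨r, ⟨hr1, hr2⟩, -⟩ := Polynomial.existsUnique_nilpotent_sub_and_aeval_eq_zero h1 h2
    have hr : r ^ k = x := by simpa [sub_eq_zero] using hr2
    have hfr : f r ≠ 0 := by
      have := (hr1.map f).eq_zero
      rw [map_sub, sub_eq_zero] at this
      rwa [← this]
    exact ⟨(hu r hfr).unit, by simp [hr]⟩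

/-- Let `(R,𝔪)` be a finite commutative local ring with residue field of size `q`, let
`k ∈ ℕ` with `gcd(k,q) = 1`, and assume `q` is even or `gcd(k,q-1) ∣ (q-1)/2`. Then the clique
number of `G_R(k)` equals the clique number of the generalized Paley graph `Γ(k,q)`. -/
theorem cliqueNum_unitaryCayley_local (R : Type*) [CommRing R] [IsLocalRing R] [Fintype R]
    (k q : ℕ)
    (hq : Nat.card (IsLocalRing.ResidueField R) = q)
    (hk : Nat.gcd k q = 1)
    (hsym : Even q ∨ (Odd q ∧ Nat.gcd k (q - 1) ∣ (q - 1) / 2))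
    (F : Type*) [Field F] [Fintype F] (hF : Fintype.card F = q) :
    (unitaryCayleyGraph R k).cliqueNum = (paleyGraph F k).cliqueNum := by
  subst hF
  have : Fintype (IsLocalRing.ResidueField R) :=
    have := Finite.of_surjective _ (IsLocalRing.residue_surjective (R := R))
    Fintype.ofFinite _
  rw [Nat.card_eq_fintype_card] at hq
  let e := FiniteField.ringEquivOfCardEq hq
  let f : R →+* F := (e : IsLocalRing.ResidueField R →+* F).comp (IsLocalRing.residue R)
  have hf : Function.Surjective f := e.surjective.comp IsLocalRing.residue_surjective
  have hloc : IsLocalHom f := RingHom.isLocalHom_comp _ _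
  have hkF := natCast_ne_zero_of_gcd F k hk
  refine cliqueNum_eq_of_surj _ _ f hf fun x y => ?_
  simp only [unitaryCayleyGraph, paleyGraph, SimpleGraph.fromRel_adj, isPow_lift f hf k hkF, map_sub]
  refine and_congr_left fun h => ⟨fun _ heq => ?_, fun hne heq => hne (by rw [heq])⟩
  rw [heq] at h
  simp only [sub_self, or_self] at h
  obtain ⟨z, hz, h0⟩ := h
  exact pow_ne_zero k hz h0.symm
end

section
/- Let (R,𝔪) be a finite commutative local ring with identity, with residue field R/𝔪 of size q, and let k ∈ ℕ with gcd(k,|R|) = 1. Then −1 is a k-th power of a unit of R (i.e., there exists a unit u ∈ R^* with u^k = −1) if and only if q is even, or q is odd and gcd(k, q−1) divides (q−1)/2. -/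
theorem aux_card_ker_dvd (R : Type*) [CommRing R] [IsLocalRing R] [Fintype R] :
    Nat.card (Units.map (IsLocalRing.residue R : R →* IsLocalRing.ResidueField R)).ker ∣
      Nat.card R := by
  have h : Nat.card (Units.map (IsLocalRing.residue R : R →* IsLocalRing.ResidueField R)).ker =
      Nat.card (IsLocalRing.maximalIdeal R).toAddSubgroup := by
    refine Nat.card_congr (Equiv.ofBijective
      (fun u => ⟨((u : Rˣ) : R) - 1, ?_⟩) ⟨?_, ?_⟩)
    · have := u.2
      rw [MonoidHom.mem_ker, Units.ext_iff] at this
      change ((u : Rˣ) : R) - 1 ∈ IsLocalRing.maximalIdeal R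
      rw [← IsLocalRing.residue_eq_zero_iff, map_sub, map_one, sub_eq_zero]
      simpa using this
    · intro u v huv
      simp only [Subtype.mk.injEq, sub_left_inj] at huv
      exact Subtype.ext (Units.ext huv)
    · rintro ⟨x, hx⟩
      have hx' : IsLocalRing.residue R x = 0 := (IsLocalRing.residue_eq_zero_iff x).2 hx
      have h1 : IsLocalRing.residue R (1 + x) = 1 := by rw [map_add, hx', map_one, add_zero]
      have hu : IsUnit (1 + x) := by
        rw [← IsLocalRing.residue_ne_zero_iff_isUnit, h1]; exact one_ne_zero
      refine ⟨⟨hu.unit, ?_⟩, ?_⟩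
      · rw [MonoidHom.mem_ker, Units.ext_iff]
        simpa using h1
      · simp
  rw [h]
  exact AddSubgroup.card_addSubgroup_dvd_card _

theorem aux_card_residue_dvd (R : Type*) [CommRing R] [IsLocalRing R] [Fintype R] :
    Nat.card (IsLocalRing.ResidueField R) ∣ Nat.card R :=
  AddSubgroup.card_dvd_of_surjective (IsLocalRing.residue R).toAddMonoidHom
    IsLocalRing.residue_surjective

/-- Let `(R,𝔪)` be a finite commutative local ring with residue field of size `q` and let
`k ∈ ℕ` with `gcd(k,|R|) = 1`. Then `-1` is a `k`-th power of a unit of `R` if and only if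
`q` is even, or `q` is odd and `gcd(k, q-1)` divides `(q-1)/2`. -/
theorem neg_one_mem_unit_powers_iff (R : Type*) [CommRing R] [IsLocalRing R] [Fintype R]
    (k q : ℕ)
    (hq : Nat.card (IsLocalRing.ResidueField R) = q)
    (hk : Nat.gcd k (Fintype.card R) = 1) :
    (∃ u : Rˣ, (u : R) ^ k = -1) ↔
      Even q ∨ (Odd q ∧ Nat.gcd k (q - 1) ∣ (q - 1) / 2) := by
  rw [← Nat.card_eq_fintype_card] at hk
  have hqR := aux_card_residue_dvd R
  rw [hq] at hqR
  set F := IsLocalRing.ResidueField R with hF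
  haveI : Finite F := Finite.of_surjective _ (IsLocalRing.residue_surjective (R := R))
  have hcU : Nat.card Fˣ = q - 1 := by rw [Nat.card_units, hq]
  have hq1 : 1 < q := hq ▸ Finite.one_lt_card
  rcases Nat.even_or_odd q with he | ho
  · refine iff_of_true ⟨-1, ?_⟩ (Or.inl he)
    have hko : Odd k := by
      by_contra h
      rw [Nat.not_odd_iff_even] at h
      have := Nat.dvd_gcd h.two_dvd (he.two_dvd.trans hqR)
      rw [hk] at this
      omega
    simpa using hko.neg_one_pow
  · have hne : ¬ Even q := Nat.not_even_iff_odd.2 ho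
    simp only [hne, ho, false_or, true_and]
    have h2 : (-1 : F) ≠ 1 := by
      intro h
      have hch : ringChar F = 2 := by
        by_contra h'
        exact Ring.neg_one_ne_one_of_char_ne_two h' h
      haveI := Fintype.ofFinite F
      have := FiniteField.even_card_of_char_two hch
      rw [← Nat.card_eq_fintype_card, hq] at this
      exact hne (Nat.even_iff.2 this)
    have hd := Nat.gcd_dvd_left k (q - 1)
    have hd' := Nat.gcd_dvd_right k (q - 1)
    have hdpos : 0 < Nat.gcd k (q - 1) := Nat.gcd_pos_of_pos_right _ (by omega)
    have hq2 : 2 ∣ q - 1 := by obtain ⟨t, rfl⟩ := ho; exact ⟨t, by omega⟩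
    constructor
    · rintro ⟨u, hu⟩
      set a : Fˣ := Units.map (IsLocalRing.residue R : R →* F) u
      have ha : a ^ k = -1 := by
        ext
        have := congrArg (IsLocalRing.residue R) hu
        simpa [a] using this
      obtain ⟨c, hc⟩ := hd
      obtain ⟨e, he⟩ := hd'
      have h1 : (-1 : Fˣ) ^ e = 1 := by
        rw [← ha, ← pow_mul]
        have : k * e = (q - 1) * c := by
          calc k * e = (k.gcd (q-1) * c) * e := by rw [← hc]
            _ = (k.gcd (q-1) * e) * c := by ring
            _ = _ := by rw [← he]
        rw [this, pow_mul, ← hcU, pow_card_eq_one', one_pow]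
      have hee : Even e := by
        by_contra h
        rw [Nat.not_even_iff_odd] at h
        rw [h.neg_one_pow] at h1
        exact h2 (by simpa using congrArg Units.val h1)
      obtain ⟨f, hf⟩ := hee
      refine ⟨f, ?_⟩
      have : q - 1 = 2 * (k.gcd (q-1) * f) := by
        calc q - 1 = k.gcd (q-1) * e := he
          _ = _ := by rw [hf]; ring
      omega
    · intro hdiv
      obtain ⟨g, hg⟩ := IsCyclic.exists_generator (α := Fˣ)
      obtain ⟨j, hj⟩ := Subgroup.mem_zpowers_iff.1 (hg (-1))
      have ho : orderOf g = q - 1 := by rw [← hcU]; exact orderOf_eq_card_of_forall_mem_zpowers hg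
      have hj2 : ((q - 1 : ℕ) : ℤ) ∣ 2 * j := by
        rw [← ho, orderOf_dvd_iff_zpow_eq_one, mul_comm, zpow_mul, hj]
        simp
      have hdj : ((k.gcd (q-1) : ℕ) : ℤ) ∣ j := by
        refine (Int.natCast_dvd_natCast.2 hdiv).trans ?_
        obtain ⟨t, ht⟩ := hq2
        rw [ht] at hj2 ⊢
        rw [Nat.mul_div_cancel_left _ (by norm_num)]
        push_cast at hj2
        exact (mul_dvd_mul_iff_left (by norm_num)).1 hj2
      obtain ⟨c, hc⟩ := hdj
      rw [Nat.gcd_eq_gcd_ab] at hc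
      obtain ⟨a, ha⟩ : ∃ a : Fˣ, a ^ k = -1 := by
        refine ⟨g ^ (k.gcdA (q-1) * c), ?_⟩
        rw [← hj, hc, add_mul, zpow_add, mul_assoc ((q-1 : ℕ) : ℤ), zpow_mul g ((q-1 : ℕ) : ℤ),
          zpow_natCast, ← ho, pow_orderOf_eq_one, one_zpow, mul_one, ← zpow_natCast, ← zpow_mul]
        congr 1
        ring
      obtain ⟨r, hr⟩ := IsLocalRing.residue_surjective (R := R) (a : F)
      have hru : IsUnit r := by
        rw [← IsLocalRing.residue_ne_zero_iff_isUnit, hr]; exact a.ne_zero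
      obtain ⟨v, rfl⟩ := hru
      set K := (Units.map (IsLocalRing.residue R : R →* F)).ker with hK
      have hmem : -v ^ k ∈ K := by
        rw [hK, MonoidHom.mem_ker, Units.ext_iff]
        have := congrArg Units.val ha
        simp only [Units.val_pow_eq_pow_val, Units.val_neg, Units.val_one] at this
        simp [hr, this]
      have hcop : (Nat.card K).Coprime k :=
        (Nat.Coprime.coprime_dvd_right (aux_card_ker_dvd R) hk).symm
      obtain ⟨w, hw⟩ := (powCoprime hcop).surjective ⟨-v ^ k, hmem⟩
      have hw' : (w : Rˣ) ^ k = -v ^ k := by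
        simpa using congrArg Subtype.val hw
      refine ⟨v * (w : Rˣ)⁻¹, ?_⟩
      have : (v * (w : Rˣ)⁻¹) ^ k = -1 := by
        rw [mul_pow, inv_pow, hw', mul_inv_eq_iff_eq_mul]
        simp
      simpa using congrArg Units.val this
end

section
/- Let (R,𝔪) be a finite commutative local ring with identity, with residue field R/𝔪 of size q = p^r (p prime), and let k ∈ ℕ with gcd(k,|R|) = 1. Assume q is even or gcd(k, q−1) divides (q−1)/2, so that G_R(k) is a simple undirected graph. Then G_R(k) is connected if and only if n = (q−1)/gcd(k,q−1) is a primitive divisor of q−1, i.e. n divides p^r − 1 and n does not divide p^a − 1 for any integer a with 1 ≤ a < r. -/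
/-- The additive subgroup generated by the `k`-th powers of units. -/
def powClosure (A : Type*) [CommRing A] (k : ℕ) : AddSubgroup A :=
  AddSubgroup.closure (Set.range fun u : Aˣ => (u : A) ^ k)

theorem connected_iff_powClosure (R : Type*) [CommRing R] [Nontrivial R] (k : ℕ) :
    (unitaryCayleyGraph R k).Connected ↔ powClosure R k = ⊤ := by
  constructor
  · intro h
    rw [AddSubgroup.eq_top_iff']
    intro x
    have key : ∀ a b : R, (unitaryCayleyGraph R k).Walk a b → b - a ∈ powClosure R k := by
      intro a b w
      induction w with
      | nil => simp [AddSubgroup.zero_mem]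
      | @cons a b c hab _ ih =>
        have h1 : b - a ∈ powClosure R k := by
          rw [unitaryCayleyGraph, SimpleGraph.fromRel_adj] at hab
          rcases hab.2 with ⟨u, hu⟩ | ⟨u, hu⟩
          · rw [hu]; exact AddSubgroup.subset_closure ⟨u, rfl⟩
          · rw [← neg_sub, hu]
            exact AddSubgroup.neg_mem _ (AddSubgroup.subset_closure ⟨u, rfl⟩)
        have := AddSubgroup.add_mem _ ih h1
        simpa using this
    obtain ⟨w⟩ := h.preconnected 0 x
    simpa using key 0 x w
  · intro h
    have key : ∀ y ∈ powClosure R k, ∀ x : R, (unitaryCayleyGraph R k).Reachable x (x + y) := by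
      intro y hy
      refine AddSubgroup.closure_induction ?_ ?_ ?_ ?_ hy
      · rintro _ ⟨u, rfl⟩ x
        apply SimpleGraph.Adj.reachable
        rw [unitaryCayleyGraph, SimpleGraph.fromRel_adj]
        refine ⟨?_, Or.inl ⟨u, by simp⟩⟩
        have : (u : R) ^ k ≠ 0 := (u.isUnit.pow k).ne_zero
        simpa using this
      · intro x; simp
      · intro a b _ _ ha hb x
        rw [← add_assoc]
        exact (ha x).trans (hb _)
      · intro a _ ha x
        have := (ha (x + -a)).symm
        simpa using this
    haveI : Nonempty R := ⟨0⟩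
    refine SimpleGraph.Connected.mk ?_
    intro x y
    have := key (y - x) (by rw [h]; trivial) x
    simpa using this

open IsLocalRing in
theorem one_add_isPow (R : Type*) [CommRing R] [IsLocalRing R] [Fintype R] (k : ℕ)
    (hk : Nat.gcd k (Fintype.card R) = 1) (w : Rˣ)
    (hw : Units.map (residue R : R →* ResidueField R) w = 1) : ∃ v : Rˣ, v ^ k = w := by
  let K := (Units.map (residue R : R →* ResidueField R)).ker
  let e : K ≃ maximalIdeal R :=
    { toFun := fun x => ⟨((x : Rˣ) : R) - 1, by
        rw [← residue_eq_zero_iff, map_sub, map_one, sub_eq_zero]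
        have := congrArg Units.val (MonoidHom.mem_ker.1 x.2)
        simpa using this⟩
      invFun := fun m =>
        have hu : IsUnit (1 + (m : R)) := by
          have h1 : residue R (1 + (m : R)) ≠ 0 := by
            rw [map_add, (residue_eq_zero_iff _).2 m.2]; simp
          exact (residue_ne_zero_iff_isUnit _).1 h1
        ⟨hu.unit, by
          rw [MonoidHom.mem_ker]
          ext
          simp [(residue_eq_zero_iff _).2 m.2]⟩
      left_inv := fun x => by ext; simp
      right_inv := fun m => by ext; simp }
  have hc : Nat.card K ∣ Fintype.card R := by
    rw [Nat.card_congr e, ← Nat.card_eq_fintype_card]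
    exact AddSubgroup.card_addSubgroup_dvd_card (Submodule.toAddSubgroup (maximalIdeal R))
  have hcop : (Nat.card K).Coprime k :=
    (Nat.Coprime.coprime_dvd_right hc hk).symm
  obtain ⟨v, hv⟩ := (powCoprime hcop).surjective ⟨w, hw⟩
  refine ⟨v, ?_⟩
  have := congrArg (fun x : K => (x : Rˣ)) hv
  simpa using this

open IsLocalRing in
theorem powClosure_residue (R : Type*) [CommRing R] [IsLocalRing R] [Fintype R] (k : ℕ)
    (hk : Nat.gcd k (Fintype.card R) = 1) :
    powClosure R k = ⊤ ↔ powClosure (ResidueField R) k = ⊤ := by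
  have hlift : Function.Surjective (Units.map (residue R : R →* ResidueField R)) :=
    surjective_units_map_of_local_ringHom (residue R) residue_surjective inferInstance
  have hmap : (powClosure R k).map (residue R : R →+ ResidueField R)
      = powClosure (ResidueField R) k := by
    rw [powClosure, AddMonoidHom.map_closure, powClosure]
    congr 1
    ext x
    constructor
    · rintro ⟨_, ⟨u, rfl⟩, rfl⟩
      exact ⟨Units.map (residue R : R →* ResidueField R) u, by simp⟩
    · rintro ⟨v, rfl⟩
      obtain ⟨u, rfl⟩ := hlift v
      exact ⟨_, ⟨u, rfl⟩, by simp⟩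
  have hker : ∀ m : R, residue R m = 0 → m ∈ powClosure R k := by
    intro m hm
    have hu : IsUnit (1 + m) := by
      apply (residue_ne_zero_iff_isUnit _).1
      rw [map_add, hm]; simp
    obtain ⟨v, hv⟩ := one_add_isPow R k hk hu.unit (by ext; simp [hm])
    have h1 : (1 + m) ∈ powClosure R k := AddSubgroup.subset_closure ⟨v, by
      have := congrArg Units.val hv
      simpa using this⟩
    have h2 : (1 : R) ∈ powClosure R k := AddSubgroup.subset_closure ⟨1, by simp⟩
    simpa using AddSubgroup.sub_mem _ h1 h2
  constructor
  · intro h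
    rw [← hmap, h]
    rw [AddSubgroup.eq_top_iff']
    intro x
    obtain ⟨y, rfl⟩ := residue_surjective x
    exact ⟨y, trivial, rfl⟩
  · intro h
    rw [AddSubgroup.eq_top_iff']
    intro x
    have hx : residue R x ∈ (powClosure R k).map (residue R : R →+ ResidueField R) := by
      rw [hmap, h]; trivial
    obtain ⟨y, hy, hyx⟩ := hx
    have := AddSubgroup.add_mem _ (hker (x - y) (by rw [map_sub, ← hyx]; simp)) hy
    simpa using this

theorem powClosure_mul (F : Type*) [CommRing F] (k : ℕ) {a b : F} (ha : a ∈ powClosure F k)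
    (hb : b ∈ powClosure F k) : a * b ∈ powClosure F k := by
  refine AddSubgroup.closure_induction ?_ ?_ ?_ ?_ ha
  · rintro _ ⟨u, rfl⟩
    refine AddSubgroup.closure_induction ?_ ?_ ?_ ?_ hb
    · rintro _ ⟨v, rfl⟩
      exact AddSubgroup.subset_closure ⟨u * v, by simp [mul_pow]⟩
    · simp [AddSubgroup.zero_mem]
    · intro x y _ _ hx hy
      rw [mul_add]; exact AddSubgroup.add_mem _ hx hy
    · intro x _ hx
      rw [mul_neg]; exact AddSubgroup.neg_mem _ hx
  · simp [AddSubgroup.zero_mem]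
  · intro x y _ _ hx hy
    rw [add_mul]; exact AddSubgroup.add_mem _ hx hy
  · intro x _ hx
    rw [neg_mul]; exact AddSubgroup.neg_mem _ hx

/-- The closure as a subring. -/
def powSubring (F : Type*) [CommRing F] (k : ℕ) : Subring F :=
  { powClosure F k with
    mul_mem' := fun ha hb => powClosure_mul F k ha hb
    one_mem' := AddSubgroup.subset_closure ⟨1, by simp⟩ }

theorem field_case (F : Type*) [Field F] [Finite F] (k p r : ℕ) (hp : p.Prime)
    (hq : Nat.card F = p ^ r) (hk : k ≠ 0) :
    powClosure F k = ⊤ ↔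
      ∀ a : ℕ, 1 ≤ a → a < r → ¬ (p ^ r - 1) / Nat.gcd k (p ^ r - 1) ∣ p ^ a - 1 := by
  haveI := Fintype.ofFinite F
  have hr : r ≠ 0 := by
    rintro rfl
    have := Finite.one_lt_card (α := F)
    rw [hq, pow_zero] at this; omega
  haveI : Fact p.Prime := ⟨hp⟩
  haveI : CharP F p := by
    obtain ⟨p', hp'⟩ := CharP.exists F
    obtain ⟨n, hpp, hn⟩ := FiniteField.card F p'
    rw [← Nat.card_eq_fintype_card, hq] at hn
    have : p ∣ p' ^ (n : ℕ) := hn ▸ dvd_pow_self p hr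
    have := (Nat.prime_dvd_prime_iff_eq hp hpp).1 (hp.dvd_of_dvd_pow this)
    rwa [this]
  have hU : Nat.card Fˣ = p ^ r - 1 := by rw [Nat.card_units, hq]
  constructor
  · intro h a ha har hdvd
    have hfix : ∀ x ∈ powClosure F k, x ^ (p ^ a) = x := by
      intro x hx
      refine AddSubgroup.closure_induction ?_ ?_ ?_ ?_ hx
      · rintro _ ⟨u, rfl⟩
        have h1 : (u ^ k) ^ ((p ^ r - 1) / Nat.gcd k (p ^ r - 1)) = 1 := by
          rw [← pow_mul, ← Nat.mul_div_assoc _ (Nat.gcd_dvd_right _ _), mul_comm,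
            Nat.mul_div_assoc _ (Nat.gcd_dvd_left _ _), pow_mul, ← hU, pow_card_eq_one', one_pow]
        obtain ⟨c, hc⟩ := hdvd
        have h2 : (u ^ k) ^ (p ^ a - 1) = 1 := by rw [hc, pow_mul, h1, one_pow]
        have h3 : (u ^ k) ^ (p ^ a) = u ^ k := by
          conv_lhs => rw [← Nat.sub_add_cancel (Nat.one_le_pow a p hp.pos)]
          rw [pow_succ, h2, one_mul]
        have := congrArg Units.val h3
        simpa using this
      · exact zero_pow (pow_ne_zero _ hp.ne_zero)
      · intro x y _ _ hx hy
        rw [add_pow_char_pow, hx, hy]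
      · intro x _ hx
        have h0 : (-x + x) ^ p ^ a = 0 := by
          rw [neg_add_cancel]; exact zero_pow (pow_ne_zero _ hp.ne_zero)
        rw [add_pow_char_pow, hx] at h0
        exact eq_neg_of_add_eq_zero_left h0
    have h1p : 1 < p ^ a := Nat.one_lt_pow (by omega) hp.one_lt
    have hcard : Nat.card F ≤ p ^ a := by
      classical
      have hne : (Polynomial.X ^ (p ^ a) - Polynomial.X : Polynomial F) ≠ 0 :=
        FiniteField.X_pow_card_sub_X_ne_zero F h1p
      have hdeg := FiniteField.X_pow_card_sub_X_natDegree_eq F h1p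
      rw [Nat.card_eq_fintype_card, ← Finset.card_univ, ← hdeg]
      refine Polynomial.card_le_degree_of_subset_roots (Z := Finset.univ) ?_
      intro x _
      rw [Polynomial.mem_roots hne]
      have := hfix x (by rw [h]; trivial)
      simp [this]
    rw [hq] at hcard
    exact absurd hcard (not_le.2 (Nat.pow_lt_pow_right hp.one_lt har))
  · intro h
    have hdvd : Nat.card (powClosure F k) ∣ p ^ r := hq ▸ AddSubgroup.card_addSubgroup_dvd_card _
    obtain ⟨a, har, hcard⟩ := (Nat.dvd_prime_pow hp).1 hdvd
    have hcardS : Nat.card (powSubring F k) = p ^ a := hcard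
    by_cases hlt : a < r
    swap
    · have : a = r := by omega
      subst this
      apply AddSubgroup.eq_top_of_card_eq
      rw [hcard, hq]
    exfalso
    have ha : 1 ≤ a := by
      have := Finite.one_lt_card (α := powSubring F k)
      rw [hcardS] at this
      by_contra h0
      have : a = 0 := by omega
      subst this
      simp at *
    apply h a ha hlt
    obtain ⟨g, hg⟩ := IsCyclic.exists_ofOrder_eq_natCard (α := Fˣ)
    have hord : orderOf (g ^ k) = (p ^ r - 1) / Nat.gcd k (p ^ r - 1) := by
      rw [orderOf_pow, hg, hU, Nat.gcd_comm]
    rw [← hord]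
    apply orderOf_dvd_of_pow_eq_one
    letI := Fintype.ofFinite (powSubring F k)
    letI : Field (powSubring F k) := (Finite.isField_of_domain (powSubring F k)).toField
    let s : powSubring F k := ⟨(g : F) ^ k, AddSubgroup.subset_closure ⟨g, rfl⟩⟩
    have hs : s ≠ 0 := by
      intro h0
      have := congrArg Subtype.val h0
      exact (g.isUnit.pow k).ne_zero this
    have hpow := FiniteField.pow_card_sub_one_eq_one s hs
    rw [← Nat.card_eq_fintype_card, hcardS] at hpow
    have h2 : ((g : F) ^ k) ^ (p ^ a - 1) = 1 := congrArg Subtype.val hpow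
    ext
    simpa using h2

/-- Let `(R,𝔪)` be a finite commutative local ring with residue field of size `q = p^r`
(`p` prime), and `k ∈ ℕ` with `gcd(k,|R|) = 1`; assume `q` is even or `gcd(k,q-1) ∣ (q-1)/2`,
so `G_R(k)` is a simple undirected graph. Then `G_R(k)` is connected iff
`n = (q-1)/gcd(k,q-1)` is a primitive divisor of `q - 1 = p^r - 1`. -/
theorem unitaryCayley_connected_iff (R : Type*) [CommRing R] [IsLocalRing R] [Fintype R]
    (k q p r : ℕ) (hp : p.Prime) (hqpr : q = p ^ r)
    (hq : Nat.card (IsLocalRing.ResidueField R) = q)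
    (hk : Nat.gcd k (Fintype.card R) = 1)
    (hsym : Even q ∨ (Odd q ∧ Nat.gcd k (q - 1) ∣ (q - 1) / 2)) :
    (unitaryCayleyGraph R k).Connected ↔
      ((q - 1) / Nat.gcd k (q - 1) ∣ p ^ r - 1 ∧
        ∀ a : ℕ, 1 ≤ a → a < r → ¬ (q - 1) / Nat.gcd k (q - 1) ∣ p ^ a - 1) := by
  haveI : Finite (IsLocalRing.ResidueField R) :=
    Finite.of_surjective _ (IsLocalRing.residue_surjective (R := R))
  subst hqpr
  have hk0 : k ≠ 0 := by
    rintro rfl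
    rw [Nat.gcd_zero_left] at hk
    have := Fintype.one_lt_card (α := R)
    omega
  rw [connected_iff_powClosure, powClosure_residue R k hk,
    field_case (IsLocalRing.ResidueField R) k p r hp hq hk0]
  exact ⟨fun h => ⟨Nat.div_dvd_of_dvd (Nat.gcd_dvd_right _ _), h⟩, fun h => h.2⟩
end

section
/- Let (R,𝔪) be a finite commutative local ring with identity, with maximal ideal of size |𝔪| = q^β and residue field R/𝔪 of size q, where gcd(2,|R|) = 1 and q ≡ 1 (mod 4). Then the number of triangles in G_R(2) is K_3(G_R(2)) = q^(3β+1) (q−1)(q−5) / 48. -/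
namespace TriangleAux

open Finset

/-- Six times the number of triangles is the number of ordered triangles. -/
lemma six_mul {V : Type*} [Fintype V] [DecidableEq V] (G : SimpleGraph V) [DecidableRel G.Adj] :
    6 * G.cliqueCount 3 =
      #{p : V × V × V | G.Adj p.1 p.2.1 ∧ G.Adj p.1 p.2.2 ∧ G.Adj p.2.1 p.2.2} := by
  have hc : G.cliqueCount 3 = #(G.cliqueFinset 3) := by
    rw [SimpleGraph.cliqueCount, ← Nat.card_eq_finsetCard]
    exact Nat.card_congr (Equiv.subtypeEquivRight fun s => SimpleGraph.mem_cliqueFinset_iff.symm)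
  rw [hc, card_eq_sum_card_fiberwise (f := fun p : V × V × V => ({p.1, p.2.1, p.2.2} : Finset V))
    (t := G.cliqueFinset 3)]
  · rw [sum_const_nat (m := 6), mul_comm]
    intro s hs
    rw [SimpleGraph.mem_cliqueFinset_iff, SimpleGraph.is3Clique_iff] at hs
    obtain ⟨a, b, c, hab, hac, hbc, rfl⟩ := hs
    have h1 := hab.ne
    have h2 := hac.ne
    have h3 := hbc.ne
    have : ({p ∈ ({p : V × V × V | G.Adj p.1 p.2.1 ∧ G.Adj p.1 p.2.2 ∧ G.Adj p.2.1 p.2.2} :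
        Finset (V × V × V)) | ({p.1, p.2.1, p.2.2} : Finset V) = {a, b, c}}) =
        {(a, b, c), (a, c, b), (b, a, c), (b, c, a), (c, a, b), (c, b, a)} := by
      ext ⟨x, y, z⟩
      simp only [mem_filter, mem_univ, true_and, mem_insert, mem_singleton, Prod.mk.injEq]
      constructor
      · rintro ⟨⟨hxy, hxz, hyz⟩, h⟩
        have hx : x ∈ ({a, b, c} : Finset V) := by rw [← h]; simp
        have hy : y ∈ ({a, b, c} : Finset V) := by rw [← h]; simp
        have hz : z ∈ ({a, b, c} : Finset V) := by rw [← h]; simp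
        have g1 := hxy.ne
        have g2 := hxz.ne
        have g3 := hyz.ne
        simp only [mem_insert, mem_singleton] at hx hy hz
        clear h hc
        grind
      · have hba := hab.symm
        have hca := hac.symm
        have hcb := hbc.symm
        rintro (⟨rfl, rfl, rfl⟩ | ⟨rfl, rfl, rfl⟩ | ⟨rfl, rfl, rfl⟩ | ⟨rfl, rfl, rfl⟩ |
          ⟨rfl, rfl, rfl⟩ | ⟨rfl, rfl, rfl⟩) <;>
        refine ⟨⟨by assumption, by assumption, by assumption⟩, ?_⟩ <;>
        ext w <;> simp only [mem_insert, mem_singleton] <;> tauto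
    rw [this]
    simp [card_insert_of_notMem, h1, h2, h3, h1.symm, h2.symm, h3.symm]
  · intro p hp
    simp only [coe_filter, mem_univ, true_and, Set.mem_ofPred_eq] at hp
    simp only [SimpleGraph.coe_cliqueFinset, SimpleGraph.mem_cliqueSet_iff]
    exact SimpleGraph.is3Clique_iff.2 ⟨_, _, _, hp.1, hp.2.1, hp.2.2, rfl⟩

section field
variable {F : Type*} [Field F] [Fintype F] [DecidableEq F]

/-- Twice the indicator function of nonzero squares. -/
noncomputable def g (a : F) : ℤ := (1 : MulChar F ℤ) a + quadraticChar F a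

lemma g_eq (a : F) : g a = 2 * (if a ≠ 0 ∧ IsSquare a then 1 else 0) := by
  unfold g
  by_cases ha : a = 0
  · subst ha
    rw [MulChar.map_zero, MulChar.map_zero]
    simp
  · rw [MulChar.one_apply (IsUnit.mk0 a ha)]
    by_cases h : IsSquare a
    · rw [(quadraticChar_one_iff_isSquare ha).2 h]; simp [ha, h]
    · rw [quadraticChar_neg_one_iff_not_isSquare.2 h]; simp [h]

lemma char_ne (h : Fintype.card F % 4 = 1) : ringChar F ≠ 2 := by
  intro h2
  have := FiniteField.even_card_iff_char_two.1 h2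
  omega

lemma sum_g (h : Fintype.card F % 4 = 1) : ∑ a : F, g a = Fintype.card F - 1 := by
  simp only [g, sum_add_distrib, quadraticChar_sum_zero (char_ne h), MulChar.sum_one_eq_card_units]
  rw [Fintype.card_units, Nat.cast_sub Fintype.card_pos]
  simp

lemma chi_neg_one (h : Fintype.card F % 4 = 1) : quadraticChar F (-1) = 1 := by
  rw [quadraticChar_one_iff_isSquare (by simp), FiniteField.isSquare_neg_one_iff]
  omega

lemma sum_gg (h : Fintype.card F % 4 = 1) :
    ∑ a : F, g a * g (1 - a) = Fintype.card F - 5 := by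
  have hn := quadraticChar_ne_one (char_ne h)
  have e : ∑ a : F, g a * g (1 - a) = jacobiSum (1 : MulChar F ℤ) 1 +
      jacobiSum 1 (quadraticChar F) + jacobiSum (quadraticChar F) 1 +
      jacobiSum (quadraticChar F) (quadraticChar F) := by
    simp only [jacobiSum, g, ← sum_add_distrib]
    exact sum_congr rfl fun _ _ => by ring
  have hi := jacobiSum_nontrivial_inv hn
  rw [(quadraticChar_isQuadratic F).inv, chi_neg_one h] at hi
  rw [e, jacobiSum_comm (quadraticChar F) 1, jacobiSum_one_one, jacobiSum_one_nontrivial hn, hi]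
  ring

lemma g_mul (a b : F) (h : g a ≠ 0) : g (a * b) = g b := by
  have ha : a ≠ 0 ∧ IsSquare a := by
    by_contra hh
    rw [g_eq, if_neg hh] at h
    simp at h
  unfold g
  rw [map_mul, map_mul, MulChar.one_apply (IsUnit.mk0 a ha.1),
    (quadraticChar_one_iff_isSquare ha.1).2 ha.2, one_mul, one_mul]

lemma sum_field (h : Fintype.card F % 4 = 1) :
    ∑ a : F, ∑ b : F, ∑ c : F, g (b - a) * g (c - a) * g (c - b) =
      Fintype.card F * ((Fintype.card F - 1) * (Fintype.card F - 5)) := by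
  have neg (a : F) : g (-a) = g a := by
    have := g_mul (-1 : F) a (by
      unfold g
      rw [chi_neg_one h, MulChar.one_apply (by simp)]
      norm_num)
    simpa using this
  have key (a : F) : ∑ b : F, ∑ c : F, g (b - a) * g (c - a) * g (c - b) =
      (Fintype.card F - 1) * (Fintype.card F - 5) := by
    rw [← Equiv.sum_comp (Equiv.addRight a)]
    rw [← sum_g h, sum_mul]
    refine sum_congr rfl fun b _ => ?_
    rw [← Equiv.sum_comp (Equiv.addRight a)]
    simp only [Equiv.coe_addRight, add_sub_cancel_right, add_sub_add_right_eq_sub, mul_assoc]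
    rw [← mul_sum]
    by_cases hb : g b = 0
    · simp [hb]
    · have hb0 : b ≠ 0 := by
        rintro rfl
        simp [g_eq] at hb
      rw [← sum_gg h, ← Equiv.sum_comp (Equiv.mulLeft₀ b hb0)]
      congr 1
      refine sum_congr rfl fun c _ => ?_
      change g (b * c) * g (b * c - b) = _
      rw [show b * c - b = b * (-(1 - c)) by ring, g_mul _ _ hb, g_mul _ _ hb, neg]
  simp [key]

end field

section ring
variable {R : Type*} [CommRing R] [IsLocalRing R] [Fintype R]

open IsLocalRing

lemma exists_sq_one (h2 : IsUnit (2 : R)) (a : R) (ha : a - 1 ∈ maximalIdeal R) :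
    ∃ b : R, a = b ^ 2 := by
  let f : maximalIdeal R → maximalIdeal R := fun x => ⟨(x : R) ^ 2 + 2 * x, by
    have := x.2
    rw [pow_two, ← add_mul]
    exact Ideal.mul_mem_left _ _ this⟩
  have hf : Function.Injective f := by
    intro x y hxy
    have h1 : (x : R) ^ 2 + 2 * x = (y : R) ^ 2 + 2 * y := congrArg Subtype.val hxy
    have hu : IsUnit ((x : R) + y + 2) := by
      by_contra hh
      have hm : (x : R) + y + 2 ∈ maximalIdeal R := hh
      have : (2 : R) ∈ maximalIdeal R := by
        have := Ideal.sub_mem _ hm (Ideal.add_mem _ x.2 y.2)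
        simpa using this
      exact this h2
    have h3 : ((x : R) + y + 2) * (x - y) = 0 := by linear_combination h1
    have := hu.mul_right_eq_zero.1 h3
    exact Subtype.ext (sub_eq_zero.1 this)
  obtain ⟨x, hx⟩ := (Finite.injective_iff_surjective.1 hf) ⟨a - 1, ha⟩
  have h1 : (x : R) ^ 2 + 2 * x = a - 1 := congrArg Subtype.val hx
  exact ⟨x + 1, by linear_combination -h1⟩

lemma exists_unit_sq_iff (h2 : IsUnit (2 : R)) (a : R) :
    (∃ u : Rˣ, a = (u : R) ^ 2) ↔ residue R a ≠ 0 ∧ IsSquare (residue R a) := by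
  constructor
  · rintro ⟨u, rfl⟩
    exact ⟨((u.isUnit.pow 2).map (residue R)).ne_zero, by rw [map_pow]; exact IsSquare.sq _⟩
  · rintro ⟨h0, ⟨c, hc⟩⟩
    obtain ⟨c, rfl⟩ := residue_surjective c
    have hcu : IsUnit c := by
      by_contra hh
      exact h0 (by rw [hc, (residue_eq_zero_iff c).2 hh, mul_zero])
    have hau : IsUnit a := by
      by_contra hh
      exact h0 ((residue_eq_zero_iff a).2 hh)
    obtain ⟨v, rfl⟩ := hcu
    obtain ⟨b, hb⟩ := exists_sq_one h2 (a * (↑(v⁻¹) : R) ^ 2) (by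
      rw [← residue_eq_zero_iff, map_sub, map_mul, hc, ← map_mul, ← map_mul, ← map_sub]
      have : (v : R) * v * (↑(v⁻¹) : R) ^ 2 - 1 = 0 := by
        have := v.mul_inv
        linear_combination ((v : R) * ↑(v⁻¹) + 1) * this
      rw [this, map_zero])
    have hab : a = (b * v) ^ 2 := by
      have := v.mul_inv
      rw [mul_pow, ← hb]
      linear_combination -a * ((v : R) * ↑(v⁻¹) + 1) * this
    have hu : IsUnit (b * v) := by
      rw [hab] at hau
      exact (isUnit_pow_iff two_ne_zero).1 hau
    exact ⟨hu.unit, hab⟩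

lemma sum_residue [Fintype (ResidueField R)] (f : ResidueField R → ℤ) :
    ∑ x : R, f (residue R x) = Nat.card (maximalIdeal R) * ∑ a, f a := by
  classical
  rw [← sum_fiberwise_of_maps_to (t := univ) (g := residue R) (fun _ _ => mem_univ _), mul_sum]
  refine sum_congr rfl fun a _ => ?_
  rw [sum_congr rfl (g := fun _ => f a) (fun x hx => by rw [(mem_filter.1 hx).2]), sum_const,
    nsmul_eq_mul]
  congr 2
  obtain ⟨r, rfl⟩ := residue_surjective a
  rw [← Fintype.card_subtype, ← Nat.card_eq_fintype_card]
  refine Nat.card_congr ((Equiv.subRight r).subtypeEquiv fun x => ?_)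
  rw [Equiv.subRight_apply, ← residue_eq_zero_iff, map_sub, sub_eq_zero]

end ring

end TriangleAux

open TriangleAux IsLocalRing Finset in
theorem TriangleAux.main (R : Type*) [CommRing R] [IsLocalRing R] [Fintype R]
    (q β : ℕ)
    (hm : Nat.card (IsLocalRing.maximalIdeal R) = q ^ β)
    (hq : Nat.card (IsLocalRing.ResidueField R) = q)
    (hk : Nat.gcd 2 (Fintype.card R) = 1)
    (hq4 : q % 4 = 1) :
    (48 : ℤ) * (unitaryCayleyGraph R 2).cliqueCount 3 =
      (q : ℤ) ^ (3 * β + 1) * ((q : ℤ) - 1) * ((q : ℤ) - 5) := by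
  classical
  have hfin : Finite (ResidueField R) := Finite.of_surjective _ (residue_surjective (R := R))
  letI : Fintype (ResidueField R) := Fintype.ofFinite _
  have hcard : Fintype.card (ResidueField R) = q := by rw [← hq, Nat.card_eq_fintype_card]
  have h4 : Fintype.card (ResidueField R) % 4 = 1 := by rw [hcard, hq4]
  have h2 : IsUnit (2 : R) := by
    by_contra hh
    have h0 : residue R 2 = 0 := (residue_eq_zero_iff _).2 hh
    rw [map_ofNat] at h0
    exact Ring.two_ne_zero (char_ne h4) h0
  have hadj (x y : R) : (unitaryCayleyGraph R 2).Adj x y ↔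
      residue R y - residue R x ≠ 0 ∧ IsSquare (residue R y - residue R x) := by
    rw [← map_sub, ← exists_unit_sq_iff h2]
    simp only [unitaryCayleyGraph, SimpleGraph.fromRel_adj]
    constructor
    · rintro ⟨_, h | h⟩
      · exact h
      · rw [exists_unit_sq_iff h2] at h ⊢
        have hm : IsSquare (-1 : ResidueField R) := by
          rw [FiniteField.isSquare_neg_one_iff]; omega
        have e : residue R (y - x) = -1 * residue R (x - y) := by
          rw [← neg_sub, map_neg]; ring
        rw [e]
        exact ⟨mul_ne_zero (by simp) h.1, hm.mul h.2⟩
    · intro h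
      refine ⟨?_, Or.inl h⟩
      rintro rfl
      rw [exists_unit_sq_iff h2] at h
      simp at h
  have h6 := six_mul (unitaryCayleyGraph R 2)
  have hsum : (8 : ℤ) * #{p : R × R × R | (unitaryCayleyGraph R 2).Adj p.1 p.2.1 ∧
      (unitaryCayleyGraph R 2).Adj p.1 p.2.2 ∧ (unitaryCayleyGraph R 2).Adj p.2.1 p.2.2} =
      ∑ x : R, ∑ y : R, ∑ z : R, g (residue R y - residue R x) * g (residue R z - residue R x) *
        g (residue R z - residue R y) := by
    rw [card_filter, Nat.cast_sum, mul_sum, Fintype.sum_prod_type]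
    refine sum_congr rfl fun x _ => ?_
    rw [Fintype.sum_prod_type]
    refine sum_congr rfl fun y _ => sum_congr rfl fun z _ => ?_
    simp only [hadj, g_eq]
    split_ifs <;> first | (norm_num; done) | (exfalso; tauto)
  have hz (a b : ResidueField R) : ∑ z : R, g (b - a) * g (residue R z - a) * g (residue R z - b) =
      q ^ β * ∑ c, g (b - a) * g (c - a) * g (c - b) := by
    rw [sum_residue (fun c => g (b - a) * g (c - a) * g (c - b)), hm]
    push_cast; rfl
  have hy (a : ResidueField R) : ∑ y : R, (q : ℤ) ^ β * ∑ c, g (residue R y - a) * g (c - a) *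
      g (c - residue R y) =
      q ^ β * ∑ b, (q : ℤ) ^ β * ∑ c, g (b - a) * g (c - a) * g (c - b) := by
    rw [sum_residue (fun b => (q : ℤ) ^ β * ∑ c, g (b - a) * g (c - a) * g (c - b)), hm]
    push_cast; rfl
  simp only [hz, hy] at hsum
  rw [sum_residue (fun a => (q : ℤ) ^ β * ∑ b, (q : ℤ) ^ β * ∑ c, g (b - a) * g (c - a) *
    g (c - b)), hm] at hsum
  simp only [← mul_sum] at hsum
  rw [sum_field h4, hcard, ← h6] at hsum
  push_cast at hsum
  rw [pow_succ, pow_mul']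
  linear_combination hsum

/-- Let `(R,𝔪)` be a finite commutative local ring with `|𝔪| = q^β` and residue field of size
`q`, where `gcd(2,|R|) = 1` and `q ≡ 1 (mod 4)`. Then the number of triangles in `G_R(2)` is
`K_3(G_R(2)) = q^(3β+1)(q-1)(q-5)/48`. -/
theorem triangleCount_unitaryCayley_two (R : Type*) [CommRing R] [IsLocalRing R] [Fintype R]
    (q β : ℕ)
    (hm : Nat.card (IsLocalRing.maximalIdeal R) = q ^ β)
    (hq : Nat.card (IsLocalRing.ResidueField R) = q)
    (hk : Nat.gcd 2 (Fintype.card R) = 1)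
    (hq4 : q % 4 = 1) :
    (48 : ℤ) * (unitaryCayleyGraph R 2).cliqueCount 3 =
      (q : ℤ) ^ (3 * β + 1) * ((q : ℤ) - 1) * ((q : ℤ) - 5) :=
  TriangleAux.main R q β hm hq hk hq4
end

section
/- Let (R,𝔪) be a finite commutative local ring with identity, with maximal ideal of size |𝔪| = q^β and residue field R/𝔪 of size q = p^r (p prime), where gcd(3,|R|) = 1, and 3 divides q−1 if q is even while 6 divides q−1 if q is odd. Let c ∈ ℤ be such that either (p ≡ 1 (mod 3) and there exists d ∈ ℤ with 4q = c² + 27d², c ≡ 1 (mod 3), and p does not divide c), or (p ≡ 2 (mod 3), r is even, and c = −2(−p)^(r/2)). Then the number of triangles in G_R(3) is K_3(G_R(3)) = q^(3β+1) (q−1)(q + c − 8) / 162. -/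
theorem aux_split {p : ℕ} (hp : p.Prime) (hp3 : p % 3 = 1) {r : ℕ} (hr : r ≠ 0) {c d c' d' : ℤ}
    (h : 4 * (p : ℤ) ^ r = c ^ 2 + 27 * d ^ 2) (h' : 4 * (p : ℤ) ^ r = c' ^ 2 + 27 * d' ^ 2)
    (hc : c % 3 = 1) (hc' : c' % 3 = 1) (hpc : ¬ (p : ℤ) ∣ c) (hpc' : ¬ (p : ℤ) ∣ c') : c = c' := by
  have hpi : Prime (p : ℤ) := Nat.prime_iff_prime_int.mp hp
  have hp2 : ¬ (p : ℤ) ∣ 2 := by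
    intro hd
    have : p ∣ 2 := by exact_mod_cast hd
    have := (Nat.prime_dvd_prime_iff_eq hp Nat.prime_two).mp this
    omega
  have hpq : (p : ℤ) ∣ p ^ r := dvd_pow_self _ hr
  have hpd' : ¬ (p : ℤ) ∣ d' := by
    intro hd
    apply hpc'
    apply hpi.dvd_of_dvd_pow (n := 2)
    have : c' ^ 2 = 4 * (p : ℤ) ^ r - 27 * d' ^ 2 := by linarith
    rw [this]
    exact dvd_sub (hpq.mul_left _) ((dvd_pow hd (by norm_num)).mul_left _)
  have hq0 : (0 : ℤ) < (p : ℤ) ^ r := by have := hp.pos; positivity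
  have main : ∀ e : ℤ, 4 * (p : ℤ) ^ r = c' ^ 2 + 27 * e ^ 2 → (p : ℤ) ^ r ∣ c * e - c' * d → c = c' := by
    rintro e he ⟨k, hk⟩
    have h1 : 16 * ((p : ℤ) ^ r) ^ 2 = (c * c' + 27 * d * e) ^ 2 + 27 * (c * e - c' * d) ^ 2 := by
      calc 16 * ((p : ℤ) ^ r) ^ 2 = (4 * (p : ℤ) ^ r) * (4 * (p : ℤ) ^ r) := by ring
        _ = (c ^ 2 + 27 * d ^ 2) * (c' ^ 2 + 27 * e ^ 2) := by rw [← h, ← he]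
        _ = _ := by ring
    have hk0 : k = 0 := by
      by_contra hk0
      have : 1 ≤ k ^ 2 := by have := pow_pos (abs_pos.mpr hk0) 2; rw [sq_abs] at this; linarith
      rw [hk] at h1
      have hqq : 0 < ((p : ℤ) ^ r) ^ 2 := by positivity
      nlinarith [sq_nonneg (c * c' + 27 * d * e)]
    have h2 : c * e = c' * d := by rw [hk0] at hk; linarith
    have h3 : 4 * (p : ℤ) ^ r * c ^ 2 = 4 * (p : ℤ) ^ r * c' ^ 2 := by
      calc 4 * (p : ℤ) ^ r * c ^ 2 = (c * c') ^ 2 + 27 * (c * e) ^ 2 := by rw [he]; ring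
        _ = (c * c') ^ 2 + 27 * (c' * d) ^ 2 := by rw [h2]
        _ = _ := by rw [h]; ring
    have h4 : c ^ 2 = c' ^ 2 := mul_left_cancel₀ (by positivity) h3
    rcases sq_eq_sq_iff_eq_or_eq_neg.mp h4 with h5 | h5 <;> omega
  have hprod : (p : ℤ) ^ r ∣ (c * d' - c' * d) * (c * d' + c' * d) := by
    refine ⟨4 * (d' ^ 2 - d ^ 2), ?_⟩
    linear_combination d ^ 2 * h' - d' ^ 2 * h
  by_cases hA : (p : ℤ) ∣ c * d' - c' * d
  · by_cases hB : (p : ℤ) ∣ c * d' + c' * d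
    · exfalso
      have := dvd_add hA hB
      have h2 : (p : ℤ) ∣ 2 * (c * d') := by
        have e : 2 * (c * d') = (c * d' - c' * d) + (c * d' + c' * d) := by ring
        rw [e]; exact this
      rcases hpi.dvd_or_dvd h2 with h2 | h2
      · exact hp2 h2
      · rcases hpi.dvd_or_dvd h2 with h2 | h2
        · exact hpc h2
        · exact hpd' h2
    · apply main d' h'
      exact IsCoprime.dvd_of_dvd_mul_right (IsCoprime.pow_left ((Prime.coprime_iff_not_dvd hpi).mpr hB)) hprod
  · apply main (-d') (by rw [h']; ring)
    have : (p : ℤ) ^ r ∣ c * d' + c' * d :=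
      IsCoprime.dvd_of_dvd_mul_left (IsCoprime.pow_left ((Prime.coprime_iff_not_dvd hpi).mpr hA)) hprod
    have := dvd_neg.mpr this
    have e : c * -d' - c' * d = -(c * d' + c' * d) := by ring
    rw [e]; exact this

theorem aux_inert_dvd {p : ℕ} (hp : p.Prime) (hp3 : p % 3 = 2) {a b : ℤ}
    (h : (p : ℤ) ∣ a ^ 2 - a * b + b ^ 2) : (p : ℤ) ∣ a ∧ (p : ℤ) ∣ b := by
  have := Fact.mk hp
  have h0 : ((a : ZMod p)) ^ 2 - a * b + b ^ 2 = 0 := by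
    have := (ZMod.intCast_zmod_eq_zero_iff_dvd _ p).mpr h
    push_cast at this; exact this
  have h1 : ((a : ZMod p)) ^ 3 = (-b) ^ 3 := by linear_combination (a + b : ZMod p) * h0
  obtain ⟨m, hm⟩ : ∃ m, 3 * m = p + (p - 1) := ⟨(2 * p - 1) / 3, by have := hp.pos; omega⟩
  have hinj : ∀ x : ZMod p, (x ^ 3) ^ m = x := by
    intro x
    rw [← pow_mul, hm, pow_add, ZMod.pow_card, ← pow_succ']
    rw [Nat.sub_add_cancel hp.one_le, ZMod.pow_card]
  have h2 : (a : ZMod p) = -b := by rw [← hinj a, h1, hinj]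
  have h3 : (3 : ZMod p) * (b : ZMod p) ^ 2 = 0 := by rw [h2] at h0; linear_combination h0
  have h3' : (3 : ZMod p) ≠ 0 := by
    intro h
    have : ((3 : ℕ) : ZMod p) = 0 := by exact_mod_cast h
    rw [ZMod.natCast_eq_zero_iff] at this
    have := (Nat.prime_dvd_prime_iff_eq hp Nat.prime_three).mp this
    omega
  have hb : (b : ZMod p) = 0 := by simpa [h3'] using h3
  have ha : (a : ZMod p) = 0 := by rw [h2, hb]; simp
  exact ⟨(ZMod.intCast_zmod_eq_zero_iff_dvd _ p).mp ha, (ZMod.intCast_zmod_eq_zero_iff_dvd _ p).mp hb⟩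

theorem aux_inert_descent {p : ℕ} (hp : p.Prime) (hp3 : p % 3 = 2) (n : ℕ) : ∀ {a b : ℤ},
    a ^ 2 - a * b + b ^ 2 = (p : ℤ) ^ (2 * n) →
    ∃ a' b' : ℤ, a = p ^ n * a' ∧ b = p ^ n * b' ∧ a' ^ 2 - a' * b' + b' ^ 2 = 1 := by
  induction n with
  | zero => intro a b h; exact ⟨a, b, by simp, by simp, by simpa using h⟩
  | succ n ih =>
    intro a b h
    obtain ⟨⟨a', rfl⟩, ⟨b', rfl⟩⟩ := aux_inert_dvd hp hp3 (a := a) (b := b)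
      (by rw [h]; exact dvd_pow_self _ (by omega))
    have hp0 : (p : ℤ) ^ 2 ≠ 0 := by have := hp.pos; positivity
    obtain ⟨x, y, rfl, rfl, hxy⟩ := ih (a := a') (b := b') (by
      apply mul_left_cancel₀ hp0
      rw [show 2 * (n + 1) = 2 * n + 2 by ring, pow_add] at h
      linear_combination h)
    exact ⟨x, y, by ring, by ring, hxy⟩

theorem aux_inert {p : ℕ} (hp : p.Prime) (hp3 : p % 3 = 2) {n : ℕ} {a b : ℤ} (ha : a % 3 = 2)
    (hb : b % 3 = 0) (h : a ^ 2 - a * b + b ^ 2 = (p : ℤ) ^ (2 * n)) :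
    2 * a - b = -2 * (-(p : ℤ)) ^ n := by
  obtain ⟨x, y, hx, hy, hxy⟩ := aux_inert_descent hp hp3 n h
  have hp3' : ¬ (3 : ℤ) ∣ (p : ℤ) ^ n := by
    intro hd
    have := Int.prime_three.dvd_of_dvd_pow hd
    omega
  have hy3 : (3 : ℤ) ∣ y := by
    have : (3 : ℤ) ∣ p ^ n * y := by rw [← hy]; omega
    exact (Int.prime_three.dvd_or_dvd this).resolve_left hp3'
  have hy0 : y = 0 := by
    have h1 : y < 2 := by nlinarith [sq_nonneg (2 * x - y)]
    have h2 : -2 < y := by nlinarith [sq_nonneg (2 * x - y)]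
    omega
  subst hy0
  have hx1 : x = 1 ∨ x = -1 := by
    have : x ^ 2 = 1 := by linarith
    simpa using this
  have hmod : (-(p : ℤ)) ^ n % 3 = 1 := by
    have : (-(p : ℤ)) ≡ 1 [ZMOD 3] := by unfold Int.ModEq; omega
    have := this.pow n
    unfold Int.ModEq at this
    simpa using this
  have hor : (-(p : ℤ)) ^ n = (p : ℤ) ^ n ∨ (-(p : ℤ)) ^ n = -(p : ℤ) ^ n := by
    rcases Nat.even_or_odd n with hn | hn
    · exact Or.inl (hn.neg_pow _)
    · exact Or.inr (hn.neg_pow _)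
  rcases hor with hh | hh <;> rw [hh] at hmod ⊢ <;>
    rcases hx1 with rfl | rfl <;> omega

theorem aux_choose {p : ℕ} (hp : p.Prime) (hp3 : p % 3 = 1) (r : ℕ) : ∀ e : ℕ, 3 * e + 1 = p ^ r →
    ¬ p ∣ (2 * e).choose e := by
  have := Fact.mk hp
  induction r with
  | zero =>
    intro e he
    have : e = 0 := by simpa using he
    subst this
    simpa using hp.one_lt.ne'
  | succ r ih =>
    intro e he
    obtain ⟨e', he'⟩ : ∃ e', 3 * e' + 1 = p ^ r := by
      have : p ^ r % 3 = 1 := by rw [Nat.pow_mod, hp3]; simp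
      exact ⟨p ^ r / 3, by omega⟩
    obtain ⟨f, hf⟩ : ∃ f, p = 3 * f + 1 := ⟨p / 3, by omega⟩
    have hee : e = f + p * e' := by
      have : p ^ (r + 1) = p * p ^ r := by ring
      rw [← he', mul_add, mul_one] at this
      have h2 : 3 * e + 1 = 3 * (p * e') + (3 * f + 1) := by rw [he, this, ← hf]; ring
      omega
    have h := Choose.choose_modEq_choose_mod_mul_choose_div_nat (n := 2 * e) (k := e) (p := p)
    have e1 : e % p = f := by rw [hee, Nat.add_mul_mod_self_left]; exact Nat.mod_eq_of_lt (by omega)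
    have e2 : e / p = e' := by
      rw [hee, Nat.add_mul_div_left _ _ hp.pos, Nat.div_eq_of_lt (by omega)]; simp
    have h2e : 2 * e = 2 * f + p * (2 * e') := by rw [hee]; ring
    have e3 : 2 * e % p = 2 * f := by
      rw [h2e, Nat.add_mul_mod_self_left]; exact Nat.mod_eq_of_lt (by omega)
    have e4 : 2 * e / p = 2 * e' := by
      rw [h2e, Nat.add_mul_div_left _ _ hp.pos, Nat.div_eq_of_lt (by omega)]; simp
    rw [e1, e2, e3, e4] at h
    rw [h.dvd_iff (dvd_refl p), hp.dvd_mul]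
    push Not
    refine ⟨?_, ih e' he'⟩
    intro hd
    have h1 : p ∣ (2 * f).factorial := by
      rw [← Nat.choose_mul_factorial_mul_factorial (show f ≤ 2 * f by omega), mul_assoc]
      exact hd.mul_right _
    rw [hp.dvd_factorial] at h1
    omega


section helpers
open Finset

/-- `x` is the cube of a unit. -/
def UCube {A : Type*} [CommRing A] (x : A) : Prop := ∃ u : Aˣ, x = (u : A) ^ 3

theorem UCube.neg {A : Type*} [CommRing A] {x : A} (h : UCube x) : UCube (-x) := by
  obtain ⟨u, rfl⟩ := h
  exact ⟨-u, by push_cast; ring⟩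

theorem ucube_neg {A : Type*} [CommRing A] {x : A} : UCube (-x) ↔ UCube x :=
  ⟨fun h => by simpa using h.neg, UCube.neg⟩

theorem ucube_mul {A : Type*} [CommRing A] {x y : A} (hx : UCube x) : UCube (x * y) ↔ UCube y := by
  obtain ⟨u, rfl⟩ := hx
  constructor
  · rintro ⟨v, hv⟩
    refine ⟨u⁻¹ * v, ?_⟩
    push_cast
    rw [mul_pow, ← hv, ← mul_assoc, ← mul_pow]
    simp
  · rintro ⟨v, rfl⟩
    exact ⟨u * v, by push_cast; ring⟩

section
variable {F : Type*} [Field F] [Fintype F] {K : Type*} [Field K]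

open Classical in
theorem ucube_indicator {χ : MulChar F K} (h1 : χ ≠ 1) (h3 : χ ^ 3 = 1) (x : F) :
    (1 : MulChar F K) x + χ x + χ⁻¹ x = if UCube x then 3 else 0 := by
  by_cases hx : x = 0
  · subst hx
    have : ¬ UCube (0 : F) := by
      rintro ⟨u, hu⟩
      exact pow_ne_zero 3 u.ne_zero hu.symm
    rw [if_neg this, MulChar.map_zero, MulChar.map_zero, MulChar.map_zero]
    ring
  · obtain ⟨u, rfl⟩ := (isUnit_iff_ne_zero.mpr hx)
    have hpow : ∀ v : Fˣ, (χ v) ^ 3 = 1 := by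
      intro v
      rw [← MulChar.pow_apply_coe, h3, MulChar.one_apply_coe]
    have hinv : χ⁻¹ = χ ^ 2 := by
      rw [inv_eq_iff_mul_eq_one, ← pow_succ', h3]
    rw [hinv, MulChar.one_apply_coe, MulChar.pow_apply_coe]
    obtain ⟨g, hg⟩ := IsCyclic.exists_generator (α := Fˣ)
    have hg1 : χ g ≠ 1 := by
      intro hg1
      apply h1
      ext v
      obtain ⟨k, rfl⟩ := (Subgroup.mem_zpowers_iff).mp (hg v)
      obtain ⟨n, hn⟩ : ∃ n : ℕ, g ^ n = g ^ k :=
        (mem_powers_iff_mem_zpowers.mpr ⟨k, rfl⟩ : g ^ k ∈ Submonoid.powers g)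
      rw [← hn]
      simp [hg1]
    split_ifs with hu
    · obtain ⟨v, hv⟩ := hu
      rw [hv, map_pow, hpow]; norm_num
    · have hne : χ u ≠ 1 := by
        intro hu1
        apply hu
        obtain ⟨n, hn⟩ : ∃ n : ℕ, g ^ n = u :=
          (mem_powers_iff_mem_zpowers.mpr (hg u) : u ∈ Submonoid.powers g)
        have : (χ g) ^ n = 1 := by
          rw [← map_pow, ← Units.val_pow_eq_pow_val, hn, hu1]
        have ho : orderOf (χ g) = 3 := orderOf_eq_prime (hpow g) hg1
        obtain ⟨k, rfl⟩ : 3 ∣ n := by rw [← ho]; exact orderOf_dvd_of_pow_eq_one this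
        exact ⟨g ^ k, by rw [← hn]; push_cast; ring⟩
      have := hpow u
      apply mul_left_cancel₀ (sub_ne_zero.mpr hne)
      linear_combination this

open Classical in
theorem card_ucube {χ : MulChar F K} (h1 : χ ≠ 1) (h3 : χ ^ 3 = 1) :
    (3 : K) * (Nat.card {x : F // UCube x} : K) = Fintype.card F - 1 := by
  have h := Finset.sum_congr rfl (fun x (_ : x ∈ (univ : Finset F)) => ucube_indicator h1 h3 x)
  have h1' : χ⁻¹ ≠ 1 := by simpa using h1
  simp_rw [Finset.sum_add_distrib] at h
  rw [MulChar.sum_eq_zero_of_ne_one h1, MulChar.sum_eq_zero_of_ne_one h1'] at h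
  rw [← Finset.sum_filter, Finset.sum_const, MulChar.sum_one_eq_card_units] at h
  rw [Nat.card_eq_fintype_card, Fintype.card_subtype]
  rw [Fintype.card_units, Nat.cast_sub Fintype.card_pos] at h
  simp at h
  linear_combination -h

open Classical in
theorem card_ucube_pair {χ : MulChar F K} (h1 : χ ≠ 1) (h3 : χ ^ 3 = 1) :
    (9 : K) * (Nat.card {x : F // UCube x ∧ UCube (x - 1)} : K) =
      Fintype.card F - 8 + jacobiSum χ χ + jacobiSum χ⁻¹ χ⁻¹ := by
  have h := Finset.sum_congr rfl (fun x (_ : x ∈ (univ : Finset F)) =>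
    congrArg₂ (· * ·) (ucube_indicator h1 h3 x) (ucube_indicator h1 h3 (1 - x)))
  have h1' : χ⁻¹ ≠ 1 := by simpa using h1
  have hneg : χ (-1) = 1 := by
    have : χ (-1) ^ 3 = 1 := by
      have := MulChar.pow_apply_coe χ 3 (-1)
      rw [h3, MulChar.one_apply_coe] at this
      simpa using this.symm
    rw [← this, ← map_pow]; norm_num
  have j1 := jacobiSum_one_one (F := F) (R := K)
  have j2 := jacobiSum_one_nontrivial h1
  have j3 := jacobiSum_one_nontrivial h1'
  have j4 := jacobiSum_comm χ 1
  have j5 := jacobiSum_comm χ⁻¹ 1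
  have j6 := jacobiSum_nontrivial_inv h1
  have j7 := jacobiSum_comm χ⁻¹ χ
  rw [hneg] at j6
  have hL : ∑ x : F, ((1 : MulChar F K) x + χ x + χ⁻¹ x) *
      ((1 : MulChar F K) (1 - x) + χ (1 - x) + χ⁻¹ (1 - x)) =
      jacobiSum (1 : MulChar F K) 1 + jacobiSum 1 χ + jacobiSum 1 χ⁻¹ + jacobiSum χ 1
      + jacobiSum χ χ + jacobiSum χ χ⁻¹ + jacobiSum χ⁻¹ 1 + jacobiSum χ⁻¹ χ
      + jacobiSum χ⁻¹ χ⁻¹ := by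
    simp only [jacobiSum, ← Finset.sum_add_distrib]
    refine Finset.sum_congr rfl fun x _ => ?_
    ring
  have hR : ∑ x : F, ((if UCube x then (3 : K) else 0) * (if UCube (1 - x) then 3 else 0)) =
      (9 : K) * (Nat.card {x : F // UCube x ∧ UCube (x - 1)} : K) := by
    rw [Nat.card_eq_fintype_card, Fintype.card_subtype, Finset.card_filter, Nat.cast_sum,
      Finset.mul_sum]
    refine Finset.sum_congr rfl fun x _ => ?_
    have : UCube (1 - x) ↔ UCube (x - 1) := by rw [← ucube_neg, neg_sub]
    by_cases a : UCube x <;> by_cases b : UCube (x - 1) <;> simp [this, a, b]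
    norm_num
  rw [hL, hR] at h
  rw [← h, j7, j6, j5, j4, j3, j2, j1]
  ring

end

theorem cyclo_complex {F : Type*} [Field F] [Fintype F] (hq : 3 ∣ Fintype.card F - 1) :
    ∃ a b : ℤ, a % 3 = 2 ∧ b % 3 = 0 ∧ a ^ 2 - a * b + b ^ 2 = Fintype.card F ∧
      (9 : ℤ) * (Nat.card {x : F // UCube x ∧ UCube (x - 1)} : ℤ) =
        Fintype.card F - 8 + (2 * a - b) ∧
      (3 : ℤ) * (Nat.card {x : F // UCube x} : ℤ) = Fintype.card F - 1 := by
  obtain ⟨ω, hω⟩ : ∃ ω : ℂ, IsPrimitiveRoot ω 3 := ⟨_, Complex.isPrimitiveRoot_exp 3 (by norm_num)⟩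
  obtain ⟨χ, hχ⟩ := MulChar.exists_mulChar_orderOf F hq hω
  have h3 : χ ^ 3 = 1 := by rw [← hχ]; exact pow_orderOf_eq_one χ
  have h1 : χ ≠ 1 := by rintro rfl; simp at hχ
  have h2 : χ * χ ≠ 1 := by
    intro h
    apply h1
    have : χ ^ 3 = χ * χ * χ := by rw [pow_succ, pow_two]
    rw [h3, h, one_mul] at this
    exact this.symm
  have hw3 : ω ^ 3 = 1 := hω.pow_eq_one
  have hw : ω ^ 2 + ω + 1 = 0 := by
    have : ω ≠ 1 := hω.ne_one (by norm_num)
    apply mul_left_cancel₀ (sub_ne_zero.mpr this)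
    linear_combination hw3
  have hconj : (starRingEnd ℂ) ω = ω ^ 2 := by
    have hn : ‖ω‖ = 1 := Complex.norm_eq_one_of_pow_eq_one hw3 (by norm_num)
    rw [← Complex.inv_eq_conj hn]
    rw [inv_eq_iff_eq_inv]
    exact eq_inv_of_mul_eq_one_left (by linear_combination hw3)
  obtain ⟨z, hz, hJ⟩ := exists_jacobiSum_eq_neg_one_add (n := 3) (by norm_num) h3 h3 hq hω
  obtain ⟨m, n, hmn⟩ : ∃ m n : ℤ, z = m + n * ω := by
    clear hJ
    induction hz using Algebra.adjoin_induction with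
    | mem x hx => exact ⟨0, 1, by simpa using hx⟩
    | algebraMap r => exact ⟨r, 0, by simp⟩
    | add x y _ _ hx hy =>
      obtain ⟨m, n, rfl⟩ := hx
      obtain ⟨m', n', rfl⟩ := hy
      exact ⟨m + m', n + n', by push_cast; ring⟩
    | mul x y _ _ hx hy =>
      obtain ⟨m, n, rfl⟩ := hx
      obtain ⟨m', n', rfl⟩ := hy
      exact ⟨m * m' - n * n', m * n' + n * m' - n * n', by
        push_cast; linear_combination (n * n' : ℂ) * hw⟩
  have hJ1 : jacobiSum χ χ = ((3 * n - 1 : ℤ) : ℂ) + ((3 * (n - m) : ℤ) : ℂ) * ω := by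
    rw [hJ, hmn]; push_cast; linear_combination (m - 3 * n + n * ω : ℂ) * hw
  set a := 3 * n - 1
  set b := 3 * (n - m)
  have hJ2 : jacobiSum χ⁻¹ χ⁻¹ = (a : ℂ) + (b : ℂ) * ω ^ 2 := by
    rw [← hconj]
    have : jacobiSum χ⁻¹ χ⁻¹ = (starRingEnd ℂ) (jacobiSum χ χ) := by
      rw [← MulChar.star_eq_inv]
      simp only [jacobiSum, map_sum, map_mul, MulChar.star_apply]
      rfl
    rw [this, hJ1]
    simp
  refine ⟨a, b, by omega, by omega, ?_, ?_, ?_⟩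
  · have := jacobiSum_mul_jacobiSum_inv (F := F) (F' := ℂ) (by
      rw [ringChar.eq_zero]
      exact (CharP.char_ne_zero_of_finite F (ringChar F)).symm) h1 h1 h2
    rw [hJ1, hJ2] at this
    have h' : ((a ^ 2 - a * b + b ^ 2 : ℤ) : ℂ) = ((Fintype.card F : ℤ) : ℂ) := by
      push_cast
      linear_combination this - (a * b : ℂ) * hw - b ^ 2 * hw3
    exact_mod_cast h'
  · have := card_ucube_pair h1 h3
    rw [hJ1, hJ2] at this
    have h' : ((9 * (Nat.card {x : F // UCube x ∧ UCube (x - 1)} : ℤ) : ℤ) : ℂ) =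
      ((Fintype.card F - 8 + (2 * a - b) : ℤ) : ℂ) := by
      push_cast
      linear_combination this + (b : ℂ) * hw
    exact_mod_cast h'
  · have := card_ucube h1 h3
    have h' : ((3 * (Nat.card {x : F // UCube x} : ℤ) : ℤ) : ℂ) =
      ((Fintype.card F - 1 : ℤ) : ℂ) := by
      push_cast
      exact this
    exact_mod_cast h'

theorem sum_pow_all {F : Type*} [Field F] [Fintype F] {i : ℕ} (hi : i ≠ 0) :
    ∑ x : F, x ^ i = if Fintype.card F - 1 ∣ i then -1 else 0 := by
  classical
  rw [← FiniteField.sum_pow_units F i]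
  rw [← Finset.sum_subset (Finset.subset_univ (univ \ {(0 : F)}))]
  · symm
    refine Finset.sum_bij (fun (u : Fˣ) _ => (u : F)) ?_ ?_ ?_ ?_
    · simp
    · intro a _ b _ h; exact Units.ext h
    · intro b hb
      have : b ≠ 0 := by simpa using hb
      exact ⟨Units.mk0 b this, by simp, rfl⟩
    · simp
  · intro x _ hx
    have : x = 0 := by simpa using hx
    rw [this, zero_pow hi]

theorem sum_beta {F : Type*} [Field F] [Fintype F] {a b : ℕ} (ha : a ≠ 0) :
    ∑ x : F, x ^ a * (1 - x) ^ b =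
      ∑ k ∈ range (b + 1), (b.choose k : F) * (-1) ^ k *
        (if Fintype.card F - 1 ∣ a + k then -1 else 0) := by
  have : ∀ x : F, x ^ a * (1 - x) ^ b =
      ∑ k ∈ range (b + 1), (b.choose k : F) * (-1) ^ k * x ^ (a + k) := by
    intro x
    rw [show (1 - x) = (-x) + 1 by ring, add_pow, Finset.mul_sum]
    refine Finset.sum_congr rfl fun k _ => ?_
    rw [neg_pow, one_pow, pow_add]; ring
  simp_rw [this]
  rw [Finset.sum_comm]
  refine Finset.sum_congr rfl fun k _ => ?_
  rw [← Finset.mul_sum, sum_pow_all (by omega)]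

theorem cyclo_mod {F : Type*} [Field F] [Fintype F] {e : ℕ} (he : Fintype.card F = 3 * e + 1) :
    (9 : F) * (Nat.card {x : F // UCube x ∧ UCube (x - 1)} : F) =
        Fintype.card F - 8 - (-1) ^ e * ((2 * e).choose e : F) := by
  have he0 : e ≠ 0 := by
    rintro rfl
    have := Fintype.one_lt_card (α := F)
    omega
  have hcard : Fintype.card F - 1 = 3 * e := by omega
  let χ : MulChar F F :=
    { toFun := fun x => x ^ e
      map_one' := one_pow e
      map_mul' := fun x y => mul_pow x y e
      map_nonunit' := fun x hx => by
        have : x = 0 := by simpa [isUnit_iff_ne_zero] using hx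
        rw [this, zero_pow he0] }
  have hχ : ∀ x, χ x = x ^ e := fun x => rfl
  have h3 : χ ^ 3 = 1 := by
    ext u
    rw [MulChar.pow_apply_coe, hχ, MulChar.one_apply_coe, ← pow_mul, mul_comm, ← hcard]
    exact FiniteField.pow_card_sub_one_eq_one _ u.ne_zero
  have h1 : χ ≠ 1 := by
    intro h
    have h0 : ∑ x : F, x ^ e = 0 := FiniteField.sum_pow_lt_card_sub_one F e (by omega)
    have h2 : ∑ x : F, χ x * χ x = 0 := by
      simp_rw [hχ, ← pow_add]
      exact FiniteField.sum_pow_lt_card_sub_one F (e + e) (by omega)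
    have h4 : ∑ x : F, (χ * χ * χ) x = -1 := by
      have : ∀ x, (χ * χ * χ) x = x ^ (3 * e) := by
        intro x
        rw [MulChar.mul_apply, MulChar.mul_apply, hχ]; ring
      simp_rw [this]
      rw [sum_pow_all (by omega), if_pos (by rw [hcard])]
    have h5 : ∑ x : F, χ x = 0 := h0
    rw [h] at h4 h5
    simp only [mul_one] at h4
    rw [h5] at h4
    simp at h4
  have hinv : χ⁻¹ = χ ^ 2 := by
    rw [inv_eq_iff_mul_eq_one, ← pow_succ', h3]
  have hχ' : ∀ x, χ⁻¹ x = x ^ (2 * e) := by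
    intro x
    rw [hinv, MulChar.pow_apply' _ (by norm_num), hχ]; ring
  rw [card_ucube_pair h1 h3]
  have hj1 : jacobiSum χ χ = 0 := by
    simp only [jacobiSum, hχ]
    rw [sum_beta he0]
    refine Finset.sum_eq_zero fun k hk => ?_
    rw [if_neg, mul_zero]
    rw [hcard]
    intro hd
    have := Nat.le_of_dvd (by omega) hd
    have := Finset.mem_range.mp hk
    omega
  have hj2 : jacobiSum χ⁻¹ χ⁻¹ = - ((-1) ^ e * ((2 * e).choose e : F)) := by
    simp only [jacobiSum, hχ']
    rw [sum_beta (by omega)]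
    rw [Finset.sum_eq_single e]
    · rw [if_pos]
      · ring
      · rw [hcard]; exact ⟨1, by ring⟩
    · intro k hk hke
      rw [if_neg, mul_zero]
      rw [hcard]
      rintro ⟨t, ht⟩
      have := Finset.mem_range.mp hk
      have ht1 : t < 2 := by
        by_contra h
        have : 3 * e * 2 ≤ 3 * e * t := Nat.mul_le_mul_left _ (by omega)
        omega
      interval_cases t <;> omega
    · intro h
      exact absurd (Finset.mem_range.mpr (by omega)) h
  rw [hj1, hj2]; ring

open Classical in
theorem six_mul_cliqueCount {V : Type*} [Fintype V] (G : SimpleGraph V) :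
    6 * G.cliqueCount 3 =
      Nat.card {t : V × V × V // G.Adj t.1 t.2.1 ∧ G.Adj t.1 t.2.2 ∧ G.Adj t.2.1 t.2.2} := by
  rw [SimpleGraph.cliqueCount, Nat.card_eq_fintype_card, Nat.card_eq_fintype_card,
    Fintype.card_subtype, Fintype.card_subtype]
  rw [Finset.card_eq_sum_card_fiberwise (f := fun t : V × V × V => ({t.1, t.2.1, t.2.2} : Finset V))
    (t := univ.filter fun s : Finset V => G.IsNClique 3 s)]
  · rw [Finset.sum_const_nat (m := 6), mul_comm]
    intro s hs
    obtain ⟨a, b, c, hab, hac, hbc, rfl⟩ := SimpleGraph.is3Clique_iff.mp (Finset.mem_filter.mp hs).2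
    have h1 := hab.ne
    have h2 := hac.ne
    have h3 := hbc.ne
    have : (univ.filter fun t : V × V × V =>
        G.Adj t.1 t.2.1 ∧ G.Adj t.1 t.2.2 ∧ G.Adj t.2.1 t.2.2).filter
        (fun t => ({t.1, t.2.1, t.2.2} : Finset V) = {a, b, c}) =
        {(a, b, c), (a, c, b), (b, a, c), (b, c, a), (c, a, b), (c, b, a)} := by
      ext ⟨x, y, z⟩
      simp only [Finset.mem_filter, Finset.mem_univ, true_and, Finset.mem_insert,
        Finset.mem_singleton, Prod.mk.injEq]
      constructor
      · rintro ⟨⟨hxy, hxz, hyz⟩, he⟩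
        have e1 := hxy.ne
        have e2 := hxz.ne
        have e3 := hyz.ne
        have hx : x ∈ ({a, b, c} : Finset V) := by rw [← he]; simp
        have hy : y ∈ ({a, b, c} : Finset V) := by rw [← he]; simp
        have hz : z ∈ ({a, b, c} : Finset V) := by rw [← he]; simp
        simp only [Finset.mem_insert, Finset.mem_singleton] at hx hy hz
        clear he hxy hxz hyz hab hac hbc hs
        grind
      · have hba := hab.symm
        have hca := hac.symm
        have hcb := hbc.symm
        rintro (⟨rfl, rfl, rfl⟩ | ⟨rfl, rfl, rfl⟩ | ⟨rfl, rfl, rfl⟩ | ⟨rfl, rfl, rfl⟩ |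
          ⟨rfl, rfl, rfl⟩ | ⟨rfl, rfl, rfl⟩) <;>
        refine ⟨⟨by assumption, by assumption, by assumption⟩, ?_⟩ <;>
        · ext w
          simp only [Finset.mem_insert, Finset.mem_singleton] <;> tauto
    rw [this]
    simp [h1, h2, h3, h1.symm, h2.symm, h3.symm]
  · rintro ⟨x, y, z⟩ ht
    simp only [Finset.coe_filter, Finset.mem_univ, true_and, Set.mem_ofPred_eq] at ht ⊢
    exact SimpleGraph.is3Clique_triple_iff.mpr ht

theorem not_ucube_zero {A : Type*} [CommRing A] [Nontrivial A] : ¬ UCube (0 : A) := by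
  rintro ⟨u, hu⟩
  exact (u.isUnit.pow 3).ne_zero hu.symm

theorem adj_iff {R : Type*} [CommRing R] [Nontrivial R] (x y : R) :
    (unitaryCayleyGraph R 3).Adj x y ↔ UCube (y - x) := by
  rw [unitaryCayleyGraph, SimpleGraph.fromRel_adj]
  change x ≠ y ∧ (UCube (y - x) ∨ UCube (x - y)) ↔ _
  have : UCube (x - y) ↔ UCube (y - x) := by rw [← ucube_neg, neg_sub]
  rw [this, or_self]
  refine ⟨fun h => h.2, fun h => ⟨?_, h⟩⟩
  rintro rfl
  rw [sub_self] at h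
  exact not_ucube_zero h

theorem card_triples (R : Type*) [CommRing R] :
    Nat.card {t : R × R × R // UCube (t.2.1 - t.1) ∧ UCube (t.2.2 - t.1) ∧ UCube (t.2.2 - t.2.1)} =
      Nat.card R * (Nat.card {x : R // UCube x} * Nat.card {x : R // UCube x ∧ UCube (x - 1)}) := by
  rw [← Nat.card_prod, ← Nat.card_prod]
  symm
  refine Nat.card_congr (Equiv.ofBijective
    (fun w : R × {x : R // UCube x} × {x : R // UCube x ∧ UCube (x - 1)} =>
      ⟨(w.1, w.1 + w.2.1.1, w.1 + w.2.1.1 * w.2.2.1), ?_, ?_, ?_⟩) ⟨?_, ?_⟩)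
  · simpa using w.2.1.2
  · simpa using (ucube_mul w.2.1.2).mpr w.2.2.2.1
  · have := (ucube_mul w.2.1.2).mpr w.2.2.2.2
    convert this using 1
    ring
  · rintro ⟨x, ⟨u, hu⟩, ⟨t, ht⟩⟩ ⟨x', ⟨u', hu'⟩, ⟨t', ht'⟩⟩ h
    simp only [Subtype.mk.injEq, Prod.mk.injEq] at h
    obtain ⟨rfl, h2, h3⟩ := h
    have h2 := add_left_cancel h2
    subst h2
    have h3 := add_left_cancel h3
    obtain ⟨v, rfl⟩ := hu
    have := (v.isUnit.pow 3).mul_left_cancel h3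
    subst this
    rfl
  · rintro ⟨⟨x, y, z⟩, h1, h2, h3⟩
    simp only at h1 h2 h3
    have h1' := h1
    obtain ⟨v, hv⟩ := h1
    have hz : (y - x) * ((v⁻¹ : Rˣ) ^ 3 * (z - x) : R) = z - x := by
      rw [hv, ← mul_assoc, ← mul_pow]; simp
    refine ⟨⟨x, ⟨y - x, h1'⟩, ⟨(v⁻¹ : Rˣ) ^ 3 * (z - x), ?_, ?_⟩⟩, ?_⟩
    · rw [← ucube_mul h1', hz]; exact h2
    · rw [← ucube_mul h1', mul_sub, hz]
      convert h3 using 1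
      ring
    · simp only [Subtype.mk.injEq, Prod.mk.injEq]
      refine ⟨trivial, by ring, ?_⟩
      rw [hz]; ring

open IsLocalRing

theorem card_fiber (R : Type*) [CommRing R] [IsLocalRing R] (P : ResidueField R → Prop) :
    Nat.card {x : R // P (residue R x)} =
      Nat.card (maximalIdeal R) * Nat.card {y : ResidueField R // P y} := by
  rw [← Nat.card_prod]
  symm
  obtain ⟨s, hs⟩ := (residue_surjective (R := R)).hasRightInverse
  refine Nat.card_congr (Equiv.ofBijective
    (fun w : maximalIdeal R × {y : ResidueField R // P y} =>
      ⟨(w.1 : R) + s w.2.1, ?_⟩) ⟨?_, ?_⟩)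
  · rw [map_add, (residue_eq_zero_iff _).mpr w.1.2, zero_add, hs]
    exact w.2.2
  · rintro ⟨⟨a, ha⟩, ⟨y, hy⟩⟩ ⟨⟨a', ha'⟩, ⟨y', hy'⟩⟩ h
    simp only [Subtype.mk.injEq] at h
    have h2 := congrArg (residue R) h
    rw [map_add, map_add, (residue_eq_zero_iff _).mpr ha, (residue_eq_zero_iff _).mpr ha',
      hs, hs, zero_add, zero_add] at h2
    subst h2
    have := add_right_cancel h
    subst this
    rfl
  · rintro ⟨x, hx⟩
    refine ⟨⟨⟨x - s (residue R x), ?_⟩, ⟨residue R x, hx⟩⟩, ?_⟩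
    · rw [← residue_eq_zero_iff, map_sub, hs, sub_self]
    · simp

theorem ucube_residue {R : Type*} [CommRing R] [IsLocalRing R] [Finite R]
    (h3 : (3 : ResidueField R) ≠ 0) (x : R) : UCube x ↔ UCube (residue R x) := by
  constructor
  · rintro ⟨u, rfl⟩
    exact ⟨Units.map (residue R).toMonoidHom u, by simp⟩
  · rintro ⟨v, hv⟩
    obtain ⟨w, hw⟩ := residue_surjective (v : ResidueField R)
    have hwu : IsUnit w := by
      rw [← residue_ne_zero_iff_isUnit, hw]; exact v.ne_zero
    have hxu : IsUnit x := by
      rw [← residue_ne_zero_iff_isUnit, hv]; exact pow_ne_zero 3 v.ne_zero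
    obtain ⟨w, rfl⟩ := hwu
    obtain ⟨x, rfl⟩ := hxu
    let H : Subgroup Rˣ := (Units.map (residue R).toMonoidHom).ker
    have hH : ∀ u : Rˣ, u ∈ H ↔ residue R (u : R) = 1 := by
      intro u
      rw [MonoidHom.mem_ker, Units.ext_iff]
      rfl
    have hinj : Function.Injective (powMonoidHom 3 : H →* H) := by
      rw [injective_iff_map_eq_one]
      rintro ⟨a, ha⟩ h
      have h' : ((a : R)) ^ 3 = 1 := by
        have := congrArg (fun z : H => ((z : Rˣ) : R)) h
        simpa using this
      have hu : IsUnit ((a : R) ^ 2 + a + 1) := by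
        rw [← residue_ne_zero_iff_isUnit]
        rw [map_add, map_add, map_pow, (hH a).mp ha, map_one]
        convert h3 using 1
        norm_num
      have h0 : ((a : R) ^ 2 + a + 1) * ((a : R) - 1) = 0 := by linear_combination h'
      have := sub_eq_zero.mp ((hu.mul_right_eq_zero).mp h0)
      apply Subtype.ext
      exact Units.ext this
    have hsurj := Finite.surjective_of_injective hinj
    have hmem : x * (w ^ 3)⁻¹ ∈ H := by
      rw [MonoidHom.mem_ker, map_mul, map_inv, map_pow, mul_inv_eq_one]
      ext
      simp [hv, hw]
    obtain ⟨⟨a, ha⟩, hha⟩ := hsurj ⟨_, hmem⟩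
    have : a ^ 3 = x * (w ^ 3)⁻¹ := by
      have := congrArg (fun z : H => (z : Rˣ)) hha
      simpa using this
    refine ⟨a * w, ?_⟩
    rw [← Units.val_pow_eq_pow_val, mul_pow, this]
    simp

end helpers

/-- Let `(R,𝔪)` be a finite commutative local ring with `|𝔪| = q^β` and residue field of size
`q = p^r` (`p` prime), where `gcd(3,|R|) = 1`, and `3 ∣ q-1` if `q` is even while `6 ∣ q-1` if
`q` is odd. Let `c ∈ ℤ` with either `p ≡ 1 (mod 3)`, `4q = c² + 27d²`, `c ≡ 1 (mod 3)` and
`p ∤ c`, or `p ≡ 2 (mod 3)`, `r` even and `c = -2(-p)^(r/2)`. Then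
`K_3(G_R(3)) = q^(3β+1)(q-1)(q+c-8)/162`. -/
theorem triangleCount_unitaryCayley_three (R : Type*) [CommRing R] [IsLocalRing R] [Fintype R]
    (q β p r : ℕ) (c : ℤ) (hp : p.Prime) (hqpr : q = p ^ r)
    (hm : Nat.card (IsLocalRing.maximalIdeal R) = q ^ β)
    (hq : Nat.card (IsLocalRing.ResidueField R) = q)
    (hk : Nat.gcd 3 (Fintype.card R) = 1)
    (hdiv : (Even q → 3 ∣ q - 1) ∧ (Odd q → 6 ∣ q - 1))
    (hc : (p % 3 = 1 ∧ (∃ d : ℤ, 4 * (q : ℤ) = c ^ 2 + 27 * d ^ 2) ∧ c % 3 = 1 ∧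
            ¬ (p : ℤ) ∣ c) ∨
          (p % 3 = 2 ∧ ∃ r' : ℕ, r = 2 * r' ∧ c = -2 * (-(p : ℤ)) ^ r')) :
    (162 : ℤ) * (unitaryCayleyGraph R 3).cliqueCount 3 =
      (q : ℤ) ^ (3 * β + 1) * ((q : ℤ) - 1) * ((q : ℤ) + c - 8) := by
  classical
  have : Finite (IsLocalRing.ResidueField R) :=
    Finite.of_surjective _ (IsLocalRing.residue_surjective (R := R))
  have : Fintype (IsLocalRing.ResidueField R) := Fintype.ofFinite _
  have hcard : Fintype.card (IsLocalRing.ResidueField R) = q := by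
    rw [← hq, Nat.card_eq_fintype_card]
  have hq1 : 1 < q := by rw [← hcard]; exact Fintype.one_lt_card
  have hr : r ≠ 0 := by rintro rfl; simp at hqpr; omega
  have h3q : 3 ∣ q - 1 := by
    rcases Nat.even_or_odd q with h | h
    · exact hdiv.1 h
    · exact Dvd.dvd.trans (by norm_num) (hdiv.2 h)
  have := Fact.mk hp
  have : CharP (IsLocalRing.ResidueField R) p :=
    charP_of_card_eq_prime_pow (f := r) (by rw [hcard, hqpr])
  have hp3 : p ≠ 3 := by rintro rfl; omega
  have h30 : (3 : IsLocalRing.ResidueField R) ≠ 0 := by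
    intro h
    have : ((3 : ℕ) : IsLocalRing.ResidueField R) = 0 := by exact_mod_cast h
    rw [CharP.cast_eq_zero_iff _ p] at this
    exact hp3 ((Nat.prime_dvd_prime_iff_eq hp Nat.prime_three).mp this)
  obtain ⟨a, b, ha, hb, hab, hN, hC⟩ :=
    cyclo_complex (F := IsLocalRing.ResidueField R) (by rw [hcard]; exact h3q)
  rw [hcard] at hab hN hC
  have hcc : 2 * a - b = c := by
    rcases hc with ⟨hp1, ⟨d, hd⟩, hc3, hpc⟩ | ⟨hp2, r', hr', hc⟩
    · obtain ⟨d', rfl⟩ : ∃ d', b = 3 * d' := ⟨b / 3, by omega⟩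
      have hqz : (q : ℤ) = (p : ℤ) ^ r := by rw [hqpr]; push_cast; rfl
      refine aux_split hp hp1 hr (d := d') (d' := d) ?_ ?_ ?_ hc3 ?_ hpc
      · rw [← hqz, ← hab]; ring
      · rw [← hqz]; exact hd
      · omega
      · intro hdv
        obtain ⟨e, he⟩ : ∃ e, q = 3 * e + 1 := ⟨(q - 1) / 3, by omega⟩
        have hm' := cyclo_mod (F := IsLocalRing.ResidueField R) (e := e) (by rw [hcard, he])
        have hN' := congrArg (Int.cast : ℤ → IsLocalRing.ResidueField R) hN
        push_cast at hN'
        rw [hm', hcard] at hN'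
        have hz := (CharP.intCast_eq_zero_iff (IsLocalRing.ResidueField R) p _).mpr hdv
        push_cast at hz
        rw [hz] at hN'
        have h0 : (-1) ^ e * (((2 * e).choose e : ℕ) : IsLocalRing.ResidueField R) = 0 := by
          linear_combination -hN'
        rw [mul_eq_zero] at h0
        rcases h0 with h0 | h0
        · exact pow_ne_zero e (by simp) h0
        · rw [CharP.cast_eq_zero_iff _ p] at h0
          exact aux_choose hp hp1 r e (by rw [← hqpr, he]) h0
    · rw [hc]
      refine aux_inert hp hp2 ha hb ?_
      rw [hab, hqpr, hr']; push_cast; rfl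
  have k1 : 6 * (unitaryCayleyGraph R 3).cliqueCount 3 =
      Nat.card R * (Nat.card {x : R // UCube x} * Nat.card {x : R // UCube x ∧ UCube (x - 1)}) := by
    rw [six_mul_cliqueCount, ← card_triples]
    simp only [adj_iff]
  have k2 : Nat.card {x : R // UCube x} =
      q ^ β * Nat.card {y : IsLocalRing.ResidueField R // UCube y} := by
    rw [← hm, ← card_fiber R (fun y => UCube y)]
    simp only [ucube_residue h30]
  have k3 : Nat.card {x : R // UCube x ∧ UCube (x - 1)} =
      q ^ β * Nat.card {y : IsLocalRing.ResidueField R // UCube y ∧ UCube (y - 1)} := by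
    rw [← hm, ← card_fiber R (fun y => UCube y ∧ UCube (y - 1))]
    simp only [ucube_residue h30, map_sub, map_one]
  have k4 : Nat.card R = q ^ β * q := by
    have := card_fiber R (fun _ => True)
    rw [hm] at this
    rw [← hq, ← Nat.card_congr (Equiv.subtypeUnivEquiv (p := fun _ : R => True) (fun _ => trivial)),
      this, hq, ← hq,
      Nat.card_congr (Equiv.subtypeUnivEquiv (p := fun _ : IsLocalRing.ResidueField R => True)
        (fun _ => trivial))]
  rw [k2, k3, k4] at k1
  have k1' := congrArg (Nat.cast : ℕ → ℤ) k1
  push_cast at k1'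
  rw [hcc] at hN
  have e1 : (q : ℤ) + c - 8 =
      9 * (Nat.card {y : IsLocalRing.ResidueField R // UCube y ∧ UCube (y - 1)} : ℤ) := by
    rw [hN]; ring
  rw [e1, ← hC]
  have e2 : (q : ℤ) ^ (3 * β + 1) = ((q : ℤ) ^ β) ^ 3 * q := by
    rw [pow_succ, mul_comm 3 β, pow_mul]
  rw [e2]
  linear_combination 27 * k1'
end

section
/- Let (R,𝔪) be a finite commutative local ring with identity, with maximal ideal of size |𝔪| = q^β and residue field R/𝔪 of size q = p^r (p prime), where gcd(4,|R|) = 1 and q ≡ 1 (mod 8). Let e, f ∈ ℤ with q = e² + 4f², e ≡ 1 (mod 4), and such that p does not divide e when p ≡ 1 (mod 4). Then the number of triangles in G_R(4) is K_3(G_R(4)) = q^(3β+1) (q−1)(q − 6e − 11) / (2⁷ · 3). -/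
set_option linter.all false

namespace TriAux

/-- nonzero fourth power -/
def P {F : Type*} [Field F] (x : F) : Prop := ∃ u : F, u ≠ 0 ∧ x = u ^ 4

/-- the imaginary unit -/
def I : GaussianInt := ⟨0, 1⟩

lemma I_sq : I ^ 2 = -1 := by decide
lemma I_four : I ^ 4 = 1 := by decide

lemma I_pow_mod (n : ℕ) : I ^ n = I ^ (n % 4) := by
  conv_lhs => rw [← Nat.div_add_mod n 4, pow_add, pow_mul, I_four, one_pow, one_mul]

lemma I_pow_eq_one {n : ℕ} (h : I ^ n = 1) : 4 ∣ n := by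
  rw [I_pow_mod] at h
  have : n % 4 < 4 := Nat.mod_lt _ (by norm_num)
  apply Nat.dvd_of_mod_eq_zero
  generalize n % 4 = m at *
  interval_cases m
  · rfl
  all_goals exact absurd h (by decide)

lemma I_sum (n : ℕ) : 1 + I ^ n + (I ^ n) ^ 2 + (I ^ n) ^ 3 = if 4 ∣ n then 4 else 0 := by
  rw [I_pow_mod]
  have : n % 4 < 4 := Nat.mod_lt _ (by norm_num)
  have e : (4 ∣ n) ↔ n % 4 = 0 := Nat.dvd_iff_mod_eq_zero
  simp only [e]
  generalize n % 4 = m at *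
  interval_cases m <;> decide

variable {F : Type*} [Field F] [Fintype F]

lemma exists_char (hq : Fintype.card F % 8 = 1) :
    ∃ (χ : MulChar F GaussianInt) (φ : GaussianInt →+* F) (g : Fˣ),
      (∀ x, x ∈ Submonoid.powers g) ∧ χ g = I ∧
      ∀ x : F, φ (χ x) = x ^ ((Fintype.card F - 1) / 4) := by
  classical
  obtain ⟨g, hg⟩ := IsCyclic.exists_generator (α := Fˣ)
  have hc : Fintype.card Fˣ = Fintype.card F - 1 := Fintype.card_units F
  have hF : 1 < Fintype.card F := Fintype.one_lt_card
  have hord : orderOf g = Fintype.card F - 1 := by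
    rw [orderOf_eq_card_of_forall_mem_zpowers hg, Nat.card_eq_fintype_card, hc]
  set m := (Fintype.card F - 1) / 4 with hm
  have hm4 : Fintype.card F - 1 = 4 * m := by omega
  have hmpos : 0 < m := by omega
  let u : GaussianIntˣ := ⟨I, -I, by decide, by decide⟩
  have hu4 : u ^ 4 = 1 := by ext1; exact I_four
  have hu : u ∈ rootsOfUnity (Fintype.card Fˣ) GaussianInt := by
    rw [mem_rootsOfUnity, hc, hm4, pow_mul, hu4, one_pow]
  have hpow : ∀ x, x ∈ Submonoid.powers g := fun x => by
    rw [mem_powers_iff_mem_zpowers]; exact hg x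
  have hι : ((g : F) ^ m) * ((g : F) ^ m) = ((-1 : ℤ) : F) := by
    have h1 : (((g : F) ^ m) ^ 2) ^ 2 = 1 := by
      have := pow_orderOf_eq_one g
      rw [hord, hm4] at this
      have := congrArg (Units.val) this
      push_cast at this
      rw [← pow_mul, ← pow_mul, ← this]; congr 1; ring
    have h2 : ((g : F) ^ m) ^ 2 ≠ 1 := by
      intro h
      have h3 : g ^ (m * 2) = 1 := by ext; push_cast; rw [pow_mul]; exact h
      have := orderOf_dvd_of_pow_eq_one h3
      have := Nat.le_of_dvd (by omega) this
      omega
    have h3 := eq_or_eq_neg_of_sq_eq_sq _ 1 (h1.trans (one_pow 2).symm)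
    rcases h3 with h | h
    · exact absurd h h2
    · rw [← sq, h]; simp
  refine ⟨MulChar.ofRootOfUnity hu hg, Zsqrtd.lift ⟨_, hι⟩, g, hpow, MulChar.ofRootOfUnity_spec hu hg, ?_⟩
  intro x
  by_cases hx : x = 0
  · subst hx
    rw [MulChar.map_zero, map_zero, zero_pow hmpos.ne']
  · obtain ⟨n, hn⟩ := hpow (Units.mk0 x hx)
    have : x = (g : F) ^ n := by
      have := congrArg Units.val hn
      simpa using this.symm
    rw [this, map_pow, MulChar.ofRootOfUnity_spec hu hg, map_pow, ← pow_mul, mul_comm, pow_mul]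
    congr 1
    simp [Zsqrtd.lift, u, I]


section
variable {χ : MulChar F GaussianInt} {φ : GaussianInt →+* F} {g : Fˣ}

lemma val_char (hg : ∀ x, x ∈ Submonoid.powers g) (hχ : χ g = I) (x : F) (hx : x ≠ 0) :
    ∃ n : ℕ, x = (g : F) ^ n ∧ χ x = I ^ n := by
  obtain ⟨n, hn⟩ := hg (Units.mk0 x hx)
  have : x = (g : F) ^ n := by
    have := congrArg Units.val hn
    simpa using this.symm
  exact ⟨n, this, by rw [this, map_pow, hχ]⟩

lemma char_ext {R : Type*} [CommRing R] (hg : ∀ x, x ∈ Submonoid.powers g) {χ₁ χ₂ : MulChar F R}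
    (h : χ₁ g = χ₂ g) : χ₁ = χ₂ := by
  ext x
  obtain ⟨n, hn⟩ := hg x
  have : (x : F) = (g : F) ^ n := by
    have := congrArg Units.val hn
    simpa using this.symm
  rw [this, map_pow, map_pow, h]

lemma chi_four (hg : ∀ x, x ∈ Submonoid.powers g) (hχ : χ g = I) : χ ^ 4 = 1 := by
  apply char_ext hg
  rw [MulChar.pow_apply_coe, hχ, I_four, MulChar.one_apply_coe]

lemma chi_ne (hχ : χ g = I) : χ ≠ 1 ∧ χ ^ 2 ≠ 1 ∧ χ ^ 3 ≠ 1 := by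
  refine ⟨?_, ?_, ?_⟩
  · intro h
    rw [h, MulChar.one_apply_coe] at hχ
    exact absurd hχ (by decide)
  · intro h
    have : (χ ^ 2) g = 1 := by rw [h, MulChar.one_apply_coe]
    rw [MulChar.pow_apply_coe, hχ] at this
    exact absurd this (by decide)
  · intro h
    have : (χ ^ 3) g = 1 := by rw [h, MulChar.one_apply_coe]
    rw [MulChar.pow_apply_coe, hχ] at this
    exact absurd this (by decide)

lemma chi_pow4 (hg : ∀ x, x ∈ Submonoid.powers g) (hχ : χ g = I) (u : F) (hu : u ≠ 0) :
    χ (u ^ 4) = 1 := by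
  obtain ⟨n, -, hn⟩ := val_char hg hχ u hu
  rw [map_pow, hn, ← pow_mul, mul_comm, pow_mul, I_four, one_pow]

open Classical in
lemma T_eq (hg : ∀ x, x ∈ Submonoid.powers g) (hχ : χ g = I) (x : F) :
    (1 : MulChar F GaussianInt) x + χ x + (χ ^ 2) x + (χ ^ 3) x =
      (((if P x then 4 else 0 : ℤ)) : GaussianInt) := by
  by_cases hx : x = 0
  · subst hx
    have : ¬ P (0 : F) := by
      rintro ⟨u, hu, h⟩
      exact pow_ne_zero 4 hu h.symm
    simp only [MulChar.map_zero, this, if_false]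
    simp
  · obtain ⟨n, hn, hn'⟩ := val_char hg hχ x hx
    have h1 : (1 : MulChar F GaussianInt) x = 1 := MulChar.one_apply (isUnit_iff_ne_zero.mpr hx)
    rw [MulChar.pow_apply' _ (by norm_num), MulChar.pow_apply' _ (by norm_num), h1, hn', I_sum]
    have : P x ↔ 4 ∣ n := by
      constructor
      · rintro ⟨u, hu, h⟩
        apply I_pow_eq_one
        rw [← hn', h, chi_pow4 hg hχ u hu]
      · rintro ⟨k, rfl⟩
        exact ⟨(g : F) ^ k, pow_ne_zero _ g.ne_zero, by rw [hn, ← pow_mul, mul_comm]⟩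
    simp only [this]
    split_ifs <;> simp

lemma two_ne (hq : Fintype.card F % 8 = 1) : (2 : F) ≠ 0 := by
  intro h
  have : ringChar F = 2 := by
    have h2 : ringChar F ∣ 2 := ringChar.dvd (by exact_mod_cast h)
    rcases (Nat.dvd_prime Nat.prime_two).mp h2 with h3 | h3
    · exact absurd h3 CharP.ringChar_ne_one
    · exact h3
  have := FiniteField.even_card_of_char_two this
  omega

lemma exists_z (hq : Fintype.card F % 8 = 1) (hχ : χ g = I)
    (hφ : ∀ x : F, φ (χ x) = x ^ ((Fintype.card F - 1) / 4)) : ∃ z : F, z ^ 4 = -1 := by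
  refine ⟨(g : F) ^ ((Fintype.card F - 1) / 8), ?_⟩
  have h := hφ g
  rw [hχ] at h
  have h2 : φ I ^ 2 = -1 := by rw [← map_pow, I_sq]; simp
  rw [← h2, h, ← pow_mul, ← pow_mul]
  congr 1
  omega

lemma chi_neg_one (hg : ∀ x, x ∈ Submonoid.powers g) (hχ : χ g = I) {z : F} (hz : z ^ 4 = -1) :
    χ (-1) = 1 := by
  rw [← hz]
  apply chi_pow4 hg hχ
  rintro rfl
  simp at hz

lemma chi_4 (h2 : (2 : F) ≠ 0) (hg : ∀ x, x ∈ Submonoid.powers g) (hχ : χ g = I) {z : F}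
    (hz : z ^ 4 = -1) : χ 4 = 1 := by
  have : (4 : F) = (z * (1 + z ^ 2)) ^ 4 := by
    have : (1 + z ^ 2) ^ 4 = -4 := by
      have : (1 + z ^ 2) ^ 2 = 2 * z ^ 2 := by linear_combination hz
      calc (1 + z ^ 2) ^ 4 = ((1 + z ^ 2) ^ 2) ^ 2 := by ring
        _ = _ := by rw [this]; linear_combination 4 * hz
    rw [mul_pow, this, hz]; ring
  rw [this]
  apply chi_pow4 hg hχ
  intro h
  rw [h] at this
  have h4 : (2 : F) * 2 = 0 := by norm_num; simpa using this
  exact h2 (by simpa using h4)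

lemma rho_eq [DecidableEq F] (hg : ∀ x, x ∈ Submonoid.powers g) (hχ : χ g = I) :
    χ ^ 2 = (quadraticChar F).ringHomComp (Int.castRingHom GaussianInt) := by
  apply char_ext hg
  have : quadraticChar F (g : F) = -1 := by
    rw [quadraticChar_neg_one_iff_not_isSquare]
    rintro ⟨y, hy⟩
    have hy0 : y ≠ 0 := by
      rintro rfl
      exact g.ne_zero (by simpa using hy)
    obtain ⟨n, -, hn⟩ := val_char hg hχ y hy0
    rw [hy, map_mul, hn] at hχ
    have : (I ^ n * I ^ n) ^ 2 = 1 := by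
      rw [← sq, ← pow_mul, ← pow_mul, mul_comm, pow_mul, I_four, one_pow]
    rw [hχ] at this
    exact absurd this (by decide)
  rw [MulChar.pow_apply_coe, hχ, MulChar.ringHomComp_apply, this]
  decide

lemma sum_sq (hq : Fintype.card F % 8 = 1) (hg : ∀ x, x ∈ Submonoid.powers g) (hχ : χ g = I)
    (h : F → GaussianInt) : ∑ y : F, h (y ^ 2) = ∑ t : F, h t * (1 + (χ ^ 2) t) := by
  classical
  have hc : ringChar F ≠ 2 := by
    intro h
    have := FiniteField.even_card_of_char_two h
    omega
  rw [← Finset.sum_fiberwise (s := Finset.univ) (g := fun y : F => y ^ 2)]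
  apply Finset.sum_congr rfl
  intro t _
  have : ∀ y ∈ Finset.univ.filter (fun y : F => y ^ 2 = t), h (y ^ 2) = h t := by
    intro y hy
    rw [(Finset.mem_filter.mp hy).2]
  rw [Finset.sum_congr rfl this, Finset.sum_const, nsmul_eq_mul, mul_comm]
  congr 1
  have h3 := quadraticChar_card_sqrts hc t
  rw [rho_eq hg hχ, MulChar.ringHomComp_apply]
  have h4 : (Finset.univ.filter (fun y : F => y ^ 2 = t)) = {x : F | x ^ 2 = t}.toFinset := by
    ext; simp
  rw [h4]
  have := congrArg (Int.cast : ℤ → GaussianInt) h3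
  push_cast at this
  rw [this, add_comm]
  rfl

lemma J_chi_chi (hq : Fintype.card F % 8 = 1) (hg : ∀ x, x ∈ Submonoid.powers g) (hχ : χ g = I)
    {z : F} (hz : z ^ 4 = -1) : jacobiSum χ χ = jacobiSum χ (χ ^ 2) := by
  have h2 := two_ne hq
  have h4 := chi_4 h2 hg hχ hz
  have e1 : jacobiSum χ χ = ∑ y : F, χ (1 - y ^ 2) := by
    have hb : Function.Bijective (fun x : F => 2 * x - 1) := by
      rw [Function.Bijective, and_iff_left_of_imp]
      · intro a b hab
        simpa [h2] using hab
      · exact fun h => (Finite.injective_iff_surjective.mp h)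
    rw [← hb.sum_comp (fun y => χ (1 - y ^ 2)), jacobiSum]
    apply Finset.sum_congr rfl
    intro x _
    rw [← map_mul, ← one_mul (χ (x * (1 - x))), ← h4, ← map_mul]
    congr 1
    ring
  rw [e1, sum_sq hq hg hχ (fun t => χ (1 - t)), jacobiSum_comm, jacobiSum]
  simp only [mul_add, mul_one, Finset.sum_add_distrib]
  have : ∑ x : F, χ (1 - x) = 0 := by
    refine ((Equiv.subLeft (1 : F)).sum_comp (fun x => χ x)).trans ?_
    exact MulChar.sum_eq_zero_of_ne_one (chi_ne hχ).1
  rw [this, zero_add]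
  simp only [mul_comm]

lemma star_chi (hg : ∀ x, x ∈ Submonoid.powers g) (hχ : χ g = I) :
    χ.ringHomComp (starRingEnd GaussianInt) = χ ^ 3 := by
  apply char_ext hg
  rw [MulChar.pow_apply_coe, hχ, MulChar.ringHomComp_apply, hχ]
  decide

lemma star_rho (hg : ∀ x, x ∈ Submonoid.powers g) (hχ : χ g = I) :
    (χ ^ 2).ringHomComp (starRingEnd GaussianInt) = χ ^ 2 := by
  apply char_ext hg
  rw [MulChar.ringHomComp_apply, MulChar.pow_apply_coe, hχ]
  decide

lemma J_norm (hg : ∀ x, x ∈ Submonoid.powers g) (hχ : χ g = I) :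
    jacobiSum χ (χ ^ 2) * jacobiSum (χ ^ 3) (χ ^ 2) = (Fintype.card F : GaussianInt) := by
  have hinj : Function.Injective GaussianInt.toComplex := by
    intro a b h
    exact GaussianInt.toComplex_inj.mp h
  have hn := chi_ne hχ
  have h4 := chi_four hg hχ
  have hne : ∀ ψ : MulChar F GaussianInt, ψ ≠ 1 → ψ.ringHomComp GaussianInt.toComplex ≠ 1 := by
    intro ψ hψ h
    apply hψ
    refine MulChar.ext fun x => ?_
    apply hinj
    have := congrArg (fun c : MulChar F ℂ => c x) h
    simpa [MulChar.ringHomComp_apply] using this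
  have hmul : ∀ a b : MulChar F GaussianInt, (a * b).ringHomComp GaussianInt.toComplex =
      a.ringHomComp GaussianInt.toComplex * b.ringHomComp GaussianInt.toComplex := by
    intro a b
    ext x
    simp [MulChar.ringHomComp_apply]
  have hone : (1 : MulChar F GaussianInt).ringHomComp GaussianInt.toComplex = 1 := by
    ext x
    simp [MulChar.ringHomComp_apply]
  apply hinj
  have hch : ringChar ℂ ≠ ringChar F := by
    rw [ringChar.eq_zero]
    exact (CharP.char_ne_zero_of_finite F (ringChar F)).symm
  have := jacobiSum_mul_jacobiSum_inv hch (hne _ hn.1) (hne _ hn.2.1)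
    (by rw [← hmul]; apply hne; rw [← pow_succ']; exact hn.2.2)
  have i1 : (χ.ringHomComp GaussianInt.toComplex)⁻¹ = (χ ^ 3).ringHomComp GaussianInt.toComplex := by
    rw [inv_eq_iff_mul_eq_one, ← hmul, ← pow_succ', h4, hone]
  have i2 : ((χ ^ 2).ringHomComp GaussianInt.toComplex)⁻¹ =
      (χ ^ 2).ringHomComp GaussianInt.toComplex := by
    rw [inv_eq_iff_mul_eq_one, ← hmul, ← pow_add, h4, hone]
  rw [i1, i2, jacobiSum_ringHomComp, jacobiSum_ringHomComp, ← map_mul] at this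
  rw [this, map_natCast]

lemma J_congr (hg : ∀ x, x ∈ Submonoid.powers g) (hχ : χ g = I) :
    (1 - I) * 2 ∣ ((Fintype.card F : ℕ) : GaussianInt) + jacobiSum χ (χ ^ 2) := by
  have hn := chi_ne hχ
  have : ((Fintype.card F : ℕ) : GaussianInt) + jacobiSum χ (χ ^ 2) =
      ∑ x : F, ((1 : MulChar F GaussianInt) x - χ x) *
        ((1 : MulChar F GaussianInt) (1 - x) - (χ ^ 2) (1 - x)) := by
    have e : ∑ x : F, ((1 : MulChar F GaussianInt) x - χ x) *
        ((1 : MulChar F GaussianInt) (1 - x) - (χ ^ 2) (1 - x)) =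
        jacobiSum (1 : MulChar F GaussianInt) 1 - jacobiSum 1 (χ ^ 2) - jacobiSum χ 1 + jacobiSum χ (χ ^ 2) := by
      simp only [jacobiSum, ← Finset.sum_sub_distrib, ← Finset.sum_add_distrib]
      apply Finset.sum_congr rfl
      intros
      ring
    rw [e, jacobiSum_one_one, jacobiSum_comm χ 1, jacobiSum_one_nontrivial hn.1,
      jacobiSum_one_nontrivial hn.2.1]
    ring
  rw [this]
  apply Finset.dvd_sum
  intro x _
  apply mul_dvd_mul
  · by_cases hx : x = 0
    · subst hx; simp only [MulChar.map_zero, sub_self, dvd_zero]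
    · obtain ⟨n, -, h⟩ := val_char hg hχ x hx
      rw [h, MulChar.one_apply (isUnit_iff_ne_zero.mpr hx)]
      simpa using sub_dvd_pow_sub_pow (1 : GaussianInt) I n
  · generalize 1 - x = x
    by_cases hx : x = 0
    · subst hx; simp only [MulChar.map_zero, sub_self, dvd_zero]
    · obtain ⟨n, -, h⟩ := val_char hg hχ x hx
      rw [MulChar.pow_apply' _ (by norm_num), h, MulChar.one_apply (isUnit_iff_ne_zero.mpr hx),
        ← pow_mul, mul_comm, pow_mul, I_sq]
      have := sub_dvd_pow_sub_pow (1 : GaussianInt) (-1) n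
      have h2 : (1 : GaussianInt) - (-1) = 2 := by decide
      rw [h2] at this
      simpa using this

end

lemma sum_pow_all (i : ℕ) (hi : i ≠ 0) :
    ∑ x : F, x ^ i = if Fintype.card F - 1 ∣ i then -1 else 0 := by
  classical
  rw [← FiniteField.sum_pow_units F i]
  symm
  rw [← Finset.sum_filter_of_ne (p := fun x : F => x ≠ 0)
    (fun x _ h hx => h (by rw [hx, zero_pow hi]))]
  refine Finset.sum_bij (fun (u : Fˣ) _ => (u : F)) ?_ ?_ ?_ ?_
  · intro a _; simp
  · intro a _ b _ h; exact Units.ext h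
  · intro b hb
    exact ⟨Units.mk0 b (Finset.mem_filter.mp hb).2, Finset.mem_univ _, rfl⟩
  · intro a _; rfl

lemma binom_ne {p r m : ℕ} (hp : p.Prime) (hp4 : p % 4 = 1) (hm : p ^ r = 4 * m + 1) :
    ¬ p ∣ (m + m).choose m := by
  intro h
  have h0 : (m + m).choose m ≠ 0 := (Nat.choose_pos (by omega)).ne'
  have h1 : 0 < ((m + m).choose m).factorization p := hp.factorization_pos_of_dvd h0 h
  have hlt : Nat.log p (m + m) < r + 1 := by
    apply Nat.lt_succ_of_le
    calc Nat.log p (m + m) ≤ Nat.log p (p ^ r) := Nat.log_mono_right (by omega)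
      _ = r := Nat.log_pow hp.one_lt r
  rw [Nat.factorization_choose' hp hlt, Finset.card_pos] at h1
  obtain ⟨i, hi⟩ := h1
  rw [Finset.mem_filter, Finset.mem_Ico] at hi
  obtain ⟨⟨hi1, hi2⟩, hi3⟩ := hi
  have hmod : ∀ j, p ^ j % 4 = 1 := fun j => by
    rw [Nat.pow_mod, hp4]; simp
  have e : p ^ r = p ^ i * p ^ (r - i) := by rw [← pow_add]; congr 1; omega
  obtain ⟨a, ha⟩ : ∃ a, p ^ i = 4 * a + 1 := ⟨p ^ i / 4, by have := hmod i; omega⟩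
  obtain ⟨b, hb⟩ : ∃ b, p ^ (r - i) = 4 * b + 1 := ⟨p ^ (r - i) / 4, by have := hmod (r - i); omega⟩
  have hmm : m = a + p ^ i * b := by
    have : 4 * m + 1 = (4 * a + 1) * (4 * b + 1) := by rw [← hm, e, ha, hb]
    rw [ha]
    nlinarith
  have : m % p ^ i = a := by
    rw [hmm, Nat.add_mul_mod_self_left, Nat.mod_eq_of_lt (by omega)]
  omega

section
variable {χ : MulChar F GaussianInt} {φ : GaussianInt →+* F} {g : Fˣ}

lemma phi_J {p r : ℕ} (hp : p.Prime) (hp4 : p % 4 = 1) (hc : Fintype.card F = p ^ r)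
    (hq : Fintype.card F % 8 = 1)
    (hφ : ∀ x : F, φ (χ x) = x ^ ((Fintype.card F - 1) / 4)) :
    φ (jacobiSum (χ ^ 3) (χ ^ 2)) ≠ 0 := by
  have hF : 1 < Fintype.card F := Fintype.one_lt_card
  set m := (Fintype.card F - 1) / 4 with hm
  have hm4 : Fintype.card F = 4 * m + 1 := by omega
  have hm0 : 0 < m := by omega
  have hr : r ≠ 0 := by
    rintro rfl
    simp at hc
    omega
  have key : φ (jacobiSum (χ ^ 3) (χ ^ 2)) = -((-1) ^ m * ((m + m).choose m : ℕ)) := by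
    rw [jacobiSum, map_sum]
    have e1 : ∀ x : F, φ ((χ ^ 3) x * (χ ^ 2) (1 - x)) = ∑ k ∈ Finset.range (m + m + 1),
        ((-1) ^ k * ((m + m).choose k : ℕ)) * x ^ (3 * m + k) := by
      intro x
      rw [MulChar.pow_apply' _ (by norm_num), MulChar.pow_apply' _ (by norm_num), map_mul,
        map_pow, map_pow, hφ, hφ, ← pow_mul, ← pow_mul,
        show (1 - x) = (-x + 1) by ring, show m * 2 = m + m by ring, add_pow, Finset.mul_sum]
      apply Finset.sum_congr rfl
      intro k _
      rw [neg_pow, pow_add, one_pow, mul_comm m 3]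
      ring
    simp only [e1]
    rw [Finset.sum_comm]
    simp only [← Finset.mul_sum]
    rw [Finset.sum_eq_single m]
    · rw [sum_pow_all _ (by omega), if_pos ⟨1, by omega⟩]; ring
    · intro k hk hkm
      rw [Finset.mem_range] at hk
      rw [sum_pow_all _ (by omega), if_neg, mul_zero]
      rintro ⟨c, hc⟩
      have h1 : Fintype.card F - 1 = 4 * m := by omega
      rw [h1] at hc
      rcases Nat.lt_or_ge c 2 with h | h
      · interval_cases c <;> omega
      · have : 4 * m * 2 ≤ 4 * m * c := Nat.mul_le_mul_left _ h
        omega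
    · intro h
      exact absurd (Finset.mem_range.mpr (by omega)) h
  rw [key, neg_ne_zero]
  apply mul_ne_zero (pow_ne_zero _ (neg_ne_zero.mpr one_ne_zero))
  have : CharP F p := by
    have := Fact.mk hp
    have h0 : (p : F) = 0 := by
      have : ((p ^ r : ℕ) : F) = 0 := by rw [← hc]; simp
      push_cast at this
      exact pow_eq_zero_iff hr |>.mp this
    have := ringChar.of_eq (R := F) (p := ringChar F) rfl
    have hd : ringChar F ∣ p := ringChar.dvd h0
    rcases (Nat.dvd_prime hp).mp hd with h3 | h3
    · exact absurd h3 CharP.ringChar_ne_one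
    · rw [← h3]; infer_instance
  rw [Ne, CharP.cast_eq_zero_iff F p]
  exact binom_ne hp hp4 (r := r) (by omega)

end

lemma descent {p : ℕ} (hp : p.Prime) (hp4 : p % 4 = 3) : ∀ (r : ℕ) (a b : ℤ),
    a ^ 2 + b ^ 2 = (p : ℤ) ^ r → a = 0 ∨ b = 0 := by
  have := Fact.mk hp
  have hpos : (0 : ℤ) < p := by exact_mod_cast hp.pos
  intro r
  induction r using Nat.strong_induction_on with
  | _ r ih =>
    intro a b h
    rcases Nat.eq_zero_or_pos r with rfl | hr
    · by_contra hcon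
      push Not at hcon
      have h1 : 0 < a ^ 2 := by have := hcon.1; positivity
      have h2 : 0 < b ^ 2 := by have := hcon.2; positivity
      simp at h
      omega
    · have hz : (a : ZMod p) ^ 2 = - (b : ZMod p) ^ 2 := by
        have : ((a ^ 2 + b ^ 2 : ℤ) : ZMod p) = 0 := by
          rw [h]; push_cast; simp [hr.ne']
        push_cast at this
        linear_combination this
      have hb : (b : ZMod p) = 0 := by
        by_contra hb
        exact ZMod.mod_four_ne_three_of_sq_eq_neg_sq' hb hz hp4
      have ha : (a : ZMod p) = 0 := by
        rw [hb] at hz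
        simpa using hz
      rw [ZMod.intCast_zmod_eq_zero_iff_dvd] at ha hb
      obtain ⟨a, rfl⟩ := ha
      obtain ⟨b, rfl⟩ := hb
      have h2 : 2 ≤ r := by
        by_contra h2
        have : r = 1 := by omega
        subst this
        have : (p : ℤ) * (p * (a ^ 2 + b ^ 2)) = p * 1 := by linear_combination h
        have := mul_left_cancel₀ hpos.ne' this
        have := Int.eq_one_or_neg_one_of_mul_eq_one this
        have := hp.two_le
        omega
      have := ih (r - 2) (by omega) a b (by
        have h3 : (p : ℤ) ^ r = p ^ 2 * p ^ (r - 2) := by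
          rw [← pow_add]; congr 1; omega
        rw [h3] at h
        have : (p : ℤ) ^ 2 ≠ 0 := by positivity
        apply mul_left_cancel₀ this
        linear_combination h)
      rcases this with h | h <;> simp [h]

lemma uniq {p r : ℕ} (hp : p.Prime) (hp2 : p ≠ 2) {a b e f : ℤ} (hr : r ≠ 0)
    (h1 : a ^ 2 + b ^ 2 = (p : ℤ) ^ r) (h2 : e ^ 2 + f ^ 2 = (p : ℤ) ^ r)
    (ha : ¬ (p : ℤ) ∣ a) (he : ¬ (p : ℤ) ∣ e) (hao : a % 2 = 1) (heo : e % 2 = 1) :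
    a ^ 2 = e ^ 2 := by
  have hpp : Prime (p : ℤ) := Nat.prime_iff_prime_int.mp hp
  have hq0 : (p : ℤ) ^ r ≠ 0 := pow_ne_zero _ hpp.ne_zero
  have hf : ¬ (p : ℤ) ∣ f := by
    intro h
    apply he
    have : (p : ℤ) ∣ e ^ 2 := by
      have h3 : (p : ℤ) ∣ (p : ℤ) ^ r := dvd_pow_self _ hr
      rw [← h2] at h3
      exact (dvd_add_left (dvd_pow h (by norm_num))).mp h3
    exact hpp.dvd_of_dvd_pow this
  have h2' : ¬ (p : ℤ) ∣ 2 := by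
    intro h
    have : p ∣ 2 := by exact_mod_cast h
    exact hp2 ((Nat.prime_dvd_prime_iff_eq hp Nat.prime_two).mp this)
  have hodd : ¬ (2 : ℤ) ∣ (p : ℤ) ^ r := by
    intro h
    have h3 := Int.prime_two.dvd_of_dvd_pow h
    have : 2 ∣ p := by exact_mod_cast h3
    exact hp2 ((Nat.prime_dvd_prime_iff_eq Nat.prime_two hp).mp this).symm
  have hprod : (a * f - b * e) * (a * f + b * e) = (p : ℤ) ^ r * (a ^ 2 - e ^ 2) := by
    linear_combination (-e ^ 2) * h1 + a ^ 2 * h2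
  -- the final step from divisibility
  have final : ∀ b : ℤ, a ^ 2 + b ^ 2 = (p : ℤ) ^ r → (p : ℤ) ^ r ∣ a * f - b * e → a ^ 2 = e ^ 2 := by
    rintro b h1 ⟨k, hk⟩
    have hsum : (a * e + b * f) ^ 2 + (a * f - b * e) ^ 2 = ((p : ℤ) ^ r) ^ 2 := by
      linear_combination (e ^ 2 + f ^ 2) * h1 + (p : ℤ) ^ r * h2
    have hprod : (a * f - b * e) * (a * f + b * e) = (p : ℤ) ^ r * (a ^ 2 - e ^ 2) := by
      linear_combination (-e ^ 2) * h1 + a ^ 2 * h2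
    generalize (p : ℤ) ^ r = q at *
    by_cases hk0 : k = 0
    · rw [hk, hk0, mul_zero, zero_mul] at hprod
      have := (mul_eq_zero.mp hprod.symm).resolve_left hq0
      linarith
    · exfalso
      have hk1 : 1 ≤ k ^ 2 := by
        have : 0 < k ^ 2 := by positivity
        omega
      rw [hk] at hsum
      have hq2 : 0 < q ^ 2 := by positivity
      have h0 : (a * e + b * f) ^ 2 = 0 := by
        apply le_antisymm _ (sq_nonneg _)
        nlinarith
      have h0' : a * e = - (b * f) := by
        have := pow_eq_zero_iff (two_ne_zero) |>.mp h0
        linarith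
      have h5 : q * (a ^ 2 + e ^ 2) = q * q := by
        have h6 : (a * e) ^ 2 = (b * f) ^ 2 := by rw [h0']; ring
        have hb : b ^ 2 = q - a ^ 2 := by linarith
        have hf : f ^ 2 = q - e ^ 2 := by linarith
        rw [mul_pow b f, hb, hf] at h6
        linear_combination h6
      have h6 := mul_left_cancel₀ hq0 h5
      apply hodd
      obtain ⟨x, hx⟩ : ∃ x, a = 2 * x + 1 := ⟨a / 2, by omega⟩
      obtain ⟨y, hy⟩ : ∃ y, e = 2 * y + 1 := ⟨e / 2, by omega⟩
      rw [← h6, hx, hy]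
      exact ⟨2 * x ^ 2 + 2 * x + 2 * y ^ 2 + 2 * y + 1, by ring⟩
  by_cases hd : (p : ℤ) ∣ a * f - b * e
  · have hd' : ¬ (p : ℤ) ∣ a * f + b * e := by
      intro h
      have := dvd_add hd h
      have h3 : (p : ℤ) ∣ 2 * (a * f) := by
        have e3 : 2 * (a * f) = a * f - b * e + (a * f + b * e) := by ring
        rw [e3]; exact this
      rcases hpp.dvd_or_dvd h3 with h | h
      · exact h2' h
      · rcases hpp.dvd_or_dvd h with h | h
        · exact ha h
        · exact hf h
    have hco : IsCoprime ((p : ℤ) ^ r) (a * f + b * e) :=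
      IsCoprime.pow_left ((Prime.coprime_iff_not_dvd hpp).mpr hd')
    exact final b h1 (hco.dvd_of_dvd_mul_right ⟨_, hprod⟩)
  · have hco : IsCoprime ((p : ℤ) ^ r) (a * f - b * e) :=
      IsCoprime.pow_left ((Prime.coprime_iff_not_dvd hpp).mpr hd)
    have := hco.dvd_of_dvd_mul_left ⟨_, hprod⟩
    exact final (-b) (by linarith [h1, neg_sq b]) (by simpa using this)

open Classical in
lemma cyclo {p r : ℕ} (hp : p.Prime) (hc : Fintype.card F = p ^ r)
    (hq : Fintype.card F % 8 = 1) {e f : ℤ} (hef : (Fintype.card F : ℤ) = e ^ 2 + 4 * f ^ 2)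
    (he4 : e % 4 = 1) (hpe : p % 4 = 1 → ¬ (p : ℤ) ∣ e) :
    (∃ z : F, z ^ 4 = -1) ∧
    4 * ∑ x : F, (if P x then 1 else 0 : ℤ) = Fintype.card F - 1 ∧
    16 * ∑ x : F, (if P x then 1 else 0 : ℤ) * (if P (1 - x) then 1 else 0 : ℤ) =
      Fintype.card F - 6 * e - 11 := by
  obtain ⟨χ, φ, g, hg, hχ, hφ⟩ := exists_char hq
  obtain ⟨z, hz⟩ := exists_z hq hχ hφ
  obtain ⟨n1, n2, n3⟩ := chi_ne hχ
  have h4 := chi_four hg hχ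
  have hF : 1 < Fintype.card F := Fintype.one_lt_card
  refine ⟨⟨z, hz⟩, ?_, ?_⟩
  · have hinj : Function.Injective (Int.cast : ℤ → GaussianInt) := Int.cast_injective
    apply hinj
    have h1 : ∑ x : F, (1 : MulChar F GaussianInt) x = (Fintype.card F : ℕ) - 1 := by
      rw [MulChar.sum_one_eq_card_units, Fintype.card_units, Nat.cast_sub hF.le]
      simp
    have h2 := Finset.sum_congr (rfl : (Finset.univ : Finset F) = Finset.univ)
      (fun x _ => T_eq hg hχ x)
    simp only [Finset.sum_add_distrib] at h2
    rw [h1, MulChar.sum_eq_zero_of_ne_one n1, MulChar.sum_eq_zero_of_ne_one n2,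
      MulChar.sum_eq_zero_of_ne_one n3] at h2
    rw [Finset.mul_sum]
    push_cast at h2 ⊢
    simp only [mul_ite, mul_one, mul_zero]
    rw [← h2]
    ring
  · -- Jacobi sum computations
    set J := jacobiSum χ (χ ^ 2) with hJ
    have hJ1 : jacobiSum χ χ = J := J_chi_chi hq hg hχ hz
    have hJ3 : jacobiSum (χ ^ 3) (χ ^ 2) = star J := by
      have := jacobiSum_ringHomComp χ (χ ^ 2) (starRingEnd GaussianInt)
      rw [star_chi hg hχ, star_rho hg hχ] at this
      exact this
    have hJ33 : jacobiSum (χ ^ 3) (χ ^ 3) = star J := by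
      have := jacobiSum_ringHomComp χ χ (starRingEnd GaussianInt)
      rw [star_chi hg hχ, hJ1] at this
      exact this
    have hm1 : χ (-1) = 1 := chi_neg_one hg hχ hz
    have i1 : χ⁻¹ = χ ^ 3 := by rw [inv_eq_iff_mul_eq_one, ← pow_succ', h4]
    have i2 : (χ ^ 2)⁻¹ = χ ^ 2 := by rw [inv_eq_iff_mul_eq_one, ← pow_add, h4]
    have j13 : jacobiSum χ (χ ^ 3) = -1 := by
      rw [← i1, jacobiSum_nontrivial_inv n1, hm1]
    have j22 : jacobiSum (χ ^ 2) (χ ^ 2) = -1 := by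
      have := jacobiSum_nontrivial_inv n2
      rw [i2, MulChar.pow_apply' _ (by norm_num), hm1, one_pow] at this
      exact this
    have hnorm := J_norm hg hχ
    rw [hJ3] at hnorm
    have hcong := J_congr hg hχ
    have hab : J.re ^ 2 + J.im ^ 2 = (Fintype.card F : ℤ) := by
      have := congrArg Zsqrtd.re hnorm
      simp at this
      rw [← this]; ring
    obtain ⟨c, hcc⟩ := hcong
    have hre : (Fintype.card F : ℤ) + J.re = 2 * (c.re + c.im) := by
      have := congrArg Zsqrtd.re hcc
      simp [I] at this
      linarith
    have him : J.im = 2 * (c.im - c.re) := by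
      have := congrArg Zsqrtd.im hcc
      simp [I] at this
      linarith
    set a := J.re
    set b := J.im
    have ha2 : a % 2 = 1 := by omega
    have hb4 : b % 4 = 0 := by
      by_contra hb
      obtain ⟨x, hx⟩ : ∃ x, a = 2 * x + 1 := ⟨a / 2, by omega⟩
      obtain ⟨y, hy⟩ : ∃ y, b = 4 * y + 2 := ⟨b / 4, by omega⟩
      obtain ⟨w, hw⟩ := Int.even_mul_succ_self x
      rw [hx, hy] at hab
      have : (2 * x + 1) ^ 2 + (4 * y + 2) ^ 2 = 4 * (x * (x + 1)) + 1 + 16 * (y ^ 2 + y) + 4 := by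
        ring
      rw [this, hw] at hab
      omega
    have ha4 : a % 4 = 3 := by omega
    have hr : r ≠ 0 := by
      rintro rfl
      simp at hc
      omega
    have hp2 : p ≠ 2 := by
      rintro rfl
      have : 2 ∣ Fintype.card F := hc ▸ dvd_pow_self 2 hr
      omega
    have hc' : (Fintype.card F : ℤ) = (p : ℤ) ^ r := by rw [hc]; push_cast; rfl
    have hsq : a ^ 2 = e ^ 2 := by
      have hodd := hp.eq_two_or_odd
      have : p % 4 = 1 ∨ p % 4 = 3 := by omega
      rcases this with h | h
      · apply uniq hp hp2 (b := b) (f := 2 * f) hr (by rw [hab, hc']) (by rw [← hc', hef]; ring) _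
          (hpe h) ha2 (by omega)
        intro hpa
        have hpp : Prime (p : ℤ) := Nat.prime_iff_prime_int.mp hp
        have hpb : (p : ℤ) ∣ b := by
          apply hpp.dvd_of_dvd_pow (n := 2)
          have h3 : (p : ℤ) ∣ (p : ℤ) ^ r := dvd_pow_self _ hr
          rw [← hc', ← hab] at h3
          exact (dvd_add_right (dvd_pow hpa (by norm_num))).mp h3
        apply phi_J hp h hc hq hφ
        rw [hJ3]
        have hd : (p : GaussianInt) ∣ star J := by
          obtain ⟨u, hu⟩ := hpa
          obtain ⟨v, hv⟩ := hpb
          refine ⟨⟨u, -v⟩, ?_⟩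
          apply Zsqrtd.ext
          · simp; exact hu
          · simp; exact hv
        obtain ⟨w, hw⟩ := hd
        rw [hw, map_mul, map_natCast]
        have : ((p ^ r : ℕ) : F) = 0 := by rw [← hc]; simp
        push_cast at this
        rw [(pow_eq_zero_iff hr).mp this, zero_mul]
      · have h1 := descent hp h r a b (by rw [hab, hc'])
        have h2 := descent hp h r e (2 * f) (by rw [← hc', hef]; ring)
        have hb : b = 0 := h1.resolve_left (by omega)
        have hf : 2 * f = 0 := h2.resolve_left (by omega)
        have hf : f = 0 := by omega
        rw [hb] at hab
        rw [hf] at hef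
        linarith
    have hae : a = -e := by
      rcases sq_eq_sq_iff_eq_or_eq_neg.mp hsq with h | h
      · omega
      · exact h
    have hinj : Function.Injective (Int.cast : ℤ → GaussianInt) := Int.cast_injective
    apply hinj
    have h16 : ((16 * ∑ x : F, (if P x then 1 else 0 : ℤ) * (if P (1 - x) then 1 else 0 : ℤ) : ℤ) :
        GaussianInt) = ∑ x : F,
        ((1 : MulChar F GaussianInt) x + χ x + (χ ^ 2) x + (χ ^ 3) x) *
        ((1 : MulChar F GaussianInt) (1 - x) + χ (1 - x) + (χ ^ 2) (1 - x) + (χ ^ 3) (1 - x)) := by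
      rw [Finset.mul_sum, Int.cast_sum]
      apply Finset.sum_congr rfl
      intro x _
      rw [T_eq hg hχ, T_eq hg hχ, ← Int.cast_mul]
      congr 1
      split_ifs <;> norm_num
    have hexp : ∑ x : F,
        ((1 : MulChar F GaussianInt) x + χ x + (χ ^ 2) x + (χ ^ 3) x) *
        ((1 : MulChar F GaussianInt) (1 - x) + χ (1 - x) + (χ ^ 2) (1 - x) + (χ ^ 3) (1 - x)) =
        (jacobiSum (1 : MulChar F GaussianInt) 1 + jacobiSum 1 χ + jacobiSum 1 (χ ^ 2) +
          jacobiSum 1 (χ ^ 3)) +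
        (jacobiSum χ 1 + jacobiSum χ χ + jacobiSum χ (χ ^ 2) + jacobiSum χ (χ ^ 3)) +
        (jacobiSum (χ ^ 2) 1 + jacobiSum (χ ^ 2) χ + jacobiSum (χ ^ 2) (χ ^ 2) +
          jacobiSum (χ ^ 2) (χ ^ 3)) +
        (jacobiSum (χ ^ 3) 1 + jacobiSum (χ ^ 3) χ + jacobiSum (χ ^ 3) (χ ^ 2) +
          jacobiSum (χ ^ 3) (χ ^ 3)) := by
      simp only [jacobiSum, ← Finset.sum_add_distrib]
      apply Finset.sum_congr rfl
      intros
      ring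
    rw [h16, hexp, jacobiSum_comm χ 1, jacobiSum_comm (χ ^ 2) 1, jacobiSum_comm (χ ^ 3) 1,
      jacobiSum_comm (χ ^ 2) χ, jacobiSum_comm (χ ^ 3) χ, jacobiSum_comm (χ ^ 2) (χ ^ 3),
      jacobiSum_one_one, jacobiSum_one_nontrivial n1, jacobiSum_one_nontrivial n2,
      jacobiSum_one_nontrivial n3, hJ1, hJ33, hJ3, j13, j22, ← hJ]
    have hs : J + star J = ((-2 * e : ℤ) : GaussianInt) := by
      apply Zsqrtd.ext
      · have : J.re = -e := hae
        simp [this]; ring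
      · simp
    push_cast at hs ⊢
    linear_combination 3 * hs

open Classical in
lemma six_mul_clique {V : Type*} [Fintype V] (G : SimpleGraph V) :
    (6 * (Nat.card {s : Finset V // G.IsNClique 3 s} : ℤ)) =
      ∑ x : V, ∑ y : V, ∑ z : V, (if G.Adj x y then 1 else 0 : ℤ) *
        (if G.Adj x z then 1 else 0 : ℤ) * (if G.Adj y z then 1 else 0 : ℤ) := by
  let S : Finset (V × V × V) := Finset.univ.filter
    (fun t => G.Adj t.1 t.2.1 ∧ G.Adj t.1 t.2.2 ∧ G.Adj t.2.1 t.2.2)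
  let C : Finset (Finset V) := Finset.univ.filter (fun s => G.IsNClique 3 s)
  have hC : Nat.card {s : Finset V // G.IsNClique 3 s} = C.card := by
    rw [Nat.card_eq_fintype_card, Fintype.card_subtype]
  have hS : (S.card : ℤ) = ∑ x : V, ∑ y : V, ∑ z : V, (if G.Adj x y then 1 else 0 : ℤ) *
        (if G.Adj x z then 1 else 0 : ℤ) * (if G.Adj y z then 1 else 0 : ℤ) := by
    rw [Finset.card_filter]
    push_cast
    rw [Fintype.sum_prod_type]
    apply Finset.sum_congr rfl
    intro x _
    rw [Fintype.sum_prod_type]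
    apply Finset.sum_congr rfl
    intro y _
    apply Finset.sum_congr rfl
    intro z _
    by_cases h1 : G.Adj x y <;> by_cases h2 : G.Adj x z <;> by_cases h3 : G.Adj y z <;>
      simp [h1, h2, h3]
  rw [hC, ← hS]
  have hmap : ∀ t ∈ S, ({t.1, t.2.1, t.2.2} : Finset V) ∈ C := by
    rintro ⟨x, y, z⟩ ht
    simp only [S, C, Finset.mem_filter, Finset.mem_univ, true_and] at ht ⊢
    exact SimpleGraph.is3Clique_iff.mpr ⟨x, y, z, ht.1, ht.2.1, ht.2.2, rfl⟩
  have hfib : ∀ s ∈ C, (S.filter (fun t => ({t.1, t.2.1, t.2.2} : Finset V) = s)).card = 6 := by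
    intro s hs
    simp only [C, Finset.mem_filter, Finset.mem_univ, true_and] at hs
    obtain ⟨a, b, c, hab, hac, hbc, rfl⟩ := SimpleGraph.is3Clique_iff.mp hs
    have nab := hab.ne
    have nac := hac.ne
    have nbc := hbc.ne
    have hset : S.filter (fun t => ({t.1, t.2.1, t.2.2} : Finset V) = {a, b, c}) =
        {(a, b, c), (a, c, b), (b, a, c), (b, c, a), (c, a, b), (c, b, a)} := by
      ext ⟨x, y, z⟩
      simp only [S, Finset.mem_filter, Finset.mem_univ, true_and, Finset.mem_insert,
        Finset.mem_singleton, Prod.mk.injEq]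
      constructor
      · rintro ⟨⟨h1, h2, h3⟩, h⟩
        have n1 := h1.ne
        have n2 := h2.ne
        have n3 := h3.ne
        have hx : x ∈ ({a, b, c} : Finset V) := h ▸ by simp
        have hy : y ∈ ({a, b, c} : Finset V) := h ▸ by simp
        have hz : z ∈ ({a, b, c} : Finset V) := h ▸ by simp
        simp only [Finset.mem_insert, Finset.mem_singleton] at hx hy hz
        clear h hs h1 h2 h3
        grind
      · rintro (⟨rfl, rfl, rfl⟩ | ⟨rfl, rfl, rfl⟩ | ⟨rfl, rfl, rfl⟩ | ⟨rfl, rfl, rfl⟩ |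
          ⟨rfl, rfl, rfl⟩ | ⟨rfl, rfl, rfl⟩) <;>
        refine ⟨by simp [hab, hac, hbc, hab.symm, hac.symm, hbc.symm], ?_⟩ <;>
        (ext w; simp only [Finset.mem_insert, Finset.mem_singleton] <;> tauto)
    rw [hset]
    simp [Finset.card_insert_of_notMem, nab, nac, nbc, nab.symm, nac.symm, nbc.symm]
  rw [Finset.card_eq_sum_card_fiberwise hmap, Finset.sum_congr rfl hfib]
  simp [mul_comm]

section
variable {R : Type*} [CommRing R] [IsLocalRing R] [Fintype R]

lemma fourth_iff (hodd : Nat.card (IsLocalRing.maximalIdeal R) % 2 = 1) (x : R) :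
    (∃ u : Rˣ, x = (u : R) ^ 4) ↔ P (IsLocalRing.residue R x) := by
  constructor
  · rintro ⟨u, rfl⟩
    exact ⟨IsLocalRing.residue R u, (u.isUnit.map (IsLocalRing.residue R)).ne_zero, by simp⟩
  · rintro ⟨v, hv, h⟩
    obtain ⟨w, rfl⟩ := IsLocalRing.residue_surjective v
    have hw : IsUnit w := IsLocalRing.residue_ne_zero_iff_isUnit _ |>.mp hv
    have hx : IsUnit x := by
      rw [← IsLocalRing.residue_ne_zero_iff_isUnit, h]
      exact pow_ne_zero _ hv
    obtain ⟨w, rfl⟩ := hw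
    obtain ⟨x, rfl⟩ := hx
    let f : Rˣ →* (IsLocalRing.ResidueField R)ˣ := Units.map (IsLocalRing.residue R).toMonoidHom
    have hker : ∀ u : Rˣ, u ∈ f.ker ↔ (u : R) - 1 ∈ IsLocalRing.maximalIdeal R := by
      intro u
      rw [MonoidHom.mem_ker, ← IsLocalRing.residue_eq_zero_iff, map_sub, map_one, sub_eq_zero,
        Units.ext_iff]
      rfl
    have hcard : Nat.card f.ker = Nat.card (IsLocalRing.maximalIdeal R) := by
      apply Nat.card_eq_of_bijective
        (fun u : f.ker => (⟨(u : Rˣ) - 1, (hker u).mp u.2⟩ : IsLocalRing.maximalIdeal R))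
      constructor
      · intro a b hab
        have := congrArg Subtype.val hab
        simp only [sub_left_inj] at this
        exact Subtype.ext (Units.ext this)
      · rintro ⟨m, hm⟩
        have hu : IsUnit (1 + m) := by
          rw [← IsLocalRing.residue_ne_zero_iff_isUnit, map_add,
            (IsLocalRing.residue_eq_zero_iff m).mpr hm]
          simp
        obtain ⟨u, hu⟩ := hu
        refine ⟨⟨u, (hker u).mpr (by rw [hu]; simpa using hm)⟩, ?_⟩
        apply Subtype.ext
        simp [hu]
    have hcop : (Nat.card f.ker).Coprime 4 := by
      rw [hcard]
      have : Nat.Coprime (Nat.card (IsLocalRing.maximalIdeal R)) 2 :=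
        (Nat.coprime_two_right).mpr (Nat.odd_iff.mpr hodd)
      exact Nat.Coprime.pow_right 2 this
    have hk : x * (w ^ 4)⁻¹ ∈ f.ker := by
      rw [MonoidHom.mem_ker, map_mul, map_inv, mul_inv_eq_one, map_pow, Units.ext_iff]
      exact h
    obtain ⟨k, hk'⟩ := (powCoprime hcop).surjective ⟨_, hk⟩
    have hk2 : (k : Rˣ) ^ 4 = x * (w ^ 4)⁻¹ := congrArg Subtype.val hk'
    refine ⟨k * w, ?_⟩
    rw [← Units.val_pow_eq_pow_val, mul_pow, hk2, inv_mul_cancel_right]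

lemma sum_residue [Fintype (IsLocalRing.ResidueField R)] (h : IsLocalRing.ResidueField R → ℤ) :
    ∑ x : R, h (IsLocalRing.residue R x) =
      Nat.card (IsLocalRing.maximalIdeal R) * ∑ a, h a := by
  classical
  rw [← Finset.sum_fiberwise (s := Finset.univ) (g := fun y : R => IsLocalRing.residue R y),
    Finset.mul_sum]
  apply Finset.sum_congr rfl
  intro t _
  have : ∀ y ∈ Finset.univ.filter (fun y : R => IsLocalRing.residue R y = t),
      h (IsLocalRing.residue R y) = h t := by
    intro y hy
    rw [(Finset.mem_filter.mp hy).2]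
  rw [Finset.sum_congr rfl this, Finset.sum_const, nsmul_eq_mul]
  congr 2
  rw [AddMonoidHom.card_fiber_eq_of_mem_range (IsLocalRing.residue R)
    (x := t) (y := 0) (IsLocalRing.residue_surjective t) ⟨0, map_zero _⟩]
  rw [Nat.card_eq_fintype_card]
  symm
  apply Fintype.card_of_subtype
  intro x
  simp [IsLocalRing.residue_eq_zero_iff]

end

open Classical in
lemma field_count {F : Type*} [Field F] [Fintype F] {z : F} (hz : z ^ 4 = -1) :
    ∑ a : F, ∑ b : F, ∑ c : F, (if P (b - a) then 1 else 0 : ℤ) *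
        (if P (c - a) then 1 else 0 : ℤ) * (if P (c - b) then 1 else 0 : ℤ) =
    Fintype.card F * ((∑ x : F, (if P x then 1 else 0 : ℤ)) *
      ∑ x : F, (if P x then 1 else 0 : ℤ) * (if P (1 - x) then 1 else 0 : ℤ)) := by
  have hz0 : z ≠ 0 := by rintro rfl; simp at hz
  have hneg : ∀ x : F, P (-x) → P x := by
    rintro x ⟨u, hu, h⟩
    refine ⟨z * u, mul_ne_zero hz0 hu, ?_⟩
    rw [mul_pow, hz, ← h]; ring
  have hmul : ∀ b x : F, P b → (P (b * x) ↔ P x) := by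
    rintro b x ⟨u, hu, rfl⟩
    constructor
    · rintro ⟨v, hv, h⟩
      refine ⟨v / u, div_ne_zero hv hu, ?_⟩
      rw [div_pow, ← h]
      field_simp
    · rintro ⟨v, hv, rfl⟩
      exact ⟨u * v, mul_ne_zero hu hv, by ring⟩
  have hinner : ∀ a : F, ∑ b : F, ∑ c : F, (if P (b - a) then 1 else 0 : ℤ) *
        (if P (c - a) then 1 else 0 : ℤ) * (if P (c - b) then 1 else 0 : ℤ) =
      (∑ x : F, (if P x then 1 else 0 : ℤ)) *
      ∑ x : F, (if P x then 1 else 0 : ℤ) * (if P (1 - x) then 1 else 0 : ℤ) := by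
    intro a
    rw [← Equiv.sum_comp (Equiv.addRight a), Finset.sum_mul]
    apply Finset.sum_congr rfl
    intro b _
    rw [← Equiv.sum_comp (Equiv.addRight a)]
    simp only [Equiv.coe_addRight, add_sub_cancel_right, add_sub_add_right_eq_sub]
    by_cases hb : P b
    · have hb0 : b ≠ 0 := by
        obtain ⟨u, hu, rfl⟩ := hb
        exact pow_ne_zero _ hu
      rw [← Equiv.sum_comp (Equiv.mulLeft₀ b hb0)]
      simp only [hb, if_true, one_mul, Equiv.mulLeft₀_apply]
      apply Finset.sum_congr rfl
      intro x _
      have h1 : P (b * x - b) ↔ P (1 - x) := by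
        rw [show b * x - b = b * (x - 1) by ring, hmul _ _ hb]
        exact ⟨fun h => hneg _ (by simpa using h), fun h => hneg _ (by simpa using h)⟩
      simp only [hmul _ _ hb, h1]
    · simp [hb]
  simp only [hinner]
  simp

end TriAux


set_option linter.all false

/-- Let `(R,𝔪)` be a finite commutative local ring with `|𝔪| = q^β` and residue field of size
`q = p^r` (`p` prime), where `gcd(4,|R|) = 1` and `q ≡ 1 (mod 8)`. Let `e, f ∈ ℤ` with
`q = e² + 4f²`, `e ≡ 1 (mod 4)`, and `p ∤ e` when `p ≡ 1 (mod 4)`. Then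
`K_3(G_R(4)) = q^(3β+1)(q-1)(q-6e-11)/(2⁷·3)`. -/
theorem triangleCount_unitaryCayley_four (R : Type*) [CommRing R] [IsLocalRing R] [Fintype R]
    (q β p r : ℕ) (e f : ℤ) (hp : p.Prime) (hqpr : q = p ^ r)
    (hm : Nat.card (IsLocalRing.maximalIdeal R) = q ^ β)
    (hq : Nat.card (IsLocalRing.ResidueField R) = q)
    (hk : Nat.gcd 4 (Fintype.card R) = 1)
    (hq8 : q % 8 = 1)
    (hef : (q : ℤ) = e ^ 2 + 4 * f ^ 2) (he4 : e % 4 = 1)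
    (hpe : p % 4 = 1 → ¬ (p : ℤ) ∣ e) :
    (2 ^ 7 * 3 : ℤ) * (unitaryCayleyGraph R 4).cliqueCount 3 =
      (q : ℤ) ^ (3 * β + 1) * ((q : ℤ) - 1) * ((q : ℤ) - 6 * e - 11) := by
  classical
  let F := IsLocalRing.ResidueField R
  haveI : Finite F := Finite.of_surjective _ (IsLocalRing.residue_surjective (R := R))
  letI : Fintype F := Fintype.ofFinite _
  have hcq : Fintype.card F = q := by rw [← Nat.card_eq_fintype_card]; exact hq
  obtain ⟨⟨z, hz⟩, h4, h16⟩ := TriAux.cyclo (F := F) (e := e) (f := f) hp (by rw [hcq, hqpr])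
    (by rw [hcq]; exact hq8) (by rw [hcq]; exact hef) he4 hpe
  have hodd : Nat.card (IsLocalRing.maximalIdeal R) % 2 = 1 := by
    rw [hm, ← Nat.odd_iff]
    exact Odd.pow (Nat.odd_iff.mpr (by omega))
  have hz0 : z ≠ 0 := by rintro rfl; simp at hz
  have hneg : ∀ x : F, TriAux.P (-x) → TriAux.P x := by
    rintro x ⟨u, hu, h⟩
    refine ⟨z * u, mul_ne_zero hz0 hu, ?_⟩
    rw [mul_pow, hz, ← h]; ring
  have hadj : ∀ x y : R, (unitaryCayleyGraph R 4).Adj x y ↔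
      TriAux.P (IsLocalRing.residue R y - IsLocalRing.residue R x) := by
    intro x y
    rw [unitaryCayleyGraph, SimpleGraph.fromRel_adj, TriAux.fourth_iff hodd,
      TriAux.fourth_iff hodd, map_sub, map_sub]
    constructor
    · rintro ⟨-, h | h⟩
      · exact h
      · exact hneg _ (by simpa using h)
    · intro h
      refine ⟨?_, Or.inl h⟩
      rintro rfl
      obtain ⟨u, hu, h⟩ := h
      exact pow_ne_zero 4 hu (by rw [← h, sub_self])
  have h6 := TriAux.six_mul_clique (unitaryCayleyGraph R 4)
  simp only [hadj] at h6
  have hc := TriAux.field_count hz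
  rw [SimpleGraph.cliqueCount]
  set N := Nat.card {s : Finset R // (unitaryCayleyGraph R 4).IsNClique 3 s}
  let ind : F → ℤ := fun x => if TriAux.P x then 1 else 0
  have s1 : ∀ a b : F, ∑ z : R, ind (b - a) * ind (IsLocalRing.residue R z - a) *
      ind (IsLocalRing.residue R z - b) = (q : ℤ) ^ β *
        ∑ c : F, ind (b - a) * ind (c - a) * ind (c - b) := by
    intro a b
    rw [TriAux.sum_residue (fun c => ind (b - a) * ind (c - a) * ind (c - b)), hm]
    push_cast; rfl
  have s2 : ∀ a : F, ∑ y : R, (q : ℤ) ^ β * ∑ c : F, ind (IsLocalRing.residue R y - a) *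
      ind (c - a) * ind (c - IsLocalRing.residue R y) = (q : ℤ) ^ β * ∑ b : F, (q : ℤ) ^ β *
        ∑ c : F, ind (b - a) * ind (c - a) * ind (c - b) := by
    intro a
    rw [TriAux.sum_residue (fun b => (q : ℤ) ^ β *
        ∑ c : F, ind (b - a) * ind (c - a) * ind (c - b)), hm]
    push_cast; rfl
  have s3 : ∑ x : R, (q : ℤ) ^ β * ∑ b : F, (q : ℤ) ^ β *
        ∑ c : F, ind (b - IsLocalRing.residue R x) * ind (c - IsLocalRing.residue R x) *
          ind (c - b) = (q : ℤ) ^ β * ∑ a : F, (q : ℤ) ^ β * ∑ b : F, (q : ℤ) ^ β *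
        ∑ c : F, ind (b - a) * ind (c - a) * ind (c - b) := by
    rw [TriAux.sum_residue (fun a => (q : ℤ) ^ β * ∑ b : F, (q : ℤ) ^ β *
        ∑ c : F, ind (b - a) * ind (c - a) * ind (c - b)), hm]
    push_cast; rfl
  change _ = ∑ x : R, ∑ y : R, ∑ z : R,
    ind (IsLocalRing.residue R y - IsLocalRing.residue R x) *
    ind (IsLocalRing.residue R z - IsLocalRing.residue R x) *
    ind (IsLocalRing.residue R z - IsLocalRing.residue R y) at h6
  simp only [s1, s2] at h6
  rw [s3] at h6
  simp only [← Finset.mul_sum] at h6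
  change ∑ a : F, ∑ b : F, ∑ c : F, ind (b - a) * ind (c - a) * ind (c - b) = _ at hc
  rw [hc] at h6
  rw [hcq] at h6 h4 h16
  set A := ∑ x : F, (if TriAux.P x then 1 else 0 : ℤ)
  set B := ∑ x : F, (if TriAux.P x then 1 else 0 : ℤ) * (if TriAux.P (1 - x) then 1 else 0 : ℤ)
  have : (2 ^ 7 * 3 : ℤ) * N = (q : ℤ) ^ (3 * β + 1) * (4 * A) * (16 * B) := by
    have e3 : (q : ℤ) ^ (3 * β + 1) = ((q : ℤ) ^ β) ^ 3 * q := by ring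
    rw [e3]
    linear_combination 64 * h6
  rw [this, h4, h16]
end

section
/- Let p be a prime with p ≡ 1 (mod 3), and suppose x₀, y₀ ∈ ℤ satisfy p = x₀² + 27y₀² with x₀ ≡ 1 (mod 3) and p not dividing x₀. For ℓ ≥ 1 let c_ℓ = −(x₀ + 3√3·y₀·i)^ℓ − (x₀ − 3√3·y₀·i)^ℓ (a real number that is an integer). Then for every ℓ ≥ 1, the number of triangles in the generalized Paley graph Γ(3, p^ℓ) is K_3(Γ(3, p^ℓ)) = p^ℓ (p^ℓ − 1)(p^ℓ + c_ℓ − 8) / 162. -/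
open Complex

set_option linter.unusedSectionVars false

namespace PaleyAux
open Polynomial

section poly
variable {K : Type*} [Field K] [Fintype K]

lemma monic_finite (K : Type*) [Field K] [Fintype K] (n : ℕ) :
    {f : K[X] | f.Monic ∧ f.natDegree = n}.Finite := by
  have : Finite {f : K[X] // f.Monic ∧ f.natDegree = n} :=
    Finite.of_equiv (Fin n → K)
      ((monicEquivDegreeLT n).trans (degreeLTEquiv K n).toEquiv).symm
  exact Set.finite_coe_iff.mp this

/-- monic polynomials of degree `n`. -/
noncomputable def M (K : Type*) [Field K] [Fintype K] (n : ℕ) : Finset K[X] :=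
  (monic_finite K n).toFinset

lemma mem_M {n : ℕ} {f : K[X]} : f ∈ M K n ↔ f.Monic ∧ f.natDegree = n := by
  simp [M]

/-- the completely multiplicative weight. -/
noncomputable def lam (χ : MulChar K ℂ) (f : K[X]) : ℂ := χ (f.eval 0) * χ (f.eval 1)

lemma lam_mul (χ : MulChar K ℂ) (f g : K[X]) : lam χ (f * g) = lam χ f * lam χ g := by
  simp only [lam, eval_mul, map_mul]; ring

lemma lam_pow (χ : MulChar K ℂ) (f : K[X]) (j : ℕ) : lam χ (f ^ j) = lam χ f ^ j := by
  simp only [lam, eval_pow, map_pow]; ring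

/-- the sum of the weights. -/
noncomputable def S (χ : MulChar K ℂ) (n : ℕ) : ℂ := ∑ f ∈ M K n, lam χ f

lemma S_zero (χ : MulChar K ℂ) : S χ 0 = 1 := by
  have : M K 0 = {1} := by
    ext f
    rw [mem_M, Finset.mem_singleton]
    constructor
    · rintro ⟨h1, h2⟩
      exact h1.natDegree_eq_zero.mp h2
    · rintro rfl
      exact ⟨monic_one, natDegree_one⟩
  simp [S, this, lam]

lemma S_one (χ : MulChar K ℂ) (hχ : χ (-1) = 1) : S χ 1 = jacobiSum χ χ := by
  rw [S, jacobiSum]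
  symm
  refine Finset.sum_bij (fun a _ => X - C a) ?_ ?_ ?_ ?_
  · intro a _
    exact mem_M.mpr ⟨monic_X_sub_C a, natDegree_X_sub_C a⟩
  · intro a _ b _ h
    simpa using h
  · intro f hf
    obtain ⟨h1, h2⟩ := mem_M.mp hf
    refine ⟨-f.coeff 0, Finset.mem_univ _, ?_⟩
    conv_rhs => rw [h1.eq_X_add_C h2]
    simp
  · intro a _
    have : χ (-a) = χ a := by
      rw [← neg_one_mul, map_mul, hχ, one_mul]
    simp [lam, this]

lemma S_two (χ : MulChar K ℂ) (hχ : χ ≠ 1) {n : ℕ} (hn : 2 ≤ n) : S χ n = 0 := by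
  obtain ⟨u, hu⟩ := MulChar.ne_one_iff.mp hχ
  set b : K := (u : K)
  have hb : b ≠ 0 := u.ne_zero
  have key : ∀ (c : K) (f : K[X]), f ∈ M K n →
      f + C ((c - 1) * f.eval 0) * (1 - X) ∈ M K n := by
    intro c f hf
    obtain ⟨h1, h2⟩ := mem_M.mp hf
    have hd : (C ((c - 1) * f.eval 0) * (1 - X)).degree < f.degree := by
      have hle : (C ((c - 1) * f.eval 0) * (1 - X)).degree ≤ 1 := by
        have : C ((c - 1) * f.eval 0) * (1 - X)
          = C (-((c - 1) * f.eval 0)) * X + C ((c - 1) * f.eval 0) := by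
          simp only [C_neg]; ring
        rw [this]
        exact degree_linear_le
      refine lt_of_le_of_lt hle ?_
      rw [degree_eq_natDegree h1.ne_zero, h2]
      exact_mod_cast hn
    refine mem_M.mpr ⟨h1.add_of_left hd, ?_⟩
    rw [natDegree_add_eq_left_of_degree_lt hd, h2]
  have h : ∑ f ∈ M K n, lam χ f = ∑ f ∈ M K n, χ b * lam χ f := by
    symm
    refine Finset.sum_bij' (fun f _ => f + C ((b - 1) * f.eval 0) * (1 - X))
      (fun f _ => f + C ((b⁻¹ - 1) * f.eval 0) * (1 - X))
      (fun f hf => key _ f hf) (fun f hf => key _ f hf) ?_ ?_ ?_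
    · intro f _
      rw [add_assoc, ← add_mul, ← C_add]
      have : (b - 1) * eval 0 f + (b⁻¹ - 1) * eval 0 (f + C ((b - 1) * eval 0 f) * (1 - X)) = 0 := by
        simp; field_simp; ring
      rw [this]; simp
    · intro f _
      rw [add_assoc, ← add_mul, ← C_add]
      have : (b⁻¹ - 1) * eval 0 f + (b - 1) * eval 0 (f + C ((b⁻¹ - 1) * eval 0 f) * (1 - X)) = 0 := by
        simp; field_simp; ring
      rw [this]; simp
    · intro f _
      have e0 : eval 0 (f + C ((b - 1) * eval 0 f) * (1 - X)) = b * eval 0 f := by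
        simp; ring
      have e1 : eval 1 (f + C ((b - 1) * eval 0 f) * (1 - X)) = eval 1 f := by
        simp
      rw [lam, lam, e0, e1, map_mul, mul_assoc]
  rw [← Finset.mul_sum] at h
  have : (χ b - 1) * S χ n = 0 := by
    rw [S]; linear_combination -h
  rcases mul_eq_zero.mp this with h' | h'
  · exact absurd (sub_eq_zero.mp h') hu
  · exact h'

open Classical in
/-- monic irreducibles of degree at most `n`. -/
noncomputable def Irr (K : Type*) [Field K] [Fintype K] (n : ℕ) : Finset K[X] :=
  ((Finset.Icc 1 n).biUnion (M K)).filter Irreducible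

lemma mem_Irr {n : ℕ} {P : K[X]} : P ∈ Irr K n ↔ P.Monic ∧ Irreducible P ∧ P.natDegree ≤ n := by
  simp only [Irr, Finset.mem_filter, Finset.mem_biUnion, Finset.mem_Icc, mem_M]
  constructor
  · rintro ⟨⟨d, ⟨_, h⟩, h1, h2⟩, h3⟩
    exact ⟨h1, h3, h2 ▸ h⟩
  · rintro ⟨h1, h2, h3⟩
    exact ⟨⟨P.natDegree, ⟨h2.natDegree_pos, h3⟩, h1, rfl⟩, h2⟩

open Classical in
lemma degree_eq_sum {n : ℕ} {f : K[X]} (hf : f ∈ M K n) :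
    n = ∑ P ∈ Irr K n, ∑ j ∈ Finset.Icc 1 n, if P ^ j ∣ f then P.natDegree else 0 := by
  obtain ⟨h1, h2⟩ := mem_M.mp hf
  set s := UniqueFactorizationMonoid.normalizedFactors f with hs
  have hprod : s.prod = f := by
    rw [hs, UniqueFactorizationMonoid.prod_normalizedFactors_eq h1.ne_zero]
    exact h1.normalize_eq_self
  have hmem : ∀ P ∈ s, P ∈ Irr K n := by
    intro P hP
    have hi := UniqueFactorizationMonoid.irreducible_of_normalized_factor P hP
    have hn := UniqueFactorizationMonoid.normalize_normalized_factor P hP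
    have hm : P.Monic := by
      rw [← hn]; exact monic_normalize hi.ne_zero
    refine mem_Irr.mpr ⟨hm, hi, ?_⟩
    rw [← h2]
    exact natDegree_le_of_dvd (UniqueFactorizationMonoid.dvd_of_mem_normalizedFactors hP)
      h1.ne_zero
  have hdeg : n = ∑ P ∈ s.toFinset, s.count P • P.natDegree := by
    rw [← Finset.sum_multiset_map_count, ← natDegree_multiset_prod_of_monic, hprod, h2]
    intro P hP
    exact (mem_Irr.mp (hmem P hP)).1
  have hsub : s.toFinset ⊆ Irr K n := fun P hP => hmem P (Multiset.mem_toFinset.mp hP)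
  rw [Finset.sum_subset hsub (by
    intro P _ hP
    rw [Multiset.mem_toFinset] at hP
    rw [Multiset.count_eq_zero_of_notMem hP, zero_smul])] at hdeg
  conv_lhs => rw [hdeg]
  refine Finset.sum_congr rfl fun P hP => ?_
  obtain ⟨hm, hi, _⟩ := mem_Irr.mp hP
  have hiff : ∀ j, P ^ j ∣ f ↔ j ≤ s.count P := by
    intro j
    rw [pow_dvd_iff_le_emultiplicity,
      UniqueFactorizationMonoid.le_emultiplicity_iff_replicate_le_normalizedFactors hi h1.ne_zero,
      hm.normalize_eq_self, Multiset.le_count_iff_replicate_le]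
  have hcn : s.count P ≤ n := by
    have := natDegree_le_of_dvd ((hiff _).mpr le_rfl) h1.ne_zero
    rw [natDegree_pow, h2] at this
    exact le_trans (Nat.le_mul_of_pos_right _ hi.natDegree_pos) this
  simp only [hiff]
  rw [← Finset.sum_filter, Finset.sum_const]
  congr 1
  have : (Finset.Icc 1 n).filter (fun j => j ≤ s.count P) = Finset.Icc 1 (s.count P) := by
    ext j; simp only [Finset.mem_filter, Finset.mem_Icc]; omega
  rw [this]; simp

open Classical in
lemma sum_dvd (χ : MulChar K ℂ) (n : ℕ) {Q : K[X]} (hQ : Q.Monic) :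
    ∑ f ∈ M K n, (if Q ∣ f then lam χ f else 0) =
      if Q.natDegree ≤ n then lam χ Q * S χ (n - Q.natDegree) else 0 := by
  split_ifs with h
  · rw [S, Finset.mul_sum, ← Finset.sum_filter]
    symm
    refine Finset.sum_bij (fun h _ => Q * h) ?_ ?_ ?_ ?_
    · intro g hg
      obtain ⟨h1, h2⟩ := mem_M.mp hg
      refine Finset.mem_filter.mpr ⟨mem_M.mpr ⟨hQ.mul h1, ?_⟩, dvd_mul_right _ _⟩
      rw [hQ.natDegree_mul h1, h2]; omega
    · intro a _ b _ hab
      exact mul_left_cancel₀ hQ.ne_zero hab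
    · intro f hf
      obtain ⟨hf, g, rfl⟩ := Finset.mem_filter.mp hf
      obtain ⟨h1, h2⟩ := mem_M.mp hf
      have hg := hQ.of_mul_monic_left h1
      refine ⟨g, mem_M.mpr ⟨hg, ?_⟩, rfl⟩
      rw [hQ.natDegree_mul hg] at h2; omega
    · intro g _
      rw [lam_mul]
  · refine Finset.sum_eq_zero fun f hf => if_neg fun hd => h ?_
    obtain ⟨h1, h2⟩ := mem_M.mp hf
    rw [← h2]
    exact natDegree_le_of_dvd hd h1.ne_zero

/-- prime power sums. -/
noncomputable def G (χ : MulChar K ℂ) (m : ℕ) : ℂ :=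
  ∑ P ∈ Irr K m, if P.natDegree ∣ m then P.natDegree * lam χ P ^ (m / P.natDegree) else 0

lemma G_eq (χ : MulChar K ℂ) {m N : ℕ} (hm : 1 ≤ m) (hN : m ≤ N) :
    G χ m = ∑ P ∈ Irr K N, ∑ j ∈ Finset.Icc 1 N,
      if j * P.natDegree = m then P.natDegree * lam χ P ^ j else 0 := by
  have hsub : Irr K m ⊆ Irr K N := by
    intro P hP
    rw [mem_Irr] at hP ⊢
    exact ⟨hP.1, hP.2.1, hP.2.2.trans hN⟩
  rw [G, Finset.sum_subset hsub]
  · refine Finset.sum_congr rfl fun P hP => ?_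
    obtain ⟨_, hi, _⟩ := mem_Irr.mp hP
    have hpos := hi.natDegree_pos
    split_ifs with h
    · obtain ⟨c, rfl⟩ := h
      rw [Nat.mul_div_cancel_left _ hpos]
      have hc : c ∈ Finset.Icc 1 N := by
        rw [Finset.mem_Icc]
        constructor
        · exact Nat.pos_of_ne_zero (by rintro rfl; omega)
        · exact le_trans (Nat.le_mul_of_pos_left _ hpos) hN
      rw [Finset.sum_eq_single_of_mem c hc]
      · rw [if_pos (mul_comm _ _)]
      · intro j _ hj
        refine if_neg fun h => hj ?_
        rw [mul_comm] at h
        exact Nat.eq_of_mul_eq_mul_left hpos h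
    · symm
      refine Finset.sum_eq_zero fun j _ => if_neg fun h' => h ?_
      exact ⟨j, by rw [← h', mul_comm]⟩
  · intro P hP hP'
    refine if_neg fun h => hP' ?_
    rw [mem_Irr] at hP ⊢
    exact ⟨hP.1, hP.2.1, Nat.le_of_dvd hm h⟩

lemma main_rec (χ : MulChar K ℂ) (n : ℕ) :
    n * S χ n = ∑ P ∈ Irr K n, ∑ j ∈ Finset.Icc 1 n,
      if j * P.natDegree ≤ n then P.natDegree * lam χ P ^ j * S χ (n - j * P.natDegree) else 0 := by
  classical
  have h1 : n * S χ n = ∑ f ∈ M K n, ∑ P ∈ Irr K n, ∑ j ∈ Finset.Icc 1 n,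
      (P.natDegree : ℂ) * (if P ^ j ∣ f then lam χ f else 0) := by
    rw [S, Finset.mul_sum]
    refine Finset.sum_congr rfl fun f hf => ?_
    conv_lhs => rw [degree_eq_sum hf]
    push_cast
    rw [Finset.sum_mul]
    refine Finset.sum_congr rfl fun P _ => ?_
    rw [Finset.sum_mul]
    refine Finset.sum_congr rfl fun j _ => ?_
    split_ifs <;> simp
  rw [h1, Finset.sum_comm]
  refine Finset.sum_congr rfl fun P hP => ?_
  rw [Finset.sum_comm]
  refine Finset.sum_congr rfl fun j _ => ?_
  rw [← Finset.mul_sum, sum_dvd χ n ((mem_Irr.mp hP).1.pow j), natDegree_pow, lam_pow]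
  split_ifs <;> ring

lemma G_one (χ : MulChar K ℂ) : G χ 1 = S χ 1 := by
  have h := main_rec χ 1
  rw [Nat.cast_one, one_mul] at h
  rw [h, G_eq χ le_rfl le_rfl]
  refine Finset.sum_congr rfl fun P hP => Finset.sum_congr rfl fun j hj => ?_
  have hpos := (mem_Irr.mp hP).2.1.natDegree_pos
  have hj1 := (Finset.mem_Icc.mp hj).1
  have : 0 < j * P.natDegree := Nat.mul_pos hj1 hpos
  by_cases h : j * P.natDegree = 1
  · rw [if_pos h, if_pos h.le, h, Nat.sub_self, S_zero, mul_one]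
  · rw [if_neg h, if_neg (by omega)]

lemma G_succ (χ : MulChar K ℂ) (hχ : χ ≠ 1) {n : ℕ} (hn : 1 ≤ n) :
    G χ (n + 1) = - S χ 1 * G χ n := by
  have h := main_rec χ (n + 1)
  rw [S_two χ hχ (by omega), mul_zero] at h
  have h2 : G χ (n + 1) + S χ 1 * G χ n = 0 := by
    rw [h, G_eq χ (by omega) le_rfl, G_eq χ hn (Nat.le_succ n), Finset.mul_sum,
      ← Finset.sum_add_distrib]
    refine Finset.sum_congr rfl fun P hP => ?_
    rw [Finset.mul_sum, ← Finset.sum_add_distrib]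
    refine Finset.sum_congr rfl fun j hj => ?_
    rcases lt_trichotomy (j * P.natDegree) n with hlt | heq | hgt
    · rw [if_neg (by omega), if_neg (by omega), if_pos (by omega),
        S_two χ hχ (n := n + 1 - j * P.natDegree) (by omega)]
      ring
    · rw [if_neg (by omega), if_pos heq, if_pos (by omega), heq, Nat.add_sub_cancel_left]
      ring
    · by_cases h' : j * P.natDegree = n + 1
      · rw [if_pos h', if_neg (by omega), if_pos h'.le, h', Nat.sub_self, S_zero]
        ring
      · rw [if_neg h', if_neg (by omega), if_neg (by omega)]
        ring
  linear_combination h2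

lemma G_formula (χ : MulChar K ℂ) (hχ : χ ≠ 1) (h1 : χ (-1) = 1) {n : ℕ} (hn : 1 ≤ n) :
    G χ n = - (- jacobiSum χ χ) ^ n := by
  induction n, hn using Nat.le_induction with
  | base => rw [G_one, S_one χ h1]; ring
  | succ n hn ih => rw [G_succ χ hχ hn, ih, S_one χ h1]; ring

end poly

section norm
variable {K L : Type*} [Field K] [Fintype K] [Field L] [Fintype L] [Algebra K L]

lemma chi_norm (χ : MulChar K ℂ) (h1 : χ (-1) = 1) (α : L) :
    χ (Algebra.norm K α) =
      χ ((minpoly K α).eval 0) ^ (Module.finrank K L / (minpoly K α).natDegree) := by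
  have hintegral : IsIntegral K α := Algebra.IsIntegral.isIntegral α
  have h := Algebra.PowerBasis.norm_gen_eq_coeff_zero_minpoly
    (IntermediateField.adjoin.powerBasis hintegral)
  rw [IntermediateField.adjoin.powerBasis_gen, IntermediateField.minpoly_gen] at h
  have hf : Module.finrank K L / (minpoly K α).natDegree
      = Module.finrank (IntermediateField.adjoin K {α}) L := by
    rw [← IntermediateField.adjoin.finrank hintegral,
      ← Module.finrank_mul_finrank K (IntermediateField.adjoin K {α}) L]
    exact Nat.mul_div_cancel_left _ Module.finrank_pos
  rw [Algebra.norm_eq_norm_adjoin, h, hf, map_pow, map_mul, map_pow, h1, one_pow, one_mul,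
    coeff_zero_eq_eval_zero]

lemma chi_norm_one_sub (χ : MulChar K ℂ) (h1 : χ (-1) = 1) (α : L) :
    χ (Algebra.norm K (1 - α)) =
      χ ((minpoly K α).eval 1) ^ (Module.finrank K L / (minpoly K α).natDegree) := by
  have e : Algebra.norm K (1 - α) = (-1) ^ Module.finrank K L *
      Algebra.norm K (α - algebraMap K L 1) := by
    rw [← Algebra.norm_algebraMap, ← map_mul]
    congr 1
    simp
  rw [e, map_mul, map_pow, h1, one_pow, one_mul, chi_norm χ h1, minpoly.sub_algebraMap,
    natDegree_comp, natDegree_X_add_C, mul_one, eval_comp]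
  simp

lemma sum_eq_G (χ : MulChar K ℂ) (h1 : χ (-1) = 1) :
    ∑ α : L, χ (Algebra.norm K α) * χ (Algebra.norm K (1 - α)) = G χ (Module.finrank K L) := by
  classical
  set m := Module.finrank K L with hm
  have hm0 : 0 < m := Module.finrank_pos
  have hintegral : ∀ α : L, IsIntegral K α := fun α => Algebra.IsIntegral.isIntegral α
  have hmaps : ∀ α ∈ (Finset.univ : Finset L), minpoly K α ∈ Irr K m := by
    intro α _
    exact mem_Irr.mpr ⟨minpoly.monic (hintegral α), minpoly.irreducible (hintegral α),
      minpoly.natDegree_le α⟩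
  rw [← Finset.sum_fiberwise_of_maps_to hmaps, G]
  refine Finset.sum_congr rfl fun P hP => ?_
  obtain ⟨hPm, hPi, _⟩ := mem_Irr.mp hP
  have hval : ∀ α ∈ Finset.univ.filter (fun α : L => minpoly K α = P),
      χ (Algebra.norm K α) * χ (Algebra.norm K (1 - α)) = lam χ P ^ (m / P.natDegree) := by
    intro α hα
    rw [chi_norm χ h1, chi_norm_one_sub χ h1, (Finset.mem_filter.mp hα).2, lam, mul_pow]
  rw [Finset.sum_congr rfl hval, Finset.sum_const, nsmul_eq_mul]
  have hroot : ∀ α : L, minpoly K α = P ↔ aeval α P = 0 := by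
    intro α
    constructor
    · rintro rfl; exact minpoly.aeval K α
    · intro h; exact (minpoly.eq_of_irreducible_of_monic hPi h hPm).symm
  split_ifs with hd
  · congr 2
    have hsplit : (P.map (algebraMap K L)).Splits := by
      have hdvd := hPi.natDegree_dvd_iff_dvd_X_pow_card_pow_sub_X.mp hd
      have hcard : Nat.card K ^ m = Fintype.card L := by
        rw [← Nat.card_eq_fintype_card, Module.natCard_eq_pow_finrank (K := K) (V := L)]
      rw [hcard] at hdvd
      have hsp : ((X ^ Fintype.card L - X : K[X]).map (algebraMap K L)).Splits :=
        IsSplittingField.splits L _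
      refine hsp.of_dvd ?_ (map_dvd (algebraMap K L) hdvd)
      exact (Polynomial.map_ne_zero_iff (algebraMap K L).injective).mpr
        (FiniteField.X_pow_card_sub_X_ne_zero K Fintype.one_lt_card)
    rw [← card_rootSet_eq_natDegree (PerfectField.separable_of_irreducible hPi) hsplit,
      ← Set.toFinset_card]
    congr 1
    ext α
    rw [Finset.mem_filter, Set.mem_toFinset, mem_rootSet_of_ne hPi.ne_zero, hroot]
    simp
  · rw [Finset.card_eq_zero.mpr, Nat.cast_zero, zero_mul]
    refine Finset.filter_eq_empty_iff.mpr fun α _ h => hd ?_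
    rw [← h]
    exact minpoly.degree_dvd (hintegral α)

/-- `χ` composed with the norm. -/
noncomputable def liftChar (χ : MulChar K ℂ) (L : Type*) [Field L] [Fintype L] [Algebra K L] :
    MulChar L ℂ where
  toFun α := χ (Algebra.norm K α)
  map_one' := by simp
  map_mul' := by simp
  map_nonunit' := by
    intro a ha
    have : a = 0 := by simpa using ha
    subst this
    rw [Algebra.norm_zero]
    exact χ.map_zero

lemma liftChar_apply (χ : MulChar K ℂ) (α : L) : liftChar χ L α = χ (Algebra.norm K α) := rfl

lemma jacobi_lift (χ : MulChar K ℂ) (hχ : χ ≠ 1) (h1 : χ (-1) = 1) :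
    jacobiSum (liftChar χ L) (liftChar χ L) = - (- jacobiSum χ χ) ^ Module.finrank K L := by
  rw [← G_formula χ hχ h1 Module.finrank_pos, ← sum_eq_G (L := L) χ h1]
  rfl

lemma liftChar_ne_one (χ : MulChar K ℂ) (hχ : χ ≠ 1) : liftChar χ L ≠ 1 := by
  obtain ⟨u, hu⟩ := MulChar.ne_one_iff.mp hχ
  obtain ⟨a, ha⟩ := FiniteField.norm_surjective K L (u : K)
  intro h
  apply hu
  rw [← ha, ← liftChar_apply, h]
  apply MulChar.one_apply
  rw [isUnit_iff_ne_zero]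
  rintro rfl
  rw [Algebra.norm_zero] at ha
  exact u.ne_zero ha.symm

lemma liftChar_pow (χ : MulChar K ℂ) (h3 : χ ^ 3 = 1) : liftChar χ L ^ 3 = 1 := by
  ext u
  have hu : Algebra.norm K (u : L) ≠ 0 := Algebra.norm_ne_zero_iff.mpr u.ne_zero
  rw [MulChar.pow_apply_coe, liftChar_apply, ← map_pow]
  have := congrArg (fun c : MulChar K ℂ => c (Algebra.norm K (u : L))) h3
  beta_reduce at this
  rw [MulChar.pow_apply' _ (by norm_num), MulChar.one_apply (isUnit_iff_ne_zero.mpr hu)] at this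
  rw [map_pow, this]
  simp

end norm

section cubic

lemma chi_neg_one {F : Type*} [Field F] (χ : MulChar F ℂ) (h3 : χ ^ 3 = 1) : χ (-1) = 1 := by
  have h : (χ ^ 3) (-1) = 1 := by
    rw [h3]; exact MulChar.one_apply (isUnit_iff_ne_zero.mpr (by simp))
  rw [MulChar.pow_apply' _ (by norm_num), ← map_pow] at h
  have e : (-1 : F) ^ 3 = -1 := by ring
  rwa [e] at h

lemma uniq_rep {p : ℕ} (hp : p.Prime) {A m x y : ℤ} (h1 : 4 * (p : ℤ) = A ^ 2 + 27 * m ^ 2)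
    (h2 : (p : ℤ) = x ^ 2 + 27 * y ^ 2) (hA : A % 3 = 1) (hx : x % 3 = 1) :
    A = -2 * x ∧ (m = 2 * y ∨ m = -2 * y) := by
  have hpp : Prime (p : ℤ) := Nat.prime_iff_prime_int.mp hp
  have hp0 : (0 : ℤ) < p := by exact_mod_cast hp.pos
  have hd : (p : ℤ) ∣ (A * y + x * m) * (A * y - x * m) := by
    refine ⟨4 * y ^ 2 - m ^ 2, ?_⟩
    linear_combination (-y ^ 2) * h1 + m ^ 2 * h2
  have hz : (A * y + x * m) * (A * y - x * m) = 0 := by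
    have aux : ∀ u v : ℤ, u ^ 2 + 27 * v ^ 2 = 4 * p ^ 2 → (p : ℤ) ∣ v → v = 0 := by
      rintro u v huv ⟨k, rfl⟩
      have hk : k = 0 := by
        by_contra hk
        have : 1 ≤ k ^ 2 := by
          have := pow_pos (abs_pos.mpr hk) 2
          rw [sq_abs] at this; omega
        nlinarith [sq_nonneg u, mul_pos hp0 hp0, mul_le_mul_of_nonneg_left this (sq_nonneg (p : ℤ))]
      rw [hk, mul_zero]
    rcases hpp.dvd_or_dvd hd with h | h
    · rw [aux (A * x - 27 * m * y) _ (by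
        linear_combination (-(x ^ 2 + 27 * y ^ 2)) * h1 + (-4 * (p : ℤ)) * h2) h, zero_mul]
    · rw [aux (A * x + 27 * m * y) _ (by
        linear_combination (-(x ^ 2 + 27 * y ^ 2)) * h1 + (-4 * (p : ℤ)) * h2) h, mul_zero]
  have hm : (m - 2 * y) * (m + 2 * y) = 0 := by
    have : (p : ℤ) * ((m - 2 * y) * (m + 2 * y)) = 0 := by
      linear_combination (-y ^ 2) * h1 + m ^ 2 * h2 - hz
    rcases mul_eq_zero.mp this with h | h
    · omega
    · exact h
  have hAx : (A - 2 * x) * (A + 2 * x) = 0 := by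
    linear_combination -h1 + 4 * h2 - 27 * hm
  constructor
  · rcases mul_eq_zero.mp hAx with h | h
    · omega
    · omega
  · rcases mul_eq_zero.mp hm with h | h
    · left; omega
    · right; omega

lemma mem_adjoin {μ : ℂ} (hμ : μ ^ 2 + μ + 1 = 0) {z : ℂ}
    (hz : z ∈ Algebra.adjoin ℤ {μ}) : ∃ u v : ℤ, z = u + v * μ := by
  induction hz using Algebra.adjoin_induction with
  | mem x hx => exact ⟨0, 1, by rw [Set.mem_singleton_iff.mp hx]; simp⟩
  | algebraMap r => exact ⟨r, 0, by simp⟩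
  | add x y _ _ hx hy =>
    obtain ⟨u, v, rfl⟩ := hx
    obtain ⟨u', v', rfl⟩ := hy
    exact ⟨u + u', v + v', by push_cast; ring⟩
  | mul x y _ _ hx hy =>
    obtain ⟨u, v, rfl⟩ := hx
    obtain ⟨u', v', rfl⟩ := hy
    exact ⟨u * u' - v * v', u * v' + v * u' - v * v', by
      push_cast; linear_combination (v * v' : ℂ) * hμ⟩

lemma jacobi_base (p : ℕ) [Fact p.Prime] (x₀ y₀ : ℤ) (hp3 : p % 3 = 1)
    (hxy : (p : ℤ) = x₀ ^ 2 + 27 * y₀ ^ 2) (hx3 : x₀ % 3 = 1) :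
    ∃ χ : MulChar (ZMod p) ℂ, χ ≠ 1 ∧ χ ^ 3 = 1 ∧
      ((-jacobiSum χ χ = (x₀ : ℂ) + 3 * Real.sqrt 3 * (y₀ : ℂ) * I ∧
        -jacobiSum χ⁻¹ χ⁻¹ = (x₀ : ℂ) - 3 * Real.sqrt 3 * (y₀ : ℂ) * I) ∨
       (-jacobiSum χ χ = (x₀ : ℂ) - 3 * Real.sqrt 3 * (y₀ : ℂ) * I ∧
        -jacobiSum χ⁻¹ χ⁻¹ = (x₀ : ℂ) + 3 * Real.sqrt 3 * (y₀ : ℂ) * I)) := by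
  have hp : p.Prime := Fact.out
  have hμ := Complex.isPrimitiveRoot_exp 3 (by norm_num)
  set μ : ℂ := Complex.exp (2 * Real.pi * I / (3 : ℕ)) with hμdef
  have hdvd : 3 ∣ Fintype.card (ZMod p) - 1 := by rw [ZMod.card]; omega
  obtain ⟨χ, hχ⟩ := MulChar.exists_mulChar_orderOf (ZMod p) hdvd hμ
  have h3 : χ ^ 3 = 1 := by rw [← hχ]; exact pow_orderOf_eq_one χ
  have hne : χ ≠ 1 := by rintro rfl; simp at hχ
  have hne2 : χ * χ ≠ 1 := by
    intro h
    apply hne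
    calc χ = χ ^ 3 * (χ * χ)⁻¹ := by rw [pow_succ, pow_two]; group
      _ = 1 := by rw [h3, h]; simp
  refine ⟨χ, hne, h3, ?_⟩
  have hμ1 : μ ≠ 1 := hμ.ne_one (by norm_num)
  have hμ3 : μ ^ 3 = 1 := hμ.pow_eq_one
  have hμ2 : μ ^ 2 + μ + 1 = 0 := by
    have : (μ - 1) * (μ ^ 2 + μ + 1) = 0 := by linear_combination hμ3
    rcases mul_eq_zero.mp this with h | h
    · exact absurd (sub_eq_zero.mp h) hμ1
    · exact h
  obtain ⟨z, hz, hJ⟩ := exists_jacobiSum_eq_neg_one_add (by norm_num) h3 h3 hdvd hμ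
  obtain ⟨u, v, rfl⟩ := mem_adjoin hμ2 hz
  have hJ1 : jacobiSum χ χ = ((3 * v - 1 : ℤ) : ℂ) + ((3 * (v - u) : ℤ) : ℂ) * μ := by
    rw [hJ]; push_cast; linear_combination ((u : ℂ) - 3 * v + v * μ) * hμ2
  have hconjμ : (starRingEnd ℂ) μ = -1 - μ := by
    have hn : ‖μ‖ = 1 := hμ.norm'_eq_one (by norm_num)
    have hmul : μ * (starRingEnd ℂ) μ = 1 := by
      rw [Complex.mul_conj, Complex.normSq_eq_norm_sq, hn]; simp
    have hμ0 : μ ≠ 0 := hμ.ne_zero (by norm_num)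
    apply mul_left_cancel₀ hμ0
    rw [hmul]; linear_combination hμ2
  have hJ2 : jacobiSum χ⁻¹ χ⁻¹ = ((3 * v - 1 : ℤ) : ℂ) + ((3 * (v - u) : ℤ) : ℂ) * (-1 - μ) := by
    have : χ⁻¹ = χ.ringHomComp (starRingEnd ℂ) := by
      rw [← MulChar.star_eq_inv]
      ext a
      simp [MulChar.star_apply, MulChar.ringHomComp_apply]
    rw [this, jacobiSum_ringHomComp, hJ1, map_add, map_mul, hconjμ, map_intCast, map_intCast]
  have hchar : ringChar ℂ ≠ ringChar (ZMod p) := by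
    rw [ringChar.eq ℂ 0, ZMod.ringChar_zmod_n]
    exact hp.ne_zero.symm
  have hprod := jacobiSum_mul_jacobiSum_inv hchar hne hne hne2
  rw [hJ1, hJ2, ZMod.card] at hprod
  set a : ℤ := 3 * v - 1 with ha
  set m : ℤ := v - u with hm
  have hpZ : (p : ℤ) = a ^ 2 - a * (3 * m) + (3 * m) ^ 2 := by
    have : ((p : ℤ) : ℂ) = ((a ^ 2 - a * (3 * m) + (3 * m) ^ 2 : ℤ) : ℂ) := by
      push_cast at hprod ⊢
      rw [← hprod]
      linear_combination (-(3 * m : ℂ) ^ 2) * hμ2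
    exact_mod_cast this
  obtain ⟨hA, hmm⟩ := uniq_rep hp (A := 2 * a - 3 * m) (m := m) (by rw [hpZ]; ring) hxy
    (by omega) hx3
  have hs : (Real.sqrt 3 : ℂ) ^ 2 = 3 := by
    have : (Real.sqrt 3) ^ 2 = 3 := Real.sq_sqrt (by norm_num)
    exact_mod_cast this
  have hμs : (2 * μ + 1 - Real.sqrt 3 * I) * (2 * μ + 1 + Real.sqrt 3 * I) = 0 := by
    linear_combination 4 * hμ2 - (Real.sqrt 3 : ℂ) ^ 2 * I_sq + hs
  have hAc : (2 * a - 3 * m : ℂ) = -2 * x₀ := by exact_mod_cast hA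
  rw [hJ1, hJ2]
  push_cast
  rcases mul_eq_zero.mp hμs with h | h <;> rcases hmm with hmm | hmm <;>
    have hmc := congrArg (Int.cast : ℤ → ℂ) hmm
  · right; push_cast at hmc
    constructor
    · linear_combination -hAc / 2 - 3 * m / 2 * h - 3 / 2 * Real.sqrt 3 * I * hmc
    · linear_combination -hAc / 2 + 3 * m / 2 * h + 3 / 2 * Real.sqrt 3 * I * hmc
  · left; push_cast at hmc
    constructor
    · linear_combination -hAc / 2 - 3 * m / 2 * h - 3 / 2 * Real.sqrt 3 * I * hmc
    · linear_combination -hAc / 2 + 3 * m / 2 * h + 3 / 2 * Real.sqrt 3 * I * hmc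
  · left; push_cast at hmc
    constructor
    · linear_combination -hAc / 2 - 3 * m / 2 * h + 3 / 2 * Real.sqrt 3 * I * hmc
    · linear_combination -hAc / 2 + 3 * m / 2 * h - 3 / 2 * Real.sqrt 3 * I * hmc
  · right; push_cast at hmc
    constructor
    · linear_combination -hAc / 2 - 3 * m / 2 * h + 3 / 2 * Real.sqrt 3 * I * hmc
    · linear_combination -hAc / 2 + 3 * m / 2 * h - 3 / 2 * Real.sqrt 3 * I * hmc

end cubic

section count
variable {F : Type*} [Field F] [Fintype F]

/-- nonzero cubes. -/
def cub (a : F) : Prop := ∃ z : F, z ≠ 0 ∧ a = z ^ 3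

lemma cub_neg {a : F} : cub (-a) ↔ cub a := by
  have : ∀ a : F, cub a → cub (-a) := by
    rintro a ⟨z, hz, rfl⟩
    exact ⟨-z, neg_ne_zero.mpr hz, by ring⟩
  exact ⟨fun h => by simpa using this _ h, this a⟩

lemma cub_mul {a t : F} (ha : cub a) : cub (a * t) ↔ cub t := by
  obtain ⟨z, hz, rfl⟩ := ha
  constructor
  · rintro ⟨w, hw, h⟩
    refine ⟨w / z, div_ne_zero hw hz, ?_⟩
    field_simp
    linear_combination h
  · rintro ⟨w, hw, rfl⟩
    exact ⟨z * w, mul_ne_zero hz hw, by ring⟩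

lemma adj_iff {x y : F} : (paleyGraph F 3).Adj x y ↔ cub (y - x) := by
  rw [paleyGraph, SimpleGraph.fromRel_adj]
  constructor
  · rintro ⟨_, h | h⟩
    · exact h
    · have : cub (x - y) := h
      rw [← cub_neg] at this
      simpa using this
  · intro h
    refine ⟨?_, Or.inl h⟩
    rintro rfl
    obtain ⟨z, hz, h⟩ := h
    rw [sub_self] at h
    exact hz (pow_eq_zero_iff (by norm_num)|>.mp h.symm)

open Classical in
/-- indicator of nonzero cubes. -/
noncomputable def ind (a : F) : ℂ := if cub a then 1 else 0

lemma ind_congr {a b : F} (h : cub a ↔ cub b) : ind a = ind b := by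
  by_cases hb : cub b
  · rw [ind, ind, if_pos hb, if_pos (h.mpr hb)]
  · rw [ind, ind, if_neg hb, if_neg (fun h' => hb (h.mp h'))]

lemma ind_eq (χ : MulChar F ℂ) (hχ : χ ≠ 1) (h3 : χ ^ 3 = 1) (a : F) :
    3 * ind a = (1 : MulChar F ℂ) a + χ a + χ⁻¹ a := by
  have hcube : ∀ b : F, b ≠ 0 → χ b ^ 3 = 1 := by
    intro b hb
    rw [← MulChar.pow_apply' _ (by norm_num), h3]
    exact MulChar.one_apply (isUnit_iff_ne_zero.mpr hb)
  by_cases ha : a = 0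
  · subst ha
    have : ¬ cub (0 : F) := by
      rintro ⟨z, hz, h⟩
      exact hz (pow_eq_zero_iff (by norm_num)|>.mp h.symm)
    rw [ind, if_neg this, MulChar.map_zero, MulChar.map_zero, MulChar.map_zero]
    ring
  have hu : IsUnit a := isUnit_iff_ne_zero.mpr ha
  have hinv : χ⁻¹ a = χ a ^ 2 := by
    have : χ⁻¹ = χ ^ 2 := by
      rw [inv_eq_iff_mul_eq_one, ← pow_succ', h3]
    rw [this, MulChar.pow_apply' _ (by norm_num)]
  rw [MulChar.one_apply hu, hinv]
  by_cases hc : cub a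
  · rw [ind, if_pos hc]
    obtain ⟨z, hz, rfl⟩ := hc
    rw [map_pow, hcube z hz]; norm_num
  · rw [ind, if_neg hc]
    have hne : χ a ≠ 1 := by
      intro h1
      apply hc
      obtain ⟨g, hg⟩ := IsCyclic.exists_generator (α := Fˣ)
      have hχg : χ (g : F) ≠ 1 := by
        intro h
        apply hχ
        ext v
        obtain ⟨k, hk⟩ := hg v
        obtain ⟨k, rfl⟩ := (mem_powers_iff_mem_zpowers.mpr (hg v))
        simp [h]
      obtain ⟨k, hk⟩ := (mem_powers_iff_mem_zpowers.mpr (hg hu.unit))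
      have hk' : a = (g : F) ^ k := by
        have := congrArg (Units.val) hk
        simpa using this.symm
      have hord : orderOf (χ (g : F)) = 3 :=
        orderOf_eq_prime (hcube _ g.ne_zero) hχg
      rw [hk', map_pow] at h1
      have hdv := orderOf_dvd_of_pow_eq_one h1
      rw [hord] at hdv
      obtain ⟨c, rfl⟩ := hdv
      exact ⟨(g : F) ^ c, pow_ne_zero _ g.ne_zero, by rw [hk']; ring⟩
    have : (χ a - 1) * (1 + χ a + χ a ^ 2) = 0 := by linear_combination hcube a ha
    rcases mul_eq_zero.mp this with h | h
    · exact absurd (sub_eq_zero.mp h) hne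
    · rw [h]; ring

lemma sum_ind (χ : MulChar F ℂ) (hχ : χ ≠ 1) (h3 : χ ^ 3 = 1) :
    3 * ∑ a : F, ind a = Fintype.card F - 1 := by
  classical
  rw [Finset.mul_sum, Finset.sum_congr rfl fun a _ => ind_eq χ hχ h3 a, Finset.sum_add_distrib,
    Finset.sum_add_distrib, MulChar.sum_eq_zero_of_ne_one hχ,
    MulChar.sum_eq_zero_of_ne_one (inv_ne_one.mpr hχ), MulChar.sum_one_eq_card_units,
    Fintype.card_units, Nat.cast_sub Fintype.card_pos]
  simp

lemma sum_ind_ind (χ : MulChar F ℂ) (hχ : χ ≠ 1) (h3 : χ ^ 3 = 1) :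
    9 * ∑ t : F, ind t * ind (1 - t) =
      Fintype.card F - 8 + jacobiSum χ χ + jacobiSum χ⁻¹ χ⁻¹ := by
  have hn : χ (-1) = 1 := chi_neg_one χ h3
  have e : 9 * ∑ t : F, ind t * ind (1 - t) =
      jacobiSum (1 : MulChar F ℂ) 1 + jacobiSum 1 χ + jacobiSum 1 χ⁻¹ + jacobiSum χ 1 +
      jacobiSum χ χ + jacobiSum χ χ⁻¹ + jacobiSum χ⁻¹ 1 + jacobiSum χ⁻¹ χ +
      jacobiSum χ⁻¹ χ⁻¹ := by
    simp only [jacobiSum, ← Finset.sum_add_distrib]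
    rw [Finset.mul_sum]
    refine Finset.sum_congr rfl fun t _ => ?_
    have : 9 * (ind t * ind (1 - t)) = (3 * ind t) * (3 * ind (1 - t)) := by ring
    rw [this, ind_eq χ hχ h3, ind_eq χ hχ h3]
    ring
  rw [e, jacobiSum_comm χ 1, jacobiSum_comm χ⁻¹ 1, jacobiSum_comm χ⁻¹ χ, jacobiSum_one_one,
    jacobiSum_one_nontrivial hχ, jacobiSum_one_nontrivial (inv_ne_one.mpr hχ),
    jacobiSum_nontrivial_inv hχ, hn]
  ring

lemma sum_triples : ∑ x : F, ∑ y : F, ∑ z : F, ind (y - x) * ind (z - x) * ind (z - y) =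
    Fintype.card F * (∑ a : F, ind a) * ∑ t : F, ind t * ind (1 - t) := by
  have h1 : ∀ x : F, ∑ y : F, ∑ z : F, ind (y - x) * ind (z - x) * ind (z - y) =
      ∑ a : F, ∑ b : F, ind a * ind b * ind (b - a) := by
    intro x
    rw [← Equiv.sum_comp (Equiv.addRight x)]
    refine Finset.sum_congr rfl fun a _ => ?_
    rw [← Equiv.sum_comp (Equiv.addRight x)]
    refine Finset.sum_congr rfl fun b _ => ?_
    simp
  have h2 : ∀ a : F, ∑ b : F, ind a * ind b * ind (b - a) =
      ind a * ∑ t : F, ind t * ind (1 - t) := by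
    intro a
    by_cases ha : cub a
    · have ha0 : a ≠ 0 := by
        obtain ⟨z, hz, rfl⟩ := ha
        exact pow_ne_zero _ hz
      rw [← Equiv.sum_comp (Equiv.mulLeft₀ a ha0), Finset.mul_sum]
      refine Finset.sum_congr rfl fun t _ => ?_
      have e1 : ind (a * t) = ind t := by
        exact ind_congr (cub_mul ha)
      have e2 : ind (a * t - a) = ind (1 - t) := by
        have : a * t - a = a * (-(1 - t)) := by ring
        rw [this]
        exact ind_congr ((cub_mul ha).trans cub_neg)
      have e3 : (Equiv.mulLeft₀ a ha0) t = a * t := rfl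
      rw [e3, e1, e2, mul_assoc]
    · have : ind a = 0 := if_neg ha
      simp [this]
  simp only [h1, h2]
  rw [Finset.sum_const, ← Finset.sum_mul, nsmul_eq_mul, Finset.card_univ, mul_assoc]

lemma card_triples {V : Type*} [Fintype V] (G : SimpleGraph V) :
    Nat.card {t : V × V × V // G.Adj t.1 t.2.1 ∧ G.Adj t.1 t.2.2 ∧ G.Adj t.2.1 t.2.2} =
      6 * G.cliqueCount 3 := by
  classical
  rw [SimpleGraph.cliqueCount, Nat.card_eq_fintype_card, Nat.card_eq_fintype_card,
    Fintype.card_subtype, Fintype.card_subtype, mul_comm]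
  rw [Finset.card_eq_sum_card_fiberwise (f := fun t : V × V × V => ({t.1, t.2.1, t.2.2} : Finset V))
    (t := Finset.univ.filter fun s : Finset V => G.IsNClique 3 s), Finset.sum_const_nat]
  · intro s hs
    obtain ⟨a, b, c, hab, hac, hbc, rfl⟩ :=
      SimpleGraph.is3Clique_iff.mp (Finset.mem_filter.mp hs).2
    have n1 := hab.ne
    have n2 := hac.ne
    have n3 := hbc.ne
    have : Finset.filter (fun t : V × V × V => ({t.1, t.2.1, t.2.2} : Finset V) = {a, b, c})
        (Finset.univ.filter fun t : V × V × V =>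
          G.Adj t.1 t.2.1 ∧ G.Adj t.1 t.2.2 ∧ G.Adj t.2.1 t.2.2) =
        {(a, b, c), (a, c, b), (b, a, c), (b, c, a), (c, a, b), (c, b, a)} := by
      ext ⟨x, y, z⟩
      simp only [Finset.mem_filter, Finset.mem_univ, true_and, Finset.mem_insert,
        Finset.mem_singleton, Prod.mk.injEq]
      constructor
      · rintro ⟨⟨h1, h2, h3⟩, h⟩
        have m1 := h1.ne
        have m2 := h2.ne
        have m3 := h3.ne
        have hx : x ∈ ({a, b, c} : Finset V) := by rw [← h]; simp
        have hy : y ∈ ({a, b, c} : Finset V) := by rw [← h]; simp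
        have hz : z ∈ ({a, b, c} : Finset V) := by rw [← h]; simp
        simp only [Finset.mem_insert, Finset.mem_singleton] at hx hy hz
        grind
      · have hba := hab.symm
        have hca := hac.symm
        have hcb := hbc.symm
        rintro (⟨rfl, rfl, rfl⟩ | ⟨rfl, rfl, rfl⟩ | ⟨rfl, rfl, rfl⟩ | ⟨rfl, rfl, rfl⟩ |
          ⟨rfl, rfl, rfl⟩ | ⟨rfl, rfl, rfl⟩) <;> refine ⟨⟨by assumption, by assumption,
            by assumption⟩, ?_⟩ <;> ext w <;> simp only [Finset.mem_insert,
              Finset.mem_singleton] <;> tauto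
    rw [this]
    simp [Finset.card_insert_of_notMem, n1, n2, n3, n1.symm, n2.symm, n3.symm]
  · rintro ⟨x, y, z⟩ ht
    have ht := (Finset.mem_filter.mp ht).2
    exact Finset.mem_coe.mpr (Finset.mem_filter.mpr
      ⟨Finset.mem_univ _, SimpleGraph.is3Clique_triple_iff.mpr ht⟩)

lemma count_formula (χ : MulChar F ℂ) (hχ : χ ≠ 1) (h3 : χ ^ 3 = 1) :
    (162 : ℂ) * ((paleyGraph F 3).cliqueCount 3 : ℂ) =
      Fintype.card F * (Fintype.card F - 1) *
        (Fintype.card F - 8 + jacobiSum χ χ + jacobiSum χ⁻¹ χ⁻¹) := by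
  classical
  have h := card_triples (paleyGraph F 3)
  have h' : ((6 * (paleyGraph F 3).cliqueCount 3 : ℕ) : ℂ) =
      ∑ x : F, ∑ y : F, ∑ z : F, ind (y - x) * ind (z - x) * ind (z - y) := by
    rw [← h, Nat.card_eq_fintype_card, Fintype.card_subtype, Finset.card_filter,
      Fintype.sum_prod_type, Nat.cast_sum]
    refine Finset.sum_congr rfl fun x _ => ?_
    rw [Fintype.sum_prod_type, Nat.cast_sum]
    refine Finset.sum_congr rfl fun y _ => ?_
    rw [Nat.cast_sum]
    refine Finset.sum_congr rfl fun z _ => ?_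
    simp only [adj_iff, ind]
    by_cases a1 : cub (y - x) <;> by_cases a2 : cub (z - x) <;> by_cases a3 : cub (z - y) <;>
      simp [a1, a2, a3]
  rw [sum_triples] at h'
  rw [← sum_ind χ hχ h3, ← sum_ind_ind χ hχ h3]
  push_cast at h'
  linear_combination 27 * h'

end count

end PaleyAux

/-- Let `p ≡ 1 (mod 3)` be prime with `p = x₀² + 27y₀²`, `x₀ ≡ 1 (mod 3)`, `p ∤ x₀`. With
`c_ℓ = -(x₀+3√3·y₀·i)^ℓ - (x₀-3√3·y₀·i)^ℓ`, the number of triangles in `Γ(3, p^ℓ)` is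
`p^ℓ(p^ℓ-1)(p^ℓ+c_ℓ-8)/162` for every `ℓ ≥ 1`. -/
theorem triangleCount_paley_three_prime_ext (p : ℕ) (x₀ y₀ : ℤ)
    (hp : p.Prime) (hp3 : p % 3 = 1)
    (hxy : (p : ℤ) = x₀ ^ 2 + 27 * y₀ ^ 2) (hx3 : x₀ % 3 = 1) (hpx : ¬ (p : ℤ) ∣ x₀)
    (ℓ : ℕ) (hℓ : 1 ≤ ℓ)
    (F : Type*) [Field F] [Fintype F] (hF : Fintype.card F = p ^ ℓ) :
    (162 : ℂ) * ((paleyGraph F 3).cliqueCount 3 : ℂ) =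
      (p : ℂ) ^ ℓ * ((p : ℂ) ^ ℓ - 1) *
        ((p : ℂ) ^ ℓ +
          (-((x₀ : ℂ) + 3 * Real.sqrt 3 * (y₀ : ℂ) * I) ^ ℓ -
            ((x₀ : ℂ) - 3 * Real.sqrt 3 * (y₀ : ℂ) * I) ^ ℓ) - 8) := by
  have : Fact p.Prime := ⟨hp⟩
  have : CharP F p := charP_of_card_eq_prime_pow hF
  let _ : Algebra (ZMod p) F := ZMod.algebra F p
  have hfin : Module.finrank (ZMod p) F = ℓ := by
    have h := Module.card_eq_pow_finrank (K := ZMod p) (V := F)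
    rw [hF, ZMod.card] at h
    exact (Nat.pow_right_injective hp.two_le h).symm
  obtain ⟨χ, hne, h3, hJ⟩ := PaleyAux.jacobi_base p x₀ y₀ hp3 hxy hx3
  have h1 := PaleyAux.chi_neg_one χ h3
  have hinv3 : χ⁻¹ ^ 3 = 1 := by rw [inv_pow, h3, inv_one]
  have hl : (PaleyAux.liftChar χ F)⁻¹ = PaleyAux.liftChar χ⁻¹ F := by
    ext u
    rw [MulChar.inv_apply', PaleyAux.liftChar_apply, PaleyAux.liftChar_apply,
      MulChar.inv_apply', Algebra.norm_inv]
  rw [PaleyAux.count_formula (PaleyAux.liftChar χ F) (PaleyAux.liftChar_ne_one χ hne)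
    (PaleyAux.liftChar_pow χ h3), hl, PaleyAux.jacobi_lift χ hne h1,
    PaleyAux.jacobi_lift χ⁻¹ (inv_ne_one.mpr hne) (PaleyAux.chi_neg_one _ hinv3), hfin, hF]
  push_cast
  rcases hJ with ⟨e1, e2⟩ | ⟨e1, e2⟩ <;> rw [e1, e2] <;> ring
end
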